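/- arXiv:2311.09095 — 3 statements merged into one kernel-verified Lean document; each statement's English description precedes it below -/
import Mathlib

section
/- There exist universal constants c, C > 0 such that the following holds. Let X, Y, Z be finite nonempty sets, let A ∈ {0,1}^{X×Y} and B ∈ {0,1}^{Y×Z}, let ε ∈ (0,1), γ ∈ (0,1/2) and d ≥ 1, and assume E[B] ≥ 2^{−d}. Then there exist nonempty Y* ⊆ Y, nonempty Z* ⊆ Z, an integer L ≥ 1, and tuples {(X_ℓ, Y_ℓ, Z_ℓ, A_ℓ)}_{ℓ=1}^L with nonempty X_ℓ ⊆ X, nonempty Y_ℓ ⊆ Y*, nonempty Z_ℓ ⊆ Z*, and A_ℓ ∈ {0,1}^{X_ℓ×Y_ℓ}, such that: (1) for every (x,y) ∈ X×Y*, A(x,y) = Σ_{ℓ : x∈X_ℓ, y∈Y_ℓ} A_ℓ(x,y); (2) for every ℓ ∈ [L], writing B_ℓ = B[Y_ℓ,Z_ℓ], either E[A_ℓ] ≤ 2^{−d}, or both A_ℓ and B_ℓ^T are (ε,2,d)-regular and ε-min-degree; (3) E[B[Y*,Z*]] ≥ E[B]; (4) Σ_{ℓ=1}^L |X_ℓ|·|Y_ℓ|·|Z_ℓ|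 ≤ (d+2)·|X|·|Y*|·|Z*|; (5) Σ_{ℓ=1}^L |X_ℓ|·|Y_ℓ|·|Z*∖Z_ℓ| ≤ γ·(d+2)·|X|·|Y*|·|Z*|; (6) |Y*|·|Z*| ≥ exp(−C·d^4·γ^{−1}·ε^{−c})·|Y|·|Z|; (7) L ≤ exp(C·d^3·ε^{−c}). -/
open Finset

/-- The density `E[A]` of a matrix restricted to the rectangle `Sx × Sy`. -/
noncomputable def density {X Y : Type*} (Sx : Finset X) (Sy : Finset Y) (A : X → Y → ℝ) : ℝ :=
  (∑ x ∈ Sx, ∑ y ∈ Sy, A x y) / ((Sx.card : ℝ) * (Sy.card : ℝ))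

/-- The (relative) degree `deg_A(x)` of a row `x`, with columns restricted to `Sy`. -/
noncomputable def rowDeg {X Y : Type*} (Sy : Finset Y) (A : X → Y → ℝ) (x : X) : ℝ :=
  (∑ y ∈ Sy, A x y) / (Sy.card : ℝ)

/-- The `(k,ℓ)`-grid norm `‖A‖_{U(k,ℓ)}` of a matrix restricted to the rectangle `Sx × Sy`:
the `(kℓ)`-th root of the average of `∏_{i,j} A(x_i, y_j)` over all tuples
`x_1, …, x_k ∈ Sx`, `y_1, …, y_ℓ ∈ Sy`. -/
noncomputable def gridNorm {X Y : Type*} (Sx : Finset X) (Sy : Finset Y) (k l : ℕ)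
    (A : X → Y → ℝ) : ℝ :=
  ((∑ xs ∈ Fintype.piFinset (fun _ : Fin k => Sx),
      ∑ ys ∈ Fintype.piFinset (fun _ : Fin l => Sy),
      ∏ i : Fin k, ∏ j : Fin l, A (xs i) (ys j)) /
    ((Sx.card : ℝ) ^ k * (Sy.card : ℝ) ^ l)) ^ ((1 : ℝ) / (k * l))

/-- `A` (restricted to `Sx × Sy`) is `(ε,k,ℓ)`-regular if `‖A‖_{U(k,ℓ)} ≤ (1+ε)·E[A]`. -/
def GridRegular {X Y : Type*} (Sx : Finset X) (Sy : Finset Y) (ε : ℝ) (k l : ℕ)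
    (A : X → Y → ℝ) : Prop :=
  gridNorm Sx Sy k l A ≤ (1 + ε) * density Sx Sy A

/-- `A` (restricted to `Sx × Sy`) is `ε`-min-degree if every row has degree
at least `(1-ε)·E[A]`. -/
def MinDegree {X Y : Type*} (Sx : Finset X) (Sy : Finset Y) (ε : ℝ) (A : X → Y → ℝ) : Prop :=
  ∀ x ∈ Sx, (1 - ε) * density Sx Sy A ≤ rowDeg Sy A x

/-- `A` is a zero-one matrix on the rectangle `Sx × Sy`. -/
def ZeroOne {X Y : Type*} (Sx : Finset X) (Sy : Finset Y) (A : X → Y → ℝ) : Prop :=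
  ∀ x ∈ Sx, ∀ y ∈ Sy, A x y = 0 ∨ A x y = 1

open scoped Classical

section Basic

variable {X Y : Type*} {Sx X' : Finset X} {Sy Y' : Finset Y} {A : X → Y → ℝ}

theorem card_mul_card_pos (hx : Sx.Nonempty) (hy : Sy.Nonempty) :
    0 < (Sx.card : ℝ) * (Sy.card : ℝ) := by
  have h1 := hx.card_pos
  have h2 := hy.card_pos
  positivity

theorem card_mul_card_le (hx : X' ⊆ Sx) (hy : Y' ⊆ Sy) :
    (X'.card : ℝ) * (Y'.card : ℝ) ≤ (Sx.card : ℝ) * (Sy.card : ℝ) := by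
  have h1 := card_le_card hx
  have h2 := card_le_card hy
  gcongr

theorem density_mul_card (hx : Sx.Nonempty) (hy : Sy.Nonempty) :
    density Sx Sy A * ((Sx.card : ℝ) * (Sy.card : ℝ)) = ∑ x ∈ Sx, ∑ y ∈ Sy, A x y :=
  div_mul_cancel₀ _ (card_mul_card_pos hx hy).ne'

theorem sum_rowDeg_mul_card (hy : Sy.Nonempty) :
    (∑ x ∈ X', rowDeg Sy A x) * Sy.card = ∑ x ∈ X', ∑ y ∈ Sy, A x y := by
  have := hy.card_pos
  rw [sum_mul]
  refine sum_congr rfl fun x _ => ?_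
  unfold rowDeg
  field_simp

namespace ZeroOne

theorem mono (h : ZeroOne Sx Sy A) (hx : X' ⊆ Sx) (hy : Y' ⊆ Sy) : ZeroOne X' Y' A :=
  fun x hx' y hy' => h x (hx hx') y (hy hy')

theorem swap (h : ZeroOne Sx Sy A) : ZeroOne Sy Sx (fun y x => A x y) :=
  fun y hy x hx => h x hx y hy

theorem nonneg (h : ZeroOne Sx Sy A) {x : X} (hx : x ∈ Sx) {y : Y} (hy : y ∈ Sy) :
    0 ≤ A x y := by
  rcases h x hx y hy with h | h <;> simp [h]

theorem le_one (h : ZeroOne Sx Sy A) {x : X} (hx : x ∈ Sx) {y : Y} (hy : y ∈ Sy) :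
    A x y ≤ 1 := by
  rcases h x hx y hy with h | h <;> simp [h]

theorem sum_nonneg (h : ZeroOne Sx Sy A) : 0 ≤ ∑ x ∈ Sx, ∑ y ∈ Sy, A x y :=
  Finset.sum_nonneg fun _ hx => Finset.sum_nonneg fun _ hy => h.nonneg hx hy

theorem sum_le_card (h : ZeroOne Sx Sy A) :
    ∑ x ∈ Sx, ∑ y ∈ Sy, A x y ≤ (Sx.card : ℝ) * (Sy.card : ℝ) := by
  calc ∑ x ∈ Sx, ∑ y ∈ Sy, A x y ≤ ∑ _x ∈ Sx, ∑ _y ∈ Sy, (1 : ℝ) :=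
        sum_le_sum fun x hx => sum_le_sum fun y hy => h.le_one hx hy
    _ = _ := by simp

theorem density_nonneg (h : ZeroOne Sx Sy A) : 0 ≤ density Sx Sy A :=
  div_nonneg h.sum_nonneg (by positivity)

theorem density_le_one (h : ZeroOne Sx Sy A) : density Sx Sy A ≤ 1 :=
  div_le_one_of_le₀ h.sum_le_card (by positivity)

theorem one_le_sum (h : ZeroOne Sx Sy A) (hpos : 0 < ∑ x ∈ Sx, ∑ y ∈ Sy, A x y) :
    1 ≤ ∑ x ∈ Sx, ∑ y ∈ Sy, A x y := by
  obtain ⟨x, hx, hx'⟩ := exists_ne_zero_of_sum_ne_zero hpos.ne'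
  obtain ⟨y, hy, hy'⟩ := exists_ne_zero_of_sum_ne_zero hx'
  calc (1 : ℝ) = A x y := ((h x hx y hy).resolve_left hy').symm
    _ ≤ ∑ y ∈ Sy, A x y := single_le_sum (fun y hy => h.nonneg hx hy) hy
    _ ≤ _ := single_le_sum (f := fun x => ∑ y ∈ Sy, A x y)
        (fun x hx => Finset.sum_nonneg fun y hy => h.nonneg hx hy) hx

end ZeroOne

end Basic

section Regularity

variable {X Y : Type*} {Sx : Finset X} {Sy : Finset Y} {A : X → Y → ℝ}

/-- A mass bound on all subrectangles extends to `[0,1]`-valued row weights. -/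
theorem sum_weight_mul_le {b t : ℝ}
    (H : ∀ X' ⊆ Sx, ∀ Y' ⊆ Sy,
      ∑ x ∈ X', ∑ y ∈ Y', A x y ≤ b * ((X'.card : ℝ) * (Y'.card : ℝ)) + t)
    {u : X → ℝ} (hu0 : ∀ x ∈ Sx, 0 ≤ u x) (hu1 : ∀ x ∈ Sx, u x ≤ 1)
    {Y' : Finset Y} (hY : Y' ⊆ Sy) :
    ∑ x ∈ Sx, u x * ∑ y ∈ Y', A x y ≤ b * ∑ x ∈ Sx, u x * (Y'.card : ℝ) + t := by
  set g : X → ℝ := fun x => ∑ y ∈ Y', A x y - b * Y'.card with hg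
  have h1 : ∑ x ∈ Sx, u x * g x ≤ ∑ x ∈ Sx with 0 < g x, g x := by
    rw [sum_filter]
    refine sum_le_sum fun x hx => ?_
    have h0 := hu0 x hx
    have h1 := hu1 x hx
    split_ifs with h
    · nlinarith
    · nlinarith
  have h2 := H _ (filter_subset (fun x => 0 < g x) Sx) Y' hY
  have h3 : ∑ x ∈ Sx with 0 < g x, g x
      = ∑ x ∈ Sx with 0 < g x, ∑ y ∈ Y', A x y
        - b * (((Sx.filter fun x => 0 < g x).card : ℝ) * (Y'.card : ℝ)) := by
    simp only [hg, sum_sub_distrib, sum_const, nsmul_eq_mul]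
    ring
  have h4 : ∑ x ∈ Sx, u x * g x
      = ∑ x ∈ Sx, u x * ∑ y ∈ Y', A x y - b * ∑ x ∈ Sx, u x * (Y'.card : ℝ) := by
    rw [mul_sum, ← sum_sub_distrib]
    exact sum_congr rfl fun x _ => by simp only [hg]; ring
  linarith

theorem sum_piFinset_fin_two (S : Finset X) (f : X → X → ℝ) :
    ∑ xs ∈ Fintype.piFinset (fun _ : Fin 2 => S), f (xs 0) (xs 1)
      = ∑ x ∈ S, ∑ x' ∈ S, f x x' := by
  rw [← sum_product']
  refine sum_nbij' (fun xs => (xs 0, xs 1)) (fun p => ![p.1, p.2]) ?_ ?_ ?_ ?_ ?_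
  · intro xs h
    rw [Fintype.mem_piFinset] at h
    simp [h]
  · intro p h
    rw [mem_product] at h
    rw [Fintype.mem_piFinset]
    intro i
    fin_cases i <;> simp [h]
  · intro xs _
    ext i
    fin_cases i <;> rfl
  · intro p _
    rfl
  · intro xs _
    rfl

/-- The relative codegree of two rows. -/
noncomputable def codeg (Sy : Finset Y) (A : X → Y → ℝ) (x x' : X) : ℝ :=
  (∑ y ∈ Sy, A x y * A x' y) / (Sy.card : ℝ)

theorem gridNorm_two_eq (hy : Sy.Nonempty) (d : ℕ) :
    gridNorm Sx Sy 2 d A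
      = ((∑ x ∈ Sx, ∑ x' ∈ Sx, codeg Sy A x x' ^ d) / (Sx.card : ℝ) ^ 2)
          ^ ((1 : ℝ) / ((2 : ℕ) * d)) := by
  unfold gridNorm
  congr 1
  have hy' := hy.card_pos
  have h : ∑ xs ∈ Fintype.piFinset (fun _ : Fin 2 => Sx),
      ∑ ys ∈ Fintype.piFinset (fun _ : Fin d => Sy),
        ∏ i : Fin 2, ∏ j : Fin d, A (xs i) (ys j)
      = ∑ x ∈ Sx, ∑ x' ∈ Sx, (∑ y ∈ Sy, A x y * A x' y) ^ d := by
    rw [← sum_piFinset_fin_two]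
    refine sum_congr rfl fun xs _ => ?_
    simp only [Fin.prod_univ_two, ← prod_mul_distrib]
    rw [sum_prod_piFinset Sy (fun _ y => A (xs 0) y * A (xs 1) y)]
    simp
  rw [h]
  simp only [codeg, div_pow, ← sum_div]
  rw [div_div, mul_comm ((Sx.card : ℝ) ^ 2)]

theorem codeg_nonneg (hA : ZeroOne Sx Sy A) {x x' : X} (hx : x ∈ Sx) (hx' : x' ∈ Sx) :
    0 ≤ codeg Sy A x x' :=
  div_nonneg (sum_nonneg fun _ hy => mul_nonneg (hA.nonneg hx hy) (hA.nonneg hx' hy))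
    (by positivity)

theorem codeg_le_one (hA : ZeroOne Sx Sy A) {x x' : X} (hx : x ∈ Sx) (hx' : x' ∈ Sx) :
    codeg Sy A x x' ≤ 1 := by
  refine div_le_one_of_le₀ ?_ (by positivity)
  calc ∑ y ∈ Sy, A x y * A x' y ≤ ∑ _y ∈ Sy, (1 : ℝ) :=
        sum_le_sum fun y hy =>
          mul_le_one₀ (hA.le_one hx hy) (hA.nonneg hx' hy) (hA.le_one hx' hy)
    _ = _ := by simp

theorem sum_codeg_pow_succ_le (hA : ZeroOne Sx Sy A) (hy : Sy.Nonempty) {b t : ℝ} (hb : 0 ≤ b)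
    (H : ∀ X' ⊆ Sx, ∀ Y' ⊆ Sy, ∑ x ∈ X', ∑ y ∈ Y', A x y
      ≤ b * ((X'.card : ℝ) * (Y'.card : ℝ)) + t * ((Sx.card : ℝ) * (Sy.card : ℝ))) (j : ℕ) :
    ∑ x ∈ Sx, ∑ x' ∈ Sx, codeg Sy A x x' ^ (j + 1)
      ≤ b ^ 2 * ∑ x ∈ Sx, ∑ x' ∈ Sx, codeg Sy A x x' ^ j
        + (b + 1) * t * (Sx.card : ℝ) ^ 2 := by
  have hy' : (0 : ℝ) < Sy.card := by exact_mod_cast hy.card_pos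
  have hu0 : ∀ x ∈ Sx, ∀ x' ∈ Sx, 0 ≤ codeg Sy A x x' ^ j := fun x hx x' hx' =>
    pow_nonneg (codeg_nonneg hA hx hx') j
  have hu1 : ∀ x ∈ Sx, ∀ x' ∈ Sx, codeg Sy A x x' ^ j ≤ 1 := fun x hx x' hx' =>
    pow_le_one₀ (codeg_nonneg hA hx hx') (codeg_le_one hA hx hx')
  have key1 : ∀ x ∈ Sx, ∑ x' ∈ Sx, codeg Sy A x x' ^ j * ∑ y ∈ Sy, A x y * A x' y
      ≤ b * ∑ x' ∈ Sx, codeg Sy A x x' ^ j * ∑ y ∈ Sy, A x y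
        + t * ((Sx.card : ℝ) * (Sy.card : ℝ)) := by
    intro x hx
    have h := sum_weight_mul_le H (hu0 x hx) (hu1 x hx) (filter_subset (fun y => A x y = 1) Sy)
    have e1 : ∀ x', ∑ y ∈ Sy with A x y = 1, A x' y = ∑ y ∈ Sy, A x y * A x' y := by
      intro x'
      rw [sum_filter]
      refine sum_congr rfl fun y hy => ?_
      rcases hA x hx y hy with h | h <;> simp [h]
    have e2 : ((Sy.filter fun y => A x y = 1).card : ℝ) = ∑ y ∈ Sy, A x y := by
      rw [card_filter]
      push_cast
      refine sum_congr rfl fun y hy => ?_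
      rcases hA x hx y hy with h | h <;> simp [h]
    simpa only [e1, e2] using h
  have key2 : ∀ x' ∈ Sx, ∑ x ∈ Sx, codeg Sy A x x' ^ j * ∑ y ∈ Sy, A x y
      ≤ b * ∑ x ∈ Sx, codeg Sy A x x' ^ j * (Sy.card : ℝ)
        + t * ((Sx.card : ℝ) * (Sy.card : ℝ)) := fun x' hx' =>
    sum_weight_mul_le H (fun x hx => hu0 x hx x' hx') (fun x hx => hu1 x hx x' hx') subset_rfl
  have s1 := sum_le_sum key1
  have s2 := sum_le_sum key2
  rw [sum_comm] at s2
  simp only [sum_add_distrib, sum_const, nsmul_eq_mul, ← mul_sum] at s1 s2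
  have s3 : ∑ x ∈ Sx, ∑ x' ∈ Sx, codeg Sy A x x' ^ j * (Sy.card : ℝ)
      = (∑ x ∈ Sx, ∑ x' ∈ Sx, codeg Sy A x x' ^ j) * Sy.card := by
    simp only [sum_mul]
  have s4 : ∑ x ∈ Sx, ∑ x' ∈ Sx, codeg Sy A x x' ^ j * ∑ y ∈ Sy, A x y * A x' y
      = (∑ x ∈ Sx, ∑ x' ∈ Sx, codeg Sy A x x' ^ (j + 1)) * Sy.card := by
    simp only [sum_mul]
    refine sum_congr rfl fun x _ => sum_congr rfl fun x' _ => ?_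
    rw [pow_succ, mul_assoc]
    congr 1
    exact (div_mul_cancel₀ _ hy'.ne').symm
  rw [s4] at s1
  rw [sum_comm (f := fun y x => codeg Sy A x y ^ j * (Sy.card : ℝ)), s3] at s2
  have s5 := mul_le_mul_of_nonneg_left s2 hb
  refine le_of_mul_le_mul_right ?_ hy'
  linarith

/-- If no subrectangle carries noticeably more mass than expected, the matrix is regular. -/
theorem gridRegular_of_sum_le (hA : ZeroOne Sx Sy A) (hx : Sx.Nonempty) (hy : Sy.Nonempty)
    {ε t : ℝ} {d : ℕ} (hε0 : 0 < ε) (hε1 : ε < 1) (hd : 1 ≤ d)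
    (ht : 5 / 2 * t ≤ ε * density Sx Sy A ^ (2 * d)) (ht0 : 0 ≤ t)
    (H : ∀ X' ⊆ Sx, ∀ Y' ⊆ Sy, ∑ x ∈ X', ∑ y ∈ Y', A x y
      ≤ (1 + ε / 2) * density Sx Sy A * ((X'.card : ℝ) * (Y'.card : ℝ))
        + t * ((Sx.card : ℝ) * (Sy.card : ℝ))) :
    GridRegular Sx Sy ε 2 d A := by
  set α := density Sx Sy A with hα
  have hα0 : 0 ≤ α := hA.density_nonneg
  have hα1 : α ≤ 1 := hA.density_le_one
  have hx' : (0 : ℝ) < Sx.card := by exact_mod_cast hx.card_pos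
  set a := (1 + ε) * α with ha
  set b := (1 + ε / 2) * α with hb
  have hb0 : 0 ≤ b := by positivity
  have ha0 : 0 ≤ a := by positivity
  have step : ∀ j ≤ d, ∑ x ∈ Sx, ∑ x' ∈ Sx, codeg Sy A x x' ^ j
      ≤ a ^ (2 * j) * (Sx.card : ℝ) ^ 2 := by
    intro j
    induction j with
    | zero => intro _; simp [sq]
    | succ j ih =>
      intro hj
      have h1 := sum_codeg_pow_succ_le hA hy hb0 H j
      have h2 := mul_le_mul_of_nonneg_left (ih (by omega)) (sq_nonneg b)
      have h3 : (b + 1) * t ≤ a ^ (2 * j) * (a ^ 2 - b ^ 2) := by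
        have e1 : (b + 1) * t ≤ 5 / 2 * t := by
          have : b ≤ 3 / 2 := by nlinarith
          nlinarith
        have e2 : α ^ (2 * d) ≤ α ^ (2 * j) * α ^ 2 := by
          rw [← pow_add]
          exact pow_le_pow_of_le_one hα0 hα1 (by omega)
        have e3 : ε * α ^ 2 ≤ a ^ 2 - b ^ 2 := by
          have : a ^ 2 - b ^ 2 = (ε + 3 / 4 * ε ^ 2) * α ^ 2 := by rw [ha, hb]; ring
          rw [this]
          gcongr
          nlinarith [sq_nonneg ε]
        have e4 : α ^ (2 * j) ≤ a ^ (2 * j) := by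
          gcongr
          rw [ha]; nlinarith
        calc (b + 1) * t ≤ ε * α ^ (2 * d) := e1.trans ht
          _ ≤ ε * (α ^ (2 * j) * α ^ 2) := by gcongr
          _ = α ^ (2 * j) * (ε * α ^ 2) := by ring
          _ ≤ a ^ (2 * j) * (a ^ 2 - b ^ 2) := by
            have : 0 ≤ ε * α ^ 2 := by positivity
            gcongr
      have h4 := mul_le_mul_of_nonneg_right h3 (sq_nonneg (Sx.card : ℝ))
      have : a ^ (2 * (j + 1)) = a ^ (2 * j) * a ^ 2 := by rw [← pow_add]; rfl
      rw [this]
      nlinarith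
  unfold GridRegular
  rw [gridNorm_two_eq hy]
  have hF := step d le_rfl
  have hd' : (d : ℝ) ≠ 0 := by positivity
  calc _ ≤ (a ^ (2 * d)) ^ ((1 : ℝ) / ((2 : ℕ) * d)) := by
        refine Real.rpow_le_rpow ?_ ?_ (by positivity)
        · exact div_nonneg (sum_nonneg fun x hx => sum_nonneg fun x' hx' =>
            pow_nonneg (codeg_nonneg hA hx hx') _) (by positivity)
        · rw [div_le_iff₀ (by positivity)]
          exact hF
    _ = a := by
        rw [← Real.rpow_natCast, ← Real.rpow_mul ha0]
        push_cast
        rw [mul_one_div_cancel (by positivity), Real.rpow_one]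

end Regularity

section Potential

variable {X Y : Type*} {Sx X' : Finset X} {Sy Y' : Finset Y} {A : X → Y → ℝ} {κ : ℝ}

/-- The rectangle `Sx × Sy` maximizes the size-penalized density `density · (area)^κ` among its
nonempty subrectangles. -/
def PotentialMax (Sx : Finset X) (Sy : Finset Y) (κ : ℝ) (A : X → Y → ℝ) : Prop :=
  ∀ X' ⊆ Sx, X'.Nonempty → ∀ Y' ⊆ Sy, Y'.Nonempty →
    density X' Y' A * ((X'.card : ℝ) * (Y'.card : ℝ)) ^ κ
      ≤ density Sx Sy A * ((Sx.card : ℝ) * (Sy.card : ℝ)) ^ κ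

theorem exists_potentialMax (hx : Sx.Nonempty) (hy : Sy.Nonempty) (κ : ℝ) (A : X → Y → ℝ) :
    ∃ X' ⊆ Sx, ∃ Y' ⊆ Sy, X'.Nonempty ∧ Y'.Nonempty ∧ PotentialMax X' Y' κ A ∧
      density Sx Sy A * ((Sx.card : ℝ) * (Sy.card : ℝ)) ^ κ
        ≤ density X' Y' A * ((X'.card : ℝ) * (Y'.card : ℝ)) ^ κ := by
  obtain ⟨p, hp, hmax⟩ := exists_max_image
    ((Sx.powerset ×ˢ Sy.powerset).filter fun p => p.1.Nonempty ∧ p.2.Nonempty)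
    (fun p => density p.1 p.2 A * ((p.1.card : ℝ) * (p.2.card : ℝ)) ^ κ)
    ⟨(Sx, Sy), by simp [hx, hy]⟩
  simp only [mem_filter, mem_product, mem_powerset] at hp hmax
  obtain ⟨⟨h1, h2⟩, h3, h4⟩ := hp
  exact ⟨p.1, h1, p.2, h2, h3, h4,
    fun X' hX hX' Y' hY hY' => hmax (X', Y') ⟨⟨hX.trans h1, hY.trans h2⟩, hX', hY'⟩,
    hmax (Sx, Sy) ⟨⟨subset_rfl, subset_rfl⟩, hx, hy⟩⟩

/-- Rectangles of maximal potential are at least as dense as the ambient one, and large. -/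
theorem exists_potentialMax_large (hA : ZeroOne Sx Sy A) (hx : Sx.Nonempty) (hy : Sy.Nonempty)
    (hκ : 0 < κ) {D : ℝ} (hD : Real.exp (-D) ≤ density Sx Sy A) :
    ∃ X' ⊆ Sx, ∃ Y' ⊆ Sy, X'.Nonempty ∧ Y'.Nonempty ∧ PotentialMax X' Y' κ A ∧
      density Sx Sy A ≤ density X' Y' A ∧
      Real.exp (-(D / κ)) * ((Sx.card : ℝ) * (Sy.card : ℝ))
        ≤ (X'.card : ℝ) * (Y'.card : ℝ) := by
  obtain ⟨X', hX, Y', hY, hX', hY', hmax, hle⟩ := exists_potentialMax hx hy κ A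
  have hN := card_mul_card_pos hx hy
  have hn := card_mul_card_pos hX' hY'
  have hnN := card_mul_card_le hX hY
  have hA' := hA.mono hX hY
  refine ⟨X', hX, Y', hY, hX', hY', hmax, ?_, ?_⟩
  · refine le_of_mul_le_mul_right (hle.trans ?_) (Real.rpow_pos_of_pos hN κ)
    have := hA'.density_nonneg
    gcongr
  · rw [← Real.rpow_le_rpow_iff (by positivity) hn.le hκ,
      Real.mul_rpow (Real.exp_pos _).le hN.le, ← Real.exp_mul, neg_mul, div_mul_cancel₀ _ hκ.ne']
    calc _ ≤ density Sx Sy A * ((Sx.card : ℝ) * (Sy.card : ℝ)) ^ κ := by gcongr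
      _ ≤ _ := hle
      _ ≤ 1 * ((X'.card : ℝ) * (Y'.card : ℝ)) ^ κ := by
        have := hA'.density_le_one
        gcongr
      _ = _ := one_mul _

namespace PotentialMax

theorem sum_le (h : PotentialMax Sx Sy κ A) (hX : X' ⊆ Sx) (hX' : X'.Nonempty)
    (hY : Y' ⊆ Sy) (hY' : Y'.Nonempty) :
    ∑ x ∈ X', ∑ y ∈ Y', A x y
      ≤ (((Sx.card : ℝ) * (Sy.card : ℝ)) / ((X'.card : ℝ) * (Y'.card : ℝ))) ^ κ
          * density Sx Sy A * ((X'.card : ℝ) * (Y'.card : ℝ)) := by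
  have hn := card_mul_card_pos hX' hY'
  have h1 := h X' hX hX' Y' hY hY'
  rw [← density_mul_card hX' hY', Real.div_rpow (by positivity) hn.le]
  refine mul_le_mul_of_nonneg_right ?_ hn.le
  rw [div_mul_eq_mul_div, le_div_iff₀ (Real.rpow_pos_of_pos hn κ)]
  linarith

theorem sum_le_of_card_le (h : PotentialMax Sx Sy κ A) (hA : ZeroOne Sx Sy A) (hκ : 0 ≤ κ)
    (hX : X' ⊆ Sx) (hY : Y' ⊆ Sy) {D : ℝ}
    (hD : Real.exp (-D) * ((Sx.card : ℝ) * (Sy.card : ℝ)) ≤ (X'.card : ℝ) * (Y'.card : ℝ)) :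
    ∑ x ∈ X', ∑ y ∈ Y', A x y
      ≤ Real.exp (κ * D) * density Sx Sy A * ((X'.card : ℝ) * (Y'.card : ℝ)) := by
  rcases X'.eq_empty_or_nonempty with rfl | hX'
  · simp
  rcases Y'.eq_empty_or_nonempty with rfl | hY'
  · simp
  refine (h.sum_le hX hX' hY hY').trans ?_
  have hn := card_mul_card_pos hX' hY'
  have := hA.density_nonneg
  gcongr
  rw [mul_comm κ, Real.exp_mul]
  gcongr
  rw [div_le_iff₀ hn]
  calc _ = Real.exp D * (Real.exp (-D) * ((Sx.card : ℝ) * (Sy.card : ℝ))) := by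
        rw [← mul_assoc, ← Real.exp_add, add_neg_cancel, Real.exp_zero, one_mul]
    _ ≤ _ := by gcongr

theorem minDegree (h : PotentialMax Sx Sy κ A) (hA : ZeroOne Sx Sy A) (hκ0 : 0 ≤ κ)
    (hκ1 : κ ≤ 1) (hy : Sy.Nonempty) : MinDegree Sx Sy κ A := by
  intro x hx
  have hα := hA.density_nonneg
  have hm : (0 : ℝ) < Sy.card := by exact_mod_cast hy.card_pos
  have hsum := add_sum_erase Sx (fun x => ∑ y ∈ Sy, A x y) hx
  have hdens := density_mul_card (A := A) ⟨x, hx⟩ hy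
  have hcard : ((Sx.erase x).card : ℝ) + 1 = Sx.card := by
    exact_mod_cast card_erase_add_one hx
  rw [rowDeg, le_div_iff₀ hm]
  rcases (Sx.erase x).eq_empty_or_nonempty with he | hne
  · rw [he] at hcard hsum
    simp only [card_empty, Nat.cast_zero, zero_add, sum_empty, add_zero] at hcard hsum
    rw [← hsum, ← hcard] at hdens
    nlinarith [mul_nonneg (mul_nonneg hκ0 hα) hm.le]
  · have hn : (0 : ℝ) < (Sx.erase x).card := by exact_mod_cast hne.card_pos
    have h1 := h.sum_le (erase_subset x Sx) hne subset_rfl hy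
    set n : ℝ := ((Sx.erase x).card : ℝ)
    rw [← hcard, mul_div_mul_right _ _ hm.ne'] at h1
    have h2 : ((n + 1) / n) ^ κ ≤ 1 + κ * (1 / n) := by
      have : (n + 1) / n = 1 + 1 / n := by field_simp
      rw [this]
      exact rpow_one_add_le_one_add_mul_self
        (by have : 0 < 1 / n := by positivity
            linarith) hκ0 hκ1
    have h3 : ((n + 1) / n) ^ κ * density Sx Sy A * (n * Sy.card)
        ≤ (1 + κ * (1 / n)) * density Sx Sy A * (n * Sy.card) := by gcongr
    have h4 : (1 + κ * (1 / n)) * density Sx Sy A * (n * Sy.card)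
        = (n + κ) * density Sx Sy A * Sy.card := by field_simp
    rw [← hcard] at hdens
    linarith

end PotentialMax

end Potential

section Estimates

theorem exp_neg_inv_le {ε : ℝ} (hε : 0 < ε) : 5 / 2 * Real.exp (-ε⁻¹) ≤ ε := by
  have h1 := Real.add_one_le_exp (ε⁻¹ - 1)
  have h2 := Real.exp_one_gt_d9
  have h3 : Real.exp ε⁻¹ = Real.exp 1 * Real.exp (ε⁻¹ - 1) := by
    rw [← Real.exp_add]; ring_nf
  have h4 : 0 < ε⁻¹ := inv_pos.2 hε
  have h5 : 5 / 2 * ε⁻¹ ≤ Real.exp ε⁻¹ := by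
    rw [h3]; nlinarith
  rw [Real.exp_neg, ← div_eq_mul_inv, div_le_iff₀ (Real.exp_pos _)]
  calc (5 / 2 : ℝ) = ε * (5 / 2 * ε⁻¹) := by field_simp
    _ ≤ _ := by gcongr

theorem exp_le_one_add_two_mul {x : ℝ} (h0 : 0 ≤ x) (h1 : x ≤ 1 / 2) :
    Real.exp x ≤ 1 + 2 * x := by
  have h2 := Real.add_one_le_exp (-x)
  have h3 : Real.exp x * Real.exp (-x) = 1 := by rw [← Real.exp_add]; simp
  have h4 := Real.exp_pos x
  nlinarith

theorem two_rpow_neg (r : ℝ) : (2 : ℝ) ^ (-r) = Real.exp (-(Real.log 2 * r)) := by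
  rw [Real.rpow_def_of_pos two_pos, mul_neg]

theorem exp_neg_le_two_rpow_neg {r : ℝ} (hr : 0 ≤ r) : Real.exp (-r) ≤ (2 : ℝ) ^ (-r) := by
  rw [two_rpow_neg, Real.exp_le_exp]
  have := Real.log_two_lt_d9
  nlinarith

/-- The mass threshold below which subrectangles may be ignored when testing regularity. -/
theorem exp_neg_le_mul_pow {ε α : ℝ} {d : ℕ} (hε0 : 0 < ε) (hε1 : ε < 1) (hd : 1 ≤ d)
    (hα : (2 : ℝ) ^ (-((d : ℝ) + 1)) ≤ α) :
    5 / 2 * Real.exp (-(4 * (d : ℝ) ^ 2 / ε)) ≤ ε * α ^ (2 * d) := by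
  have hd' : (1 : ℝ) ≤ d := by exact_mod_cast hd
  have hlog := Real.log_two_lt_d9
  have hlog0 : 0 < Real.log 2 := Real.log_pos one_lt_two
  have hinv : 1 ≤ ε⁻¹ := (one_le_inv₀ hε0).2 hε1.le
  have h1 : Real.exp (-(3 * (d : ℝ) ^ 2)) ≤ α ^ (2 * d) := by
    calc _ ≤ Real.exp (-(Real.log 2 * ((d : ℝ) + 1))) ^ (2 * d) := by
          rw [← Real.exp_nat_mul, Real.exp_le_exp]
          push_cast
          have : Real.log 2 * ((d : ℝ) + 1) ≤ 3 / 2 * d := by nlinarith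
          nlinarith
      _ ≤ _ := by
          rw [two_rpow_neg] at hα
          gcongr
  calc 5 / 2 * Real.exp (-(4 * (d : ℝ) ^ 2 / ε))
      ≤ 5 / 2 * Real.exp (-ε⁻¹ + -(3 * (d : ℝ) ^ 2)) := by
        gcongr
        rw [div_eq_mul_inv]
        have e1 : (1 : ℝ) ≤ (d : ℝ) ^ 2 := one_le_pow₀ hd'
        nlinarith
    _ = 5 / 2 * Real.exp (-ε⁻¹) * Real.exp (-(3 * (d : ℝ) ^ 2)) := by
        rw [Real.exp_add]; ring
    _ ≤ _ := by
        have := exp_neg_inv_le hε0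
        gcongr

end Estimates

section Decomposition

variable {X Y : Type*} {Sx : Finset X} {Sy : Finset Y} {A : X → Y → ℝ} {ε : ℝ} {d : ℕ}

/-- A matrix that is not too sparse contains a large, at least as dense, regular and min-degree
submatrix. -/
theorem exists_regular_submatrix (hA : ZeroOne Sx Sy A) (hx : Sx.Nonempty) (hy : Sy.Nonempty)
    (hε0 : 0 < ε) (hε1 : ε < 1) (hd : 1 ≤ d)
    (hdens : (2 : ℝ) ^ (-(d : ℝ)) ≤ density Sx Sy A) :
    ∃ X' ⊆ Sx, ∃ Y' ⊆ Sy, X'.Nonempty ∧ Y'.Nonempty ∧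
      GridRegular X' Y' ε 2 d A ∧ MinDegree X' Y' ε A ∧
      density Sx Sy A ≤ density X' Y' A ∧
      Real.exp (-(16 * (d : ℝ) ^ 3 / ε ^ 2)) * ((Sx.card : ℝ) * (Sy.card : ℝ))
        ≤ (X'.card : ℝ) * (Y'.card : ℝ) := by
  have hd' : (1 : ℝ) ≤ d := by exact_mod_cast hd
  set κ : ℝ := ε ^ 2 / (16 * (d : ℝ) ^ 2) with hκ
  have hκ0 : 0 < κ := by positivity
  have hκε : κ ≤ ε := by
    rw [hκ, div_le_iff₀ (by positivity)]
    have e1 : (1 : ℝ) ≤ (d : ℝ) ^ 2 := one_le_pow₀ hd'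
    nlinarith
  obtain ⟨X', hX, Y', hY, hX', hY', hmax, hle, hlarge⟩ := exists_potentialMax_large hA hx hy hκ0
    ((exp_neg_le_two_rpow_neg (Nat.cast_nonneg d)).trans hdens)
  have hA' := hA.mono hX hY
  have hα0 := hA'.density_nonneg
  refine ⟨X', hX, Y', hY, hX', hY', ?_, ?_, hle, ?_⟩
  · refine gridRegular_of_sum_le (t := Real.exp (-(4 * (d : ℝ) ^ 2 / ε))) hA' hX' hY' hε0 hε1 hd
      (exp_neg_le_mul_pow hε0 hε1 hd ?_) (Real.exp_pos _).le ?_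
    · refine le_trans ?_ (hdens.trans hle)
      exact Real.rpow_le_rpow_of_exponent_le one_le_two (by linarith)
    · intro X'' hX2 Y'' hY2
      have hN := card_mul_card_pos hX' hY'
      rcases le_total (Real.exp (-(4 * (d : ℝ) ^ 2 / ε)) * ((X'.card : ℝ) * (Y'.card : ℝ)))
        ((X''.card : ℝ) * (Y''.card : ℝ)) with h | h
      · refine (hmax.sum_le_of_card_le hA' hκ0.le hX2 hY2 h).trans ?_
        have e1 : κ * (4 * (d : ℝ) ^ 2 / ε) = ε / 4 := by
          rw [hκ]; field_simp; norm_num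
        have e2 : Real.exp (ε / 4) ≤ 1 + ε / 2 :=
          (exp_le_one_add_two_mul (by positivity) (by linarith)).trans (by linarith)
        rw [e1]
        refine le_add_of_le_of_nonneg ?_ (by positivity)
        gcongr
      · refine (hA'.mono hX2 hY2).sum_le_card.trans (h.trans ?_)
        exact le_add_of_nonneg_left (by positivity)
  · intro x hx
    refine le_trans ?_ (hmax.minDegree hA' hκ0.le (hκε.trans hε1.le) hY' x hx)
    gcongr
  · convert hlarge using 4
    rw [hκ]; field_simp

/-- The pieces of a decomposition: large submatrices that are sparse, or regular and
min-degree. -/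
structure IsPiece (Sx : Finset X) (Sy : Finset Y) (ε : ℝ) (d : ℕ)
    (p : Finset X × Finset Y × (X → Y → ℝ)) : Prop where
  subset_left : p.1 ⊆ Sx
  subset_right : p.2.1 ⊆ Sy
  nonempty_left : p.1.Nonempty
  nonempty_right : p.2.1.Nonempty
  zeroOne : ZeroOne p.1 p.2.1 p.2.2
  large : Real.exp (-(16 * (d : ℝ) ^ 3 / ε ^ 2)) * ((Sx.card : ℝ) * (Sy.card : ℝ))
    ≤ (p.1.card : ℝ) * (p.2.1.card : ℝ)
  sparse_or_regular : density p.1 p.2.1 p.2.2 ≤ (2 : ℝ) ^ (-(d : ℝ)) ∨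
    (GridRegular p.1 p.2.1 ε 2 d p.2.2 ∧ MinDegree p.1 p.2.1 ε p.2.2)

theorem isPiece_of_sparse (hA : ZeroOne Sx Sy A) (hx : Sx.Nonempty) (hy : Sy.Nonempty)
    (h : density Sx Sy A ≤ (2 : ℝ) ^ (-(d : ℝ))) : IsPiece Sx Sy ε d (Sx, Sy, A) where
  subset_left := subset_rfl
  subset_right := subset_rfl
  nonempty_left := hx
  nonempty_right := hy
  zeroOne := hA
  large := mul_le_of_le_one_left (card_mul_card_pos hx hy).le
    (Real.exp_le_one_iff.2 (neg_nonpos.2 (by positivity)))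
  sparse_or_regular := Or.inl h

/-- Total relative area allowed for the decomposition of a matrix of density `a`. -/
noncomputable def areaBound (d : ℕ) (a : ℝ) : ℝ :=
  if a ≤ (2 : ℝ) ^ (-(d : ℝ)) then 1 else 2 + Real.log a + d * Real.log 2

theorem areaBound_of_sparse {a : ℝ} (h : a ≤ (2 : ℝ) ^ (-(d : ℝ))) : areaBound d a = 1 :=
  if_pos h

theorem areaBound_le (d : ℕ) {a : ℝ} (ha0 : 0 ≤ a) (ha : a ≤ 1) : areaBound d a ≤ d + 2 := by
  unfold areaBound
  have := Real.log_two_lt_d9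
  have hd : (0 : ℝ) ≤ d := Nat.cast_nonneg d
  split_ifs
  · linarith
  · have := Real.log_nonpos ha0 ha
    nlinarith

theorem add_areaBound_le {a a' r : ℝ} (ha : (2 : ℝ) ^ (-(d : ℝ)) < a) (hr : r ≤ 1)
    (hra : a * r ≤ a - a') : r + areaBound d a' ≤ areaBound d a := by
  have h2 : (0 : ℝ) < 2 ^ (-(d : ℝ)) := Real.rpow_pos_of_pos two_pos _
  have ha0 : 0 < a := h2.trans ha
  have hlog : Real.log (2 ^ (-(d : ℝ))) = -(d * Real.log 2) := by
    rw [Real.log_rpow two_pos]; ring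
  unfold areaBound
  rw [if_neg ha.not_ge]
  split_ifs with h
  · have := Real.log_lt_log h2 ha
    linarith
  · have ha' : 0 < a' := h2.trans (not_le.1 h)
    have h3 := Real.log_le_sub_one_of_pos (div_pos ha' ha0)
    rw [Real.log_div ha'.ne' ha0.ne'] at h3
    have h4 : r ≤ 1 - a' / a := by
      rw [le_sub_iff_add_le, ← le_sub_iff_add_le', le_sub_iff_add_le, ← mul_le_mul_iff_right₀ ha0]
      rw [mul_add, mul_div_cancel₀ _ ha0.ne']
      linarith
    linarith

theorem sum_ite_rect {X' : Finset X} {Y' : Finset Y} (hX : X' ⊆ Sx) (hY : Y' ⊆ Sy)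
    (A : X → Y → ℝ) :
    ∑ x ∈ Sx, ∑ y ∈ Sy, (if x ∈ X' ∧ y ∈ Y' then A x y else 0) = ∑ x ∈ X', ∑ y ∈ Y', A x y := by
  rw [← sum_product', ← sum_product', ← sum_filter]
  congr 1
  ext p
  simp only [mem_filter, mem_product]
  exact ⟨fun h => h.2, fun h => ⟨⟨hX h.1, hY h.2⟩, h⟩⟩

/-- Every zero-one matrix is a sum of pieces whose total area is controlled. -/
theorem exists_decomposition (hx : Sx.Nonempty) (hy : Sy.Nonempty)
    (hε0 : 0 < ε) (hε1 : ε < 1) (hd : 1 ≤ d) (n : ℕ) :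
    ∀ A : X → Y → ℝ, ZeroOne Sx Sy A → ∑ x ∈ Sx, ∑ y ∈ Sy, A x y ≤ n →
    ∃ (L : ℕ) (p : Fin L → Finset X × Finset Y × (X → Y → ℝ)), 1 ≤ L ∧
      (∀ i, IsPiece Sx Sy ε d (p i)) ∧
      (∀ x ∈ Sx, ∀ y ∈ Sy,
        A x y = ∑ i, if x ∈ (p i).1 ∧ y ∈ (p i).2.1 then (p i).2.2 x y else 0) ∧
      ∑ i, ((p i).1.card : ℝ) * ((p i).2.1.card : ℝ)
        ≤ areaBound d (density Sx Sy A) * ((Sx.card : ℝ) * (Sy.card : ℝ)) := by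
  have hN := card_mul_card_pos hx hy
  have h2 : (0 : ℝ) < 2 ^ (-(d : ℝ)) := Real.rpow_pos_of_pos two_pos _
  induction n with
  | zero =>
    intro A hA hn
    have hsparse : density Sx Sy A ≤ (2 : ℝ) ^ (-(d : ℝ)) := by
      refine le_trans ?_ h2.le
      exact div_nonpos_of_nonpos_of_nonneg (by simpa using hn) hN.le
    exact ⟨1, fun _ => (Sx, Sy, A), le_rfl, fun _ => isPiece_of_sparse hA hx hy hsparse,
      fun x hx y hy => by simp [hx, hy], by simp [areaBound_of_sparse hsparse]⟩
  | succ n ih =>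
    intro A hA hn
    rcases le_or_gt (density Sx Sy A) ((2 : ℝ) ^ (-(d : ℝ))) with hsparse | hdense
    · exact ⟨1, fun _ => (Sx, Sy, A), le_rfl, fun _ => isPiece_of_sparse hA hx hy hsparse,
        fun x hx y hy => by simp [hx, hy], by simp [areaBound_of_sparse hsparse]⟩
    · obtain ⟨X', hX, Y', hY, hX', hY', hreg, hmin, hle, hlarge⟩ :=
        exists_regular_submatrix hA hx hy hε0 hε1 hd hdense.le
      have hA' := hA.mono hX hY
      set R : X → Y → ℝ := fun x y => if x ∈ X' ∧ y ∈ Y' then 0 else A x y with hR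
      have hRZ : ZeroOne Sx Sy R := by
        intro x hx y hy
        simp only [hR]
        split_ifs
        · exact Or.inl rfl
        · exact hA x hx y hy
      have hsplit : ∀ x y, A x y = (if x ∈ X' ∧ y ∈ Y' then A x y else 0) + R x y := by
        intro x y
        simp only [hR]
        split_ifs <;> simp
      have hsum : ∑ x ∈ Sx, ∑ y ∈ Sy, A x y
          = ∑ x ∈ X', ∑ y ∈ Y', A x y + ∑ x ∈ Sx, ∑ y ∈ Sy, R x y := by
        rw [← sum_ite_rect hX hY, ← sum_add_distrib]
        refine sum_congr rfl fun x _ => ?_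
        rw [← sum_add_distrib]
        exact sum_congr rfl fun y _ => hsplit x y
      have hn' := card_mul_card_pos hX' hY'
      have hmass := density_mul_card (A := A) hX' hY'
      have hone : 1 ≤ ∑ x ∈ X', ∑ y ∈ Y', A x y := by
        refine hA'.one_le_sum ?_
        rw [← hmass]
        exact mul_pos (h2.trans (hdense.trans_le hle)) hn'
      obtain ⟨L, p, hL, hp, hpsum, hparea⟩ := ih R hRZ (by push_cast at hn; linarith)
      refine ⟨L + 1, Fin.cons (X', Y', A) p, by omega, ?_, ?_, ?_⟩
      · refine Fin.cases ?_ ?_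
        · exact ⟨hX, hY, hX', hY', hA', hlarge, Or.inr ⟨hreg, hmin⟩⟩
        · exact hp
      · intro x hx y hy
        rw [Fin.sum_univ_succ]
        simp only [Fin.cons_zero, Fin.cons_succ]
        rw [← hpsum x hx y hy]
        exact hsplit x y
      · rw [Fin.sum_univ_succ]
        simp only [Fin.cons_zero, Fin.cons_succ]
        have hr : (X'.card : ℝ) * (Y'.card : ℝ) / ((Sx.card : ℝ) * (Sy.card : ℝ)) ≤ 1 :=
          div_le_one_of_le₀ (card_mul_card_le hX hY) hN.le
        have hbound := add_areaBound_le (a' := density Sx Sy R) hdense hr (by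
          rw [← mul_div_assoc, div_le_iff₀ hN, sub_mul, density_mul_card hx hy,
            density_mul_card hx hy]
          have := mul_le_mul_of_nonneg_right hle hn'.le
          linarith)
        have := mul_le_mul_of_nonneg_right hbound hN.le
        rw [add_mul, div_mul_cancel₀ _ hN.ne'] at this
        linarith

end Decomposition

section GoodColumns

/-- If all rows have degree almost `β`, and no large subrectangle is noticeably denser than `β`,
then the matrix is regular and min-degree. -/
theorem gridRegular_and_minDegree_of_sum_le {X Y : Type*} {Sx : Finset X} {Sy : Finset Y}
    {A : X → Y → ℝ} {ε η β τ : ℝ} {d : ℕ}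
    (hA : ZeroOne Sx Sy A) (hx : Sx.Nonempty) (hy : Sy.Nonempty)
    (hε0 : 0 < ε) (hε1 : ε < 1) (hη0 : 0 < η) (hηε : η ≤ ε / 16) (hβ0 : 0 < β) (hd : 1 ≤ d)
    (hτ0 : 0 < τ) (hτ1 : τ ≤ 1) (hτ : ∀ α : ℝ, β / 2 ≤ α → 5 / 2 * τ ≤ ε * α ^ (2 * d))
    (hrow : ∀ x ∈ Sx, (1 - ε / 4) * β * (Sy.card : ℝ) ≤ ∑ y ∈ Sy, A x y)
    (hupper : ∀ X' ⊆ Sx, ∀ Y' ⊆ Sy,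
      τ * ((Sx.card : ℝ) * (Sy.card : ℝ)) ≤ (X'.card : ℝ) * (Y'.card : ℝ) →
      ∑ x ∈ X', ∑ y ∈ Y', A x y ≤ (1 + η) * β * ((X'.card : ℝ) * (Y'.card : ℝ))) :
    GridRegular Sx Sy ε 2 d A ∧ MinDegree Sx Sy ε A := by
  have hm : (0 : ℝ) < Sy.card := by exact_mod_cast hy.card_pos
  have hN := card_mul_card_pos hx hy
  have hmass := density_mul_card (A := A) hx hy
  have hρ0 : 0 ≤ density Sx Sy A := hA.density_nonneg
  set ρ := density Sx Sy A with hρ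
  have hρup : ρ ≤ (1 + η) * β := by
    refine le_of_mul_le_mul_right ?_ hN
    rw [hmass]
    exact hupper Sx subset_rfl Sy subset_rfl (mul_le_of_le_one_left hN.le hτ1)
  have hρlow : (1 - ε / 4) * β ≤ ρ := by
    refine le_of_mul_le_mul_right ?_ hN
    rw [hmass]
    calc (1 - ε / 4) * β * ((Sx.card : ℝ) * (Sy.card : ℝ))
        = ∑ _x ∈ Sx, (1 - ε / 4) * β * (Sy.card : ℝ) := by
          rw [sum_const, nsmul_eq_mul]; ring
      _ ≤ _ := sum_le_sum hrow
  constructor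
  · refine gridRegular_of_sum_le (t := τ) hA hx hy hε0 hε1 hd (hτ ρ (by nlinarith)) hτ0.le ?_
    intro X' hX Y' hY
    rcases le_total (τ * ((Sx.card : ℝ) * (Sy.card : ℝ))) ((X'.card : ℝ) * (Y'.card : ℝ))
      with h | h
    · refine le_add_of_le_of_nonneg ((hupper X' hX Y' hY h).trans ?_) (by positivity)
      refine mul_le_mul_of_nonneg_right ?_ (by positivity)
      have e1 : 1 + η ≤ (1 + ε / 2) * (1 - ε / 4) := by nlinarith
      have e2 : (1 + ε / 2) * ((1 - ε / 4) * β) ≤ (1 + ε / 2) * ρ := by gcongr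
      have e3 : (1 + η) * β ≤ (1 + ε / 2) * (1 - ε / 4) * β := by gcongr
      linarith
    · refine (hA.mono hX hY).sum_le_card.trans (h.trans ?_)
      exact le_add_of_nonneg_left (by positivity)
  · intro x hx
    rw [rowDeg, le_div_iff₀ hm]
    refine le_trans ?_ (hrow x hx)
    refine mul_le_mul_of_nonneg_right ?_ hm.le
    have e1 : (1 - ε) * ρ ≤ (1 - ε) * ((1 + η) * β) :=
      mul_le_mul_of_nonneg_left hρup (by linarith)
    have e2 : (1 - ε) * (1 + η) ≤ 1 - ε / 4 := by nlinarith
    have e3 : (1 - ε) * (1 + η) * β ≤ (1 - ε / 4) * β := by gcongr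
    linarith

variable {Y Z : Type*} {Sy Y' : Finset Y} {Sz : Finset Z} {B : Y → Z → ℝ} {ε γ : ℝ} {d : ℕ}

theorem sum_columns_le_of_low_degree {Z' Z'' : Finset Z} (hZ : Z' ⊆ Z'') {t : ℝ}
    (h : ∀ z ∈ Z'' \ Z', ∑ y ∈ Y', B y z ≤ t) :
    ∑ y ∈ Y', ∑ z ∈ Z'', B y z
      ≤ ∑ y ∈ Y', ∑ z ∈ Z', B y z + t * ((Z'' \ Z').card : ℝ) := by
  rw [sum_comm, ← sum_sdiff hZ, sum_comm (s := Y') (t := Z'), add_comm]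
  gcongr
  calc _ ≤ ∑ _z ∈ Z'' \ Z', t := sum_le_sum h
    _ = _ := by simp [mul_comm]

/-- If `Y' × Sz` has density almost `β` and no large subrectangle is noticeably denser, then few
columns have low degree. -/
theorem card_low_degree_le {η β τ : ℝ} (hB : ZeroOne Y' Sz B) (hY' : Y'.Nonempty)
    (hSz : Sz.Nonempty)
    (hε0 : 0 < ε) (hε1 : ε < 1) (hη : η = γ * ε / 8) (hη0 : 0 < η) (hηε : η ≤ ε / 16)
    (hβ0 : 0 < β) (hτβ : τ ≤ ε * β / 5)
    (hlower : (1 - η) * β * ((Y'.card : ℝ) * (Sz.card : ℝ)) ≤ ∑ y ∈ Y', ∑ z ∈ Sz, B y z)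
    {Z' : Finset Z} (hZ : Z' ⊆ Sz)
    (hlow : ∀ z ∈ Sz \ Z', ∑ y ∈ Y', B y z ≤ (1 - ε / 4) * β * (Y'.card : ℝ))
    (hupper : τ / 2 * (Sz.card : ℝ) ≤ Z'.card →
      ∑ y ∈ Y', ∑ z ∈ Z', B y z ≤ (1 + η) * β * ((Y'.card : ℝ) * (Z'.card : ℝ))) :
    ((Sz \ Z').card : ℝ) ≤ γ * (Sz.card : ℝ) := by
  have hm : (0 : ℝ) < Y'.card := by exact_mod_cast hY'.card_pos
  have hn : (0 : ℝ) < Sz.card := by exact_mod_cast hSz.card_pos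
  have hmass := hlower.trans (sum_columns_le_of_low_degree hZ hlow)
  have hcard : ((Sz \ Z').card : ℝ) + (Z'.card : ℝ) = (Sz.card : ℝ) := by
    exact_mod_cast card_sdiff_add_card_eq_card hZ
  have hBY := hB.mono subset_rfl hZ
  have hZbig : τ / 2 * (Sz.card : ℝ) ≤ (Z'.card : ℝ) := by
    by_contra! hlt
    have e1 : (1 - η) * β * Sz.card ≤ Z'.card + (1 - ε / 4) * β * ((Sz \ Z').card : ℝ) := by
      refine le_of_mul_le_mul_left ?_ hm
      have := hBY.sum_le_card
      linarith
    have e2 : ((Sz \ Z').card : ℝ) ≤ Sz.card := by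
      have : (0 : ℝ) ≤ Z'.card := Nat.cast_nonneg _
      linarith
    have e3 : (1 - ε / 4) * β * ((Sz \ Z').card : ℝ) ≤ (1 - ε / 4) * β * (Sz.card : ℝ) :=
      mul_le_mul_of_nonneg_left e2 (mul_nonneg (by linarith) hβ0.le)
    have e4 : (ε / 4 - η) * β * (Sz.card : ℝ) < τ / 2 * Sz.card := by linarith
    have e5 := lt_of_mul_lt_mul_right e4 hn.le
    have e6 : 3 / 16 * ε * β ≤ (ε / 4 - η) * β := by
      gcongr
      linarith
    have : 0 < ε * β := by positivity
    linarith
  have hZup := hupper hZbig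
  have e2 : (β * Y'.card) * ((1 - η) * Sz.card)
      ≤ (β * Y'.card) * ((1 + η) * Z'.card + (1 - ε / 4) * ((Sz \ Z').card : ℝ)) := by linarith
  have e3 := le_of_mul_le_mul_left e2 (by positivity)
  rw [← hcard] at e3 ⊢
  have e4 : 0 ≤ η * ((Sz \ Z').card : ℝ) := by positivity
  refine le_of_mul_le_mul_left ?_ (show 0 < ε / 4 by positivity)
  have e5 : ε / 4 * (γ * (((Sz \ Z').card : ℝ) + Z'.card))
      = 2 * η * (((Sz \ Z').card : ℝ) + Z'.card) := by rw [hη]; ring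
  rw [e5]
  linarith

theorem exp_neg_le_mul_exp_neg (hε0 : 0 < ε) (hε1 : ε < 1) (hd : 1 ≤ d) :
    Real.exp (-(21 * (d : ℝ) ^ 3 / ε ^ 2))
      ≤ Real.exp (-(16 * (d : ℝ) ^ 3 / ε ^ 2)) * (Real.exp (-(4 * (d : ℝ) ^ 2 / ε)) / 2) := by
  have hd' : (1 : ℝ) ≤ d := by exact_mod_cast hd
  have e1 : Real.exp (-1) ≤ 1 / 2 := by
    have := Real.exp_neg_one_lt_d9
    linarith
  have e2 : 4 * (d : ℝ) ^ 2 / ε ≤ 4 * (d : ℝ) ^ 3 / ε ^ 2 := by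
    have h1 : ε ^ 2 ≤ ε := pow_le_of_le_one hε0.le hε1.le (by norm_num)
    have h2 : (d : ℝ) ^ 2 ≤ (d : ℝ) ^ 3 := pow_le_pow_right₀ hd' (by norm_num)
    gcongr
  have e3 : 1 ≤ (d : ℝ) ^ 3 / ε ^ 2 := by
    rw [one_le_div (by positivity)]
    exact (pow_le_one₀ hε0.le hε1.le).trans (one_le_pow₀ hd')
  calc Real.exp (-(21 * (d : ℝ) ^ 3 / ε ^ 2))
      ≤ Real.exp (-(16 * (d : ℝ) ^ 3 / ε ^ 2) + (-(4 * (d : ℝ) ^ 2 / ε) + -1)) := by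
        rw [Real.exp_le_exp]
        have e4 : 21 * (d : ℝ) ^ 3 / ε ^ 2
            = 4 * (d : ℝ) ^ 3 / ε ^ 2 + (d : ℝ) ^ 3 / ε ^ 2 + 16 * (d : ℝ) ^ 3 / ε ^ 2 := by ring
        linarith
    _ ≤ _ := by
        rw [Real.exp_add, Real.exp_add, div_eq_mul_one_div (Real.exp (-(4 * (d : ℝ) ^ 2 / ε)))]
        gcongr

theorem PotentialMax.sum_le_one_add_mul
    (hmax : PotentialMax Sy Sz (γ * ε ^ 3 / (336 * (d : ℝ) ^ 3)) B) (hB : ZeroOne Sy Sz B)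
    (hε0 : 0 < ε) (hε1 : ε < 1) (hγ0 : 0 < γ) (hγ1 : γ < 1 / 2) (hd : 1 ≤ d)
    {Y' : Finset Y} (hY : Y' ⊆ Sy) {Z' : Finset Z} (hZ : Z' ⊆ Sz)
    (hlarge : Real.exp (-(16 * (d : ℝ) ^ 3 / ε ^ 2)) * (Real.exp (-(4 * (d : ℝ) ^ 2 / ε)) / 2)
      * ((Sy.card : ℝ) * (Sz.card : ℝ)) ≤ (Y'.card : ℝ) * (Z'.card : ℝ)) :
    ∑ y ∈ Y', ∑ z ∈ Z', B y z
      ≤ (1 + γ * ε / 8) * density Sy Sz B * ((Y'.card : ℝ) * (Z'.card : ℝ)) := by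
  have hβ := hB.density_nonneg
  refine (hmax.sum_le_of_card_le hB (by positivity) hY hZ
    ((mul_le_mul_of_nonneg_right (exp_neg_le_mul_exp_neg hε0 hε1 hd) (by positivity)).trans
      hlarge)).trans ?_
  have e1 : γ * ε ^ 3 / (336 * (d : ℝ) ^ 3) * (21 * (d : ℝ) ^ 3 / ε ^ 2) = γ * ε / 16 := by
    field_simp; norm_num
  have e2 : Real.exp (γ * ε / 16) ≤ 1 + γ * ε / 8 :=
    (exp_le_one_add_two_mul (by positivity) (by nlinarith)).trans (by linarith)
  rw [e1]
  gcongr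

/-- Inside a rectangle of maximal potential, every large set of rows admits a set of almost all
columns on which the transposed matrix is regular and min-degree. -/
theorem PotentialMax.exists_good_columns
    (hmax : PotentialMax Sy Sz (γ * ε ^ 3 / (336 * (d : ℝ) ^ 3)) B)
    (hB : ZeroOne Sy Sz B) (hSz : Sz.Nonempty) (hY : Y' ⊆ Sy) (hY' : Y'.Nonempty)
    (hε0 : 0 < ε) (hε1 : ε < 1) (hγ0 : 0 < γ) (hγ1 : γ < 1 / 2) (hd : 1 ≤ d)
    (hdens : (2 : ℝ) ^ (-(d : ℝ)) ≤ density Sy Sz B)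
    (hlarge : Real.exp (-(16 * (d : ℝ) ^ 3 / ε ^ 2)) * (Sy.card : ℝ) ≤ (Y'.card : ℝ)) :
    ∃ Z' ⊆ Sz, Z'.Nonempty ∧ ((Sz \ Z').card : ℝ) ≤ γ * (Sz.card : ℝ) ∧
      GridRegular Z' Y' ε 2 d (fun z y => B y z) ∧ MinDegree Z' Y' ε (fun z y => B y z) := by
  have hd' : (1 : ℝ) ≤ d := by exact_mod_cast hd
  have hd3 : (1 : ℝ) ≤ (d : ℝ) ^ 3 := one_le_pow₀ hd'
  have hupper := fun Y'' hY'' Z'' hZ'' => hmax.sum_le_one_add_mul hB hε0 hε1 hγ0 hγ1 hd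
    (Y' := Y'') hY'' (Z' := Z'') hZ''
  have hrows := hmax.minDegree hB (by positivity)
  have hκη : γ * ε ^ 3 / (336 * (d : ℝ) ^ 3) ≤ γ * ε / 8 := by
    rw [div_le_div_iff₀ (by positivity) (by positivity)]
    have e1 : ε ^ 3 ≤ ε := pow_le_of_le_one hε0.le hε1.le (by norm_num)
    have e2 : γ * ε ^ 3 ≤ γ * ε := by gcongr
    have e3 : 0 < γ * ε := by positivity
    nlinarith
  have hη0 : 0 < γ * ε / 8 := by positivity
  have hηε : γ * ε / 8 ≤ ε / 16 := by nlinarith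
  have hβ0 : 0 < density Sy Sz B := (Real.rpow_pos_of_pos two_pos _).trans_le hdens
  have hβ1 := hB.density_le_one
  generalize hβ : density Sy Sz B = β at *
  generalize hη : γ * ε / 8 = η at *
  generalize hκ : γ * ε ^ 3 / (336 * (d : ℝ) ^ 3) = κ at *
  set τ : ℝ := Real.exp (-(4 * (d : ℝ) ^ 2 / ε)) with hτ
  set δ : ℝ := Real.exp (-(16 * (d : ℝ) ^ 3 / ε ^ 2)) with hδ
  have hτ0 : 0 < τ := Real.exp_pos _
  have hδ0 : 0 < δ := Real.exp_pos _
  have hτpow : ∀ α : ℝ, β / 2 ≤ α → 5 / 2 * τ ≤ ε * α ^ (2 * d) := by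
    intro α hα
    refine exp_neg_le_mul_pow hε0 hε1 hd (le_trans ?_ hα)
    rw [neg_add, Real.rpow_add two_pos, Real.rpow_neg_one]
    linarith
  have hτβ : τ ≤ ε * β / 5 := by
    have h1 := hτpow (β / 2) le_rfl
    have h2 : (β / 2) ^ (2 * d) ≤ β / 2 :=
      pow_le_of_le_one (by positivity) (by linarith) (by omega)
    have h3 : ε * (β / 2) ^ (2 * d) ≤ ε * (β / 2) := by gcongr
    linarith
  have hm : (0 : ℝ) < Y'.card := by exact_mod_cast hY'.card_pos
  have hn : (0 : ℝ) < Sz.card := by exact_mod_cast hSz.card_pos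
  have hlower : (1 - η) * β * ((Y'.card : ℝ) * (Sz.card : ℝ)) ≤ ∑ y ∈ Y', ∑ z ∈ Sz, B y z := by
    rw [← sum_rowDeg_mul_card hSz]
    have h1 : ∑ _y ∈ Y', (1 - η) * β ≤ ∑ y ∈ Y', rowDeg Sz B y := by
      refine sum_le_sum fun y hy => le_trans ?_ (hrows (by linarith) hSz y (hY hy))
      rw [hβ]
      gcongr
    rw [sum_const, nsmul_eq_mul] at h1
    calc _ = (Y'.card : ℝ) * ((1 - η) * β) * Sz.card := by ring
      _ ≤ _ := by gcongr
  set Z' := Sz.filter fun z => (1 - ε / 4) * β * (Y'.card : ℝ) ≤ ∑ y ∈ Y', B y z with hZdef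
  have hZ : Z' ⊆ Sz := filter_subset _ _
  have hlow : ∀ z ∈ Sz \ Z', ∑ y ∈ Y', B y z ≤ (1 - ε / 4) * β * (Y'.card : ℝ) := by
    intro z hz
    rw [mem_sdiff, hZdef, mem_filter, not_and, not_le] at hz
    exact (hz.2 hz.1).le
  have hcard : ((Sz \ Z').card : ℝ) + (Z'.card : ℝ) = (Sz.card : ℝ) := by
    exact_mod_cast card_sdiff_add_card_eq_card hZ
  have hbad : ((Sz \ Z').card : ℝ) ≤ γ * Sz.card := by
    refine card_low_degree_le (hB.mono hY subset_rfl) hY' hSz hε0 hε1 hη.symm hη0 hηε hβ0 hτβ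
      hlower hZ hlow fun hZbig => hupper Y' hY Z' hZ ?_
    calc _ = (δ * Sy.card) * (τ / 2 * Sz.card) := by ring
      _ ≤ _ := by gcongr
  have hZhalf : (Sz.card : ℝ) / 2 ≤ Z'.card := by nlinarith
  have hZpos : (0 : ℝ) < Z'.card := by linarith
  have hZ' : Z'.Nonempty := card_pos.1 (by exact_mod_cast hZpos)
  refine ⟨Z', hZ, hZ', hbad, gridRegular_and_minDegree_of_sum_le (hB.mono hY hZ).swap hZ' hY'
    hε0 hε1 hη0 hηε hβ0 hd hτ0 (by nlinarith) hτpow (fun z hz => (mem_filter.1 hz).2) ?_⟩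
  intro Z'' hZ2 Y'' hY2 h
  rw [sum_comm, mul_comm (Z''.card : ℝ)]
  refine hupper Y'' (hY2.trans hY) Z'' (hZ2.trans hZ) ?_
  calc _ = τ * ((Sz.card : ℝ) / 2 * (δ * Sy.card)) := by ring
    _ ≤ τ * ((Z'.card : ℝ) * (Y'.card : ℝ)) := by gcongr
    _ ≤ _ := h
    _ = _ := mul_comm _ _

end GoodColumns

/-- **Finding a good cube (existential content).** There are universal constants `c, C > 0`
such that: for zero-one matrices `A ∈ {0,1}^{X×Y}`, `B ∈ {0,1}^{Y×Z}` on finite nonempty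
sets, `ε ∈ (0,1)`, `γ ∈ (0,1/2)` and an integer `d ≥ 1` with `E[B] ≥ 2^{−d}`, there are
nonempty `Y* ⊆ Y`, `Z* ⊆ Z` and pieces `{(X_ℓ, Y_ℓ, Z_ℓ, A_ℓ)}_{ℓ=1}^L`
(with `Y_ℓ ⊆ Y*`, `Z_ℓ ⊆ Z*`) satisfying properties (1)–(7) of the Good Cube lemma. -/
theorem good_cube :
    ∃ c C : ℝ, 0 < c ∧ 0 < C ∧
    ∀ (X Y Z : Type) [Fintype X] [Fintype Y] [Fintype Z]
      [Nonempty X] [Nonempty Y] [Nonempty Z]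
      (A : X → Y → ℝ) (B : Y → Z → ℝ),
      ZeroOne Finset.univ Finset.univ A → ZeroOne Finset.univ Finset.univ B →
      ∀ (ε γ : ℝ) (d : ℕ), ε ∈ Set.Ioo (0 : ℝ) 1 → γ ∈ Set.Ioo (0 : ℝ) (1/2) → 1 ≤ d →
      (2 : ℝ) ^ (-(d : ℝ)) ≤ density Finset.univ Finset.univ B →
      ∃ (Ys : Finset Y) (Zs : Finset Z) (L : ℕ)
        (Xl : Fin L → Finset X) (Yl : Fin L → Finset Y) (Zl : Fin L → Finset Z)
        (Al : Fin L → X → Y → ℝ),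
        Ys.Nonempty ∧ Zs.Nonempty ∧ 1 ≤ L ∧
        (∀ i, (Xl i).Nonempty ∧ (Yl i).Nonempty ∧ (Zl i).Nonempty ∧
          Yl i ⊆ Ys ∧ Zl i ⊆ Zs ∧ ZeroOne (Xl i) (Yl i) (Al i)) ∧
        -- (1) A[X,Y*] = Σ_ℓ A_ℓ
        (∀ x : X, ∀ y ∈ Ys,
          A x y = ∑ i : Fin L, if x ∈ Xl i ∧ y ∈ Yl i then Al i x y else 0) ∧
        -- (2) each piece is sparse, or A_ℓ and B_ℓᵀ are regular and min-degree
        (∀ i, density (Xl i) (Yl i) (Al i) ≤ (2 : ℝ) ^ (-(d : ℝ)) ∨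
          (GridRegular (Xl i) (Yl i) ε 2 d (Al i) ∧ MinDegree (Xl i) (Yl i) ε (Al i) ∧
           GridRegular (Zl i) (Yl i) ε 2 d (fun z y => B y z) ∧
           MinDegree (Zl i) (Yl i) ε (fun z y => B y z))) ∧
        -- (3) E[B[Y*,Z*]] ≥ E[B]
        density Finset.univ Finset.univ B ≤ density Ys Zs B ∧
        -- (4)
        (∑ i : Fin L, ((Xl i).card : ℝ) * ((Yl i).card : ℝ) * ((Zl i).card : ℝ)
            ≤ ((d : ℝ) + 2) * ((Fintype.card X : ℝ) * (Ys.card : ℝ) * (Zs.card : ℝ))) ∧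
        -- (5)
        (∑ i : Fin L, ((Xl i).card : ℝ) * ((Yl i).card : ℝ) * (((Zs \ Zl i).card : ℝ))
            ≤ γ * ((d : ℝ) + 2) * ((Fintype.card X : ℝ) * (Ys.card : ℝ) * (Zs.card : ℝ))) ∧
        -- (6)
        Real.exp (-(C * (d : ℝ) ^ 4 * γ⁻¹ * ε ^ (-c)))
            * ((Fintype.card Y : ℝ) * (Fintype.card Z : ℝ))
          ≤ (Ys.card : ℝ) * (Zs.card : ℝ) ∧
        -- (7)
        (L : ℝ) ≤ Real.exp (C * (d : ℝ) ^ 3 * ε ^ (-c)) := by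
  refine ⟨3, 336, by norm_num, by norm_num, ?_⟩
  intro X Y Z _ _ _ _ _ _ A B hA hB ε γ d hε hγ hd hdens
  obtain ⟨hε0, hε1⟩ := hε
  obtain ⟨hγ0, hγ1⟩ := hγ
  have hd' : (1 : ℝ) ≤ d := by exact_mod_cast hd
  have hεpow : ε ^ (-3 : ℝ) = (ε ^ 3)⁻¹ := by
    rw [Real.rpow_neg hε0.le]
    norm_cast
  rw [hεpow]
  obtain ⟨Ys, -, Zs, -, hYs, hZs, hmax, hle, hsize⟩ :=
    exists_potentialMax_large (κ := γ * ε ^ 3 / (336 * (d : ℝ) ^ 3)) hB univ_nonempty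
      univ_nonempty (by positivity) ((exp_neg_le_two_rpow_neg (Nat.cast_nonneg d)).trans hdens)
  have hBs := hB.mono (subset_univ Ys) (subset_univ Zs)
  have hAs := hA.mono (subset_univ univ) (subset_univ Ys)
  obtain ⟨n, hn⟩ := exists_nat_ge (∑ x : X, ∑ y ∈ Ys, A x y)
  obtain ⟨L, p, hL, hp, hsum, harea⟩ :=
    exists_decomposition (univ_nonempty (α := X)) hYs hε0 hε1 hd n A hAs hn
  have harea' : ∑ i, ((p i).1.card : ℝ) * ((p i).2.1.card : ℝ)
      ≤ ((d : ℝ) + 2) * ((Fintype.card X : ℝ) * (Ys.card : ℝ)) :=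
    harea.trans (mul_le_mul_of_nonneg_right
      (areaBound_le d hAs.density_nonneg hAs.density_le_one) (by positivity))
  have hcols : ∀ i, ∃ Z' ⊆ Zs, Z'.Nonempty ∧ ((Zs \ Z').card : ℝ) ≤ γ * (Zs.card : ℝ) ∧
      (density (p i).1 (p i).2.1 (p i).2.2 ≤ (2 : ℝ) ^ (-(d : ℝ)) ∨
        (GridRegular (p i).1 (p i).2.1 ε 2 d (p i).2.2 ∧ MinDegree (p i).1 (p i).2.1 ε (p i).2.2 ∧
          GridRegular Z' (p i).2.1 ε 2 d (fun z y => B y z) ∧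
          MinDegree Z' (p i).2.1 ε (fun z y => B y z))) := by
    intro i
    have hlarge : Real.exp (-(16 * (d : ℝ) ^ 3 / ε ^ 2)) * (Ys.card : ℝ)
        ≤ ((p i).2.1.card : ℝ) := by
      have hX : (0 : ℝ) < (univ : Finset X).card := by exact_mod_cast univ_nonempty.card_pos
      refine le_of_mul_le_mul_left ?_ hX
      calc _ = _ := by ring
        _ ≤ _ := (hp i).large
        _ ≤ _ := by
          have := card_le_card (hp i).subset_left
          gcongr
    obtain ⟨Z', hZ, hZ', hbad, h1, h2⟩ := hmax.exists_good_columns hBs hZs (hp i).subset_right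
      (hp i).nonempty_right hε0 hε1 hγ0 hγ1 hd (hdens.trans hle) hlarge
    exact ⟨Z', hZ, hZ', hbad, (hp i).sparse_or_regular.imp_right fun h => ⟨h.1, h.2, h1, h2⟩⟩
  choose Zl hZl hZne hZbad hgood using hcols
  refine ⟨Ys, Zs, L, fun i => (p i).1, fun i => (p i).2.1, Zl, fun i => (p i).2.2, hYs, hZs, hL,
    fun i => ⟨(hp i).nonempty_left, (hp i).nonempty_right, hZne i, (hp i).subset_right, hZl i,
      (hp i).zeroOne⟩, fun x y hy => hsum x (mem_univ x) y hy, hgood, hle, ?_, ?_, ?_, ?_⟩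
  · calc _ ≤ ∑ i, ((p i).1.card : ℝ) * ((p i).2.1.card : ℝ) * (Zs.card : ℝ) := by
          refine sum_le_sum fun i _ => ?_
          have := card_le_card (hZl i)
          gcongr
      _ = (∑ i, ((p i).1.card : ℝ) * ((p i).2.1.card : ℝ)) * (Zs.card : ℝ) := by rw [sum_mul]
      _ ≤ ((d : ℝ) + 2) * ((Fintype.card X : ℝ) * (Ys.card : ℝ)) * (Zs.card : ℝ) := by gcongr
      _ = _ := by ring
  · calc _ ≤ ∑ i, ((p i).1.card : ℝ) * ((p i).2.1.card : ℝ) * (γ * (Zs.card : ℝ)) :=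
          sum_le_sum fun i _ => mul_le_mul_of_nonneg_left (hZbad i) (by positivity)
      _ = (∑ i, ((p i).1.card : ℝ) * ((p i).2.1.card : ℝ)) * (γ * (Zs.card : ℝ)) := by
          rw [sum_mul]
      _ ≤ ((d : ℝ) + 2) * ((Fintype.card X : ℝ) * (Ys.card : ℝ)) * (γ * (Zs.card : ℝ)) := by
          gcongr
      _ = _ := by ring
  · rw [card_univ, card_univ] at hsize
    convert hsize using 4
    field_simp
  · have hN : (0 : ℝ) < (Fintype.card X : ℝ) * (Ys.card : ℝ) :=
      card_mul_card_pos univ_nonempty hYs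
    have h1 : (L : ℝ) * Real.exp (-(16 * (d : ℝ) ^ 3 / ε ^ 2)) ≤ d + 2 := by
      refine le_of_mul_le_mul_right (le_trans ?_ harea') hN
      have h2 := sum_le_sum fun i (_ : i ∈ univ) => (hp i).large
      rw [sum_const, nsmul_eq_mul, card_univ, card_univ, Fintype.card_fin] at h2
      linarith
    have h3 : (d : ℝ) + 2 ≤ Real.exp (d + 1) := by
      have := Real.add_one_le_exp ((d : ℝ) + 1)
      linarith
    rw [Real.exp_neg, ← div_eq_mul_inv, div_le_iff₀ (Real.exp_pos _)] at h1
    refine h1.trans ((mul_le_mul_of_nonneg_right h3 (Real.exp_pos _).le).trans ?_)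
    rw [← Real.exp_add, Real.exp_le_exp]
    have e1 : (d : ℝ) ≤ (d : ℝ) ^ 3 := le_self_pow₀ hd' (by norm_num)
    have e2 : 1 ≤ (ε ^ 3)⁻¹ := (one_le_inv₀ (by positivity)).2 (pow_le_one₀ hε0.le hε1.le)
    have e3 : (d : ℝ) ^ 3 ≤ (d : ℝ) ^ 3 * (ε ^ 3)⁻¹ := le_mul_of_one_le_right (by positivity) e2
    have e4 : (d : ℝ) ^ 3 / ε ^ 2 ≤ (d : ℝ) ^ 3 * (ε ^ 3)⁻¹ := by
      rw [← div_eq_mul_inv]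
      have : ε ^ 3 ≤ ε ^ 2 := pow_le_pow_of_le_one hε0.le hε1.le (by norm_num)
      gcongr
    have e5 : 16 * (d : ℝ) ^ 3 / ε ^ 2 = 16 * ((d : ℝ) ^ 3 / ε ^ 2) := by ring
    linarith
end

section
/- There exist universal constants c, C > 0 such that the following holds. Let X, Y, Z be finite nonempty sets, let A ∈ {0,1}^{X×Y} and B ∈ {0,1}^{Y×Z}, let ε ∈ (0,1) and d ≥ 1. Then there exist an integer K ≥ 1 and tuples {(X_k, Y_k, Z_k, A_k, B_k)}_{k=1}^K with nonempty X_k ⊆ X, Y_k ⊆ Y, Z_k ⊆ Z, A_k ∈ {0,1}^{X_k×Y_k}, B_k ∈ {0,1}^{Y_k×Z_k}, such that: (1) for every (x,z) ∈ X×Z, (AB)(x,z) = Σ_{k : x∈X_k, z∈Z_k} (A_k B_k)(x,z), where products are standard (unnormalized) matrix products over the integers; (2) for every k ∈ [K], either E[A_k] ≤ 2^{−d} or E[B_k] ≤ 2^{−d}, or both A_k and B_k^T are (ε,2,d)-regular and ε-min-degree; (3) Σ_{k=1}^K |X_k|·|Y_k|·|Z_k| ≤ 2(d+2)^2·|X|·|Y|·|Z|;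 (4) K ≤ exp(C·d^7·ε^{−c}). -/
open Finset

open scoped Classical

namespace ABDecomposition

variable {X Y Z : Type*}

/-- A zero-one matrix on the whole ambient index set. -/
def Binary (A : X → Y → ℝ) : Prop := ∀ x y, A x y = 0 ∨ A x y = 1

theorem Binary.nonneg {A : X → Y → ℝ} (hA : Binary A) (x : X) (y : Y) : 0 ≤ A x y := by
  rcases hA x y with h | h <;> simp [h]

theorem Binary.le_one {A : X → Y → ℝ} (hA : Binary A) (x : X) (y : Y) : A x y ≤ 1 := by
  rcases hA x y with h | h <;> simp [h]

theorem Binary.swap {A : X → Y → ℝ} (hA : Binary A) : Binary fun y x => A x y :=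
  fun y x => hA x y

theorem sum_eq_density_mul (S : Finset X) (T : Finset Y) (A : X → Y → ℝ) :
    ∑ x ∈ S, ∑ y ∈ T, A x y = density S T A * (#S * #T) := by
  rcases S.eq_empty_or_nonempty with rfl | hS
  · simp
  rcases T.eq_empty_or_nonempty with rfl | hT
  · simp
  have hS' : (0 : ℝ) < #S := by exact_mod_cast hS.card_pos
  have hT' : (0 : ℝ) < #T := by exact_mod_cast hT.card_pos
  rw [density, div_mul_cancel₀ _ (by positivity)]

theorem density_swap (S : Finset X) (T : Finset Y) (A : X → Y → ℝ) :
    density T S (fun y x => A x y) = density S T A := by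
  rw [density, density, Finset.sum_comm, mul_comm]

theorem Binary.density_nonneg {A : X → Y → ℝ} (hA : Binary A) (S : Finset X) (T : Finset Y) :
    0 ≤ density S T A :=
  div_nonneg (Finset.sum_nonneg fun x _ => Finset.sum_nonneg fun y _ => hA.nonneg x y)
    (by positivity)

theorem Binary.sum_le_card {A : X → Y → ℝ} (hA : Binary A) (S : Finset X) (T : Finset Y) :
    ∑ x ∈ S, ∑ y ∈ T, A x y ≤ #S * #T := by
  calc ∑ x ∈ S, ∑ y ∈ T, A x y ≤ ∑ x ∈ S, ∑ y ∈ T, (1 : ℝ) :=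
        Finset.sum_le_sum fun x _ => Finset.sum_le_sum fun y _ => hA.le_one x y
    _ = #S * #T := by simp

theorem Binary.density_le_one {A : X → Y → ℝ} (hA : Binary A) (S : Finset X) (T : Finset Y) :
    density S T A ≤ 1 :=
  div_le_one_of_le₀ (hA.sum_le_card S T) (by positivity)

theorem nonempty_of_density_pos {A : X → Y → ℝ} {S : Finset X} {T : Finset Y}
    (h : 0 < density S T A) : S.Nonempty ∧ T.Nonempty := by
  constructor <;> rw [Finset.nonempty_iff_ne_empty] <;> rintro rfl <;> simp [density] at h

theorem density_congr {A A' : X → Y → ℝ} {S : Finset X} {T : Finset Y}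
    (h : ∀ x ∈ S, ∀ y ∈ T, A x y = A' x y) : density S T A = density S T A' := by
  rw [density, density,
    Finset.sum_congr rfl fun x hx => Finset.sum_congr rfl fun y hy => h x hx y hy]

/-! ### Irregular matrices have dense subrectangles -/

/-- The unnormalized `U(2,l)` count: `∑_{x₁,x₂ ∈ S} (∑_{y ∈ T} A(x₁,y) A(x₂,y)) ^ l`. -/
noncomputable def pairMoment (A : X → Y → ℝ) (T : Finset Y) (S : Finset X) (l : ℕ) : ℝ :=
  ∑ x₁ ∈ S, ∑ x₂ ∈ S, (∑ y ∈ T, A x₁ y * A x₂ y) ^ l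

theorem sum_gridTuples_eq_pairMoment (A : X → Y → ℝ) (S : Finset X) (T : Finset Y) (l : ℕ) :
    (∑ xs ∈ Fintype.piFinset (fun _ : Fin 2 => S),
      ∑ ys ∈ Fintype.piFinset (fun _ : Fin l => T),
      ∏ i : Fin 2, ∏ j : Fin l, A (xs i) (ys j)) = pairMoment A T S l := by
  have h1 : ∀ xs : Fin 2 → X,
      ∑ ys ∈ Fintype.piFinset (fun _ : Fin l => T), ∏ i : Fin 2, ∏ j : Fin l, A (xs i) (ys j)
        = (∑ y ∈ T, A (xs 0) y * A (xs 1) y) ^ l := by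
    intro xs
    have := Finset.prod_univ_sum (fun _ : Fin l => T) (fun _ y => A (xs 0) y * A (xs 1) y)
    simp only [Finset.prod_const, Finset.card_univ, Fintype.card_fin] at this
    rw [this]
    refine Finset.sum_congr rfl fun ys _ => ?_
    rw [Fin.prod_univ_two, ← Finset.prod_mul_distrib]
  simp only [h1]
  rw [pairMoment, ← Finset.sum_product']
  refine Finset.sum_bij' (fun xs _ => (xs 0, xs 1)) (fun p _ => ![p.1, p.2]) ?_ ?_ ?_ ?_ ?_
  · intro xs hxs
    rw [Fintype.mem_piFinset] at hxs
    simp [hxs 0, hxs 1]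
  · rintro ⟨a, b⟩ hp
    rw [Finset.mem_product] at hp
    rw [Fintype.mem_piFinset]
    intro i
    fin_cases i
    · exact hp.1
    · exact hp.2
  · intro xs _
    ext i
    fin_cases i <;> rfl
  · rintro ⟨a, b⟩ _
    rfl
  · intro xs _
    rfl

theorem sum_eq_card_filter {A : X → Y → ℝ} (hA : Binary A) (S : Finset X) (y : Y) :
    ∑ x ∈ S, A x y = #{x ∈ S | A x y = 1} := by
  rw [Finset.card_filter]
  push_cast
  refine Finset.sum_congr rfl fun x _ => ?_
  rcases hA x y with h | h <;> simp [h]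

theorem pairMoment_succ {A : X → Y → ℝ} (hA : Binary A) (T : Finset Y) (S : Finset X) (l : ℕ) :
    pairMoment A T S (l + 1) = ∑ y ∈ T, pairMoment A T {x ∈ S | A x y = 1} l := by
  have h2 : ∀ y, pairMoment A T {x ∈ S | A x y = 1} l =
      ∑ x₁ ∈ S, ∑ x₂ ∈ S, A x₁ y * A x₂ y * (∑ y ∈ T, A x₁ y * A x₂ y) ^ l := by
    intro y
    rw [pairMoment, Finset.sum_filter]
    refine Finset.sum_congr rfl fun x₁ _ => ?_
    rw [Finset.sum_filter]
    rcases hA x₁ y with h | h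
    · simp [h]
    · rw [if_pos h]
      refine Finset.sum_congr rfl fun x₂ _ => ?_
      rcases hA x₂ y with h' | h' <;> simp [h, h']
  simp only [h2]
  rw [pairMoment, Finset.sum_comm]
  simp_rw [Finset.sum_comm (s := T)]
  rw [Finset.sum_comm]
  refine Finset.sum_congr rfl fun x₁ _ => Finset.sum_congr rfl fun x₂ _ => ?_
  rw [pow_succ', Finset.sum_mul]

theorem pairMoment_le_trivial {A : X → Y → ℝ} (hA : Binary A) (T : Finset Y) (S : Finset X)
    (l : ℕ) : pairMoment A T S l ≤ (#T : ℝ) ^ l * (#S : ℝ) ^ 2 := by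
  have h : ∀ x₁ x₂, ∑ y ∈ T, A x₁ y * A x₂ y ≤ #T := fun x₁ x₂ => by
    calc ∑ y ∈ T, A x₁ y * A x₂ y ≤ ∑ y ∈ T, (1 : ℝ) :=
          Finset.sum_le_sum fun y _ =>
            mul_le_one₀ (hA.le_one _ _) (hA.nonneg _ _) (hA.le_one _ _)
      _ = #T := by simp
  calc pairMoment A T S l ≤ ∑ x₁ ∈ S, ∑ x₂ ∈ S, (#T : ℝ) ^ l :=
        Finset.sum_le_sum fun x₁ _ => Finset.sum_le_sum fun x₂ _ =>
          pow_le_pow_left₀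
            (Finset.sum_nonneg fun y _ => mul_nonneg (hA.nonneg _ _) (hA.nonneg _ _)) (h x₁ x₂) l
    _ = (#T : ℝ) ^ l * (#S : ℝ) ^ 2 := by
        simp
        ring

/-- If every large row set `S` has small second moment of its column degrees, then all higher
pair moments are small, up to the contribution of the small row sets. -/
theorem pairMoment_le {A : X → Y → ℝ} (hA : Binary A) (T : Finset Y) {θ κ : ℝ} (hθ : 0 ≤ θ)
    (R : Finset X)
    (h : ∀ S ⊆ R, κ ≤ #S → ∑ y ∈ T, (∑ x ∈ S, A x y) ^ 2 ≤ θ * #T * (#S : ℝ) ^ 2)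
    (l : ℕ) : ∀ S ⊆ R, pairMoment A T S l ≤ (#T : ℝ) ^ l * (θ ^ l * (#S : ℝ) ^ 2 + κ ^ 2) := by
  induction l with
  | zero =>
    intro S _
    simp only [pairMoment, pow_zero, Finset.sum_const, nsmul_eq_mul, mul_one, one_mul]
    nlinarith [sq_nonneg κ]
  | succ l ih =>
    intro S hS
    by_cases hκ : κ ≤ #S
    · rw [pairMoment_succ hA]
      calc ∑ y ∈ T, pairMoment A T {x ∈ S | A x y = 1} l
          ≤ ∑ y ∈ T, (#T : ℝ) ^ l * (θ ^ l * (∑ x ∈ S, A x y) ^ 2 + κ ^ 2) := by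
            refine Finset.sum_le_sum fun y _ => ?_
            rw [sum_eq_card_filter hA]
            exact ih _ ((Finset.filter_subset _ _).trans hS)
        _ = (#T : ℝ) ^ l * (θ ^ l * ∑ y ∈ T, (∑ x ∈ S, A x y) ^ 2 + #T * κ ^ 2) := by
            rw [← Finset.mul_sum, Finset.sum_add_distrib, ← Finset.mul_sum]
            simp
        _ ≤ (#T : ℝ) ^ l * (θ ^ l * (θ * #T * (#S : ℝ) ^ 2) + #T * κ ^ 2) := by
            gcongr
            exact h S hS hκ
        _ = (#T : ℝ) ^ (l + 1) * (θ ^ (l + 1) * (#S : ℝ) ^ 2 + κ ^ 2) := by ring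
    · refine (pairMoment_le_trivial hA T S _).trans ?_
      push Not at hκ
      have : (#S : ℝ) ^ 2 ≤ κ ^ 2 := pow_le_pow_left₀ (by positivity) hκ.le 2
      gcongr
      have : 0 ≤ θ ^ (l + 1) * (#S : ℝ) ^ 2 := by positivity
      linarith

theorem sub_add_pow_le_pow {a b : ℝ} (hb : 1 ≤ b) (hab : b ≤ a) {l : ℕ} (hl : 1 ≤ l) :
    a - b + b ^ l ≤ a ^ l := by
  induction l, hl using Nat.le_induction with
  | base => simp
  | succ l _ ih =>
    have h1 : 1 ≤ b ^ l := one_le_pow₀ hb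
    rw [pow_succ, pow_succ]
    nlinarith [mul_le_mul_of_nonneg_right ih (by linarith : (0 : ℝ) ≤ a),
      mul_nonneg (by linarith : 0 ≤ b ^ l) (by linarith : 0 ≤ a - b)]

theorem gridRegular_of_pairMoment_le {A : X → Y → ℝ} {S : Finset X} {T : Finset Y}
    (hS : S.Nonempty) (hT : T.Nonempty) (hA : Binary A) {ε : ℝ} (hε : 0 < ε) {d : ℕ} (hd : 1 ≤ d)
    (h : pairMoment A T S d ≤ ((1 + ε) * density S T A) ^ (2 * d) * ((#S : ℝ) ^ 2 * (#T : ℝ) ^ d)) :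
    GridRegular S T ε 2 d A := by
  have hS' : (0 : ℝ) < #S := by exact_mod_cast hS.card_pos
  have hT' : (0 : ℝ) < #T := by exact_mod_cast hT.card_pos
  have h0 : 0 ≤ (1 + ε) * density S T A := mul_nonneg (by linarith) (hA.density_nonneg S T)
  rw [GridRegular, gridNorm, sum_gridTuples_eq_pairMoment]
  have h1 : pairMoment A T S d / ((#S : ℝ) ^ 2 * (#T : ℝ) ^ d)
      ≤ ((1 + ε) * density S T A) ^ (2 * d) := by
    rwa [div_le_iff₀ (by positivity)]
  have h2 : 0 ≤ pairMoment A T S d :=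
    Finset.sum_nonneg fun _ _ => Finset.sum_nonneg fun _ _ => pow_nonneg
      (Finset.sum_nonneg fun _ _ => mul_nonneg (hA.nonneg _ _) (hA.nonneg _ _)) _
  calc _ ≤ (((1 + ε) * density S T A) ^ (2 * d)) ^ ((1 : ℝ) / ((2 : ℕ) * (d : ℕ))) :=
        Real.rpow_le_rpow (by positivity) h1 (by positivity)
    _ = (1 + ε) * density S T A := by
        have : ((1 : ℝ) / ((2 : ℕ) * (d : ℕ))) = ((2 * d : ℕ) : ℝ)⁻¹ := by
          push_cast
          rw [one_div]
        rw [this]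
        exact Real.pow_rpow_inv_natCast h0 (by omega)

theorem exists_dense_of_not_gridRegular {A : X → Y → ℝ} (hA : Binary A) {S : Finset X}
    {T : Finset Y} {ε : ℝ} (hε : 0 < ε) {d : ℕ} (hd : 1 ≤ d) (hα : 0 < density S T A)
    (h : ¬ GridRegular S T ε 2 d A) :
    ∃ S' ⊆ S, ∃ T' ⊆ T, ε / 2 * density S T A ^ d * #S ≤ #S' ∧
      ε / 2 * density S T A ^ 2 * #T ≤ #T' ∧
      (1 + ε / 4) * density S T A ≤ density S' T' A := by
  obtain ⟨hS, hT⟩ := nonempty_of_density_pos hα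
  have hS' : (0 : ℝ) < #S := by exact_mod_cast hS.card_pos
  have hT' : (0 : ℝ) < #T := by exact_mod_cast hT.card_pos
  set α := density S T A with hα_def
  obtain ⟨S', hS'S, hκ, hlarge⟩ : ∃ S' ⊆ S, ε / 2 * α ^ d * #S ≤ #S' ∧
      ((1 + ε / 2) * α) ^ 2 * #T * (#S' : ℝ) ^ 2 < ∑ y ∈ T, (∑ x ∈ S', A x y) ^ 2 := by
    by_contra! hcon
    refine h (gridRegular_of_pairMoment_le hS hT hA hε hd ?_)
    refine (pairMoment_le hA T (sq_nonneg ((1 + ε / 2) * α)) S hcon d S subset_rfl).trans ?_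
    rw [← hα_def]
    have h1 := sub_add_pow_le_pow (a := (1 + ε) ^ 2) (b := (1 + ε / 2) ^ 2) (l := d)
      (by nlinarith) (by nlinarith) hd
    have h2 : (ε / 2) ^ 2 + ((1 + ε / 2) ^ 2) ^ d ≤ ((1 + ε) ^ 2) ^ d := by nlinarith
    calc (#T : ℝ) ^ d * ((((1 + ε / 2) * α) ^ 2) ^ d * (#S : ℝ) ^ 2 + (ε / 2 * α ^ d * #S) ^ 2)
        = (((ε / 2) ^ 2 + ((1 + ε / 2) ^ 2) ^ d)) * α ^ (2 * d) * ((#S : ℝ) ^ 2 * (#T : ℝ) ^ d) := by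
          simp only [mul_pow, ← pow_mul]
          ring
      _ ≤ ((1 + ε) ^ 2) ^ d * α ^ (2 * d) * ((#S : ℝ) ^ 2 * (#T : ℝ) ^ d) := by gcongr
      _ = _ := by rw [mul_pow, ← pow_mul]
  have hS'pos : (0 : ℝ) < #S' := lt_of_lt_of_le (by positivity) hκ
  set T' := {y ∈ T | (1 + ε / 4) * α * #S' ≤ ∑ x ∈ S', A x y} with hT'_def
  have hT'T : T' ⊆ T := Finset.filter_subset _ _
  have hcard : ε / 2 * α ^ 2 * #T ≤ #T' := by
    have hle : ∀ y ∈ T, (∑ x ∈ S', A x y) ^ 2 ≤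
        (if (1 + ε / 4) * α * #S' ≤ ∑ x ∈ S', A x y then (#S' : ℝ) ^ 2 else 0)
          + ((1 + ε / 4) * α * #S') ^ 2 := by
      intro y _
      have h0 : 0 ≤ ∑ x ∈ S', A x y := Finset.sum_nonneg fun x _ => hA.nonneg x y
      split_ifs with hy
      · have : ∑ x ∈ S', A x y ≤ #S' := by
          rw [sum_eq_card_filter hA]
          exact_mod_cast Finset.card_filter_le _ _
        nlinarith [sq_nonneg ((1 + ε / 4) * α * #S')]
      · push Not at hy
        nlinarith
    have hsum := hlarge.trans_le (Finset.sum_le_sum hle)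
    rw [Finset.sum_add_distrib, ← Finset.sum_filter, ← hT'_def] at hsum
    simp only [Finset.sum_const, nsmul_eq_mul] at hsum
    have hsq : (0 : ℝ) < (#S' : ℝ) ^ 2 := by positivity
    have h3 : (((1 + ε / 2) * α) ^ 2 - ((1 + ε / 4) * α) ^ 2) * #T * (#S' : ℝ) ^ 2
        ≤ #T' * (#S' : ℝ) ^ 2 := by nlinarith
    refine le_trans ?_ (le_of_mul_le_mul_right h3 hsq)
    gcongr
    nlinarith [mul_pos hε hε, mul_pos (mul_pos hε hε) (mul_pos hα hα), sq_nonneg α]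
  have hT'pos : (0 : ℝ) < #T' := lt_of_lt_of_le (by positivity) hcard
  refine ⟨S', hS'S, T', hT'T, hκ, hcard, ?_⟩
  rw [density, le_div_iff₀ (by positivity), Finset.sum_comm]
  calc (1 + ε / 4) * α * (#S' * #T') = ∑ y ∈ T', (1 + ε / 4) * α * #S' := by
        simp
        ring
    _ ≤ _ := Finset.sum_le_sum fun y hy => (Finset.mem_filter.mp hy).2

/-! ### Extremal rectangles -/

/-- The rectangle `S × T` maximizes `density ^ M * area` among all its subrectangles. -/
def Extremal (M : ℕ) (S : Finset X) (T : Finset Y) (A : X → Y → ℝ) : Prop :=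
  ∀ S' ⊆ S, ∀ T' ⊆ T,
    density S' T' A ^ M * (#S' * #T') ≤ density S T A ^ M * ((#S : ℝ) * #T)

theorem Extremal.swap {M : ℕ} {S : Finset X} {T : Finset Y} {A : X → Y → ℝ}
    (h : Extremal M S T A) : Extremal M T S fun y x => A x y := by
  intro T' hT' S' hS'
  rw [density_swap S' T' A, density_swap S T A, mul_comm (#T' : ℝ), mul_comm (#T : ℝ)]
  exact h S' hS' T' hT'

theorem exists_extremal (M : ℕ) (S : Finset X) (T : Finset Y) (A : X → Y → ℝ) :
    ∃ S' ⊆ S, ∃ T' ⊆ T, Extremal M S' T' A ∧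
      density S T A ^ M * ((#S : ℝ) * #T) ≤ density S' T' A ^ M * (#S' * #T') := by
  obtain ⟨⟨S', T'⟩, hmem, hmax⟩ := Finset.exists_max_image (S.powerset ×ˢ T.powerset)
    (fun p => density p.1 p.2 A ^ M * ((#p.1 : ℝ) * #p.2)) ⟨(S, T), by simp⟩
  simp only [Finset.mem_product, Finset.mem_powerset, Prod.forall] at hmem hmax
  exact ⟨S', hmem.1, T', hmem.2,
    fun S'' hS'' T'' hT'' => hmax S'' T'' ⟨hS''.trans hmem.1, hT''.trans hmem.2⟩,
    hmax S T ⟨subset_rfl, subset_rfl⟩⟩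

theorem Extremal.le_row_sum {M : ℕ} {S : Finset X} {T : Finset Y} {A : X → Y → ℝ}
    (h : Extremal M S T A) (hα : 0 < density S T A) {η : ℝ} (hη : 0 < η) (hM : 1 ≤ M * η)
    {x : X} (hx : x ∈ S) : (1 - η) * density S T A * #T ≤ ∑ y ∈ T, A x y := by
  obtain ⟨hS, hT⟩ := nonempty_of_density_pos hα
  have hT' : (0 : ℝ) < #T := by exact_mod_cast hT.card_pos
  have hM0 : M ≠ 0 := by
    rintro rfl
    norm_num at hM
  by_contra! hlt
  set α := density S T A
  have hsplit : ∑ y ∈ T, A x y + ∑ x ∈ S.erase x, ∑ y ∈ T, A x y = ∑ x ∈ S, ∑ y ∈ T, A x y :=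
    Finset.add_sum_erase S (fun x => ∑ y ∈ T, A x y) hx
  rw [sum_eq_density_mul, sum_eq_density_mul] at hsplit
  have hcard : (#S : ℝ) = #(S.erase x) + 1 := by
    exact_mod_cast (Finset.card_erase_add_one hx).symm
  set β := density (S.erase x) T A
  set m : ℝ := (#(S.erase x) : ℝ)
  have hm0 : 0 ≤ m := by positivity
  have hmain : α * (m + η) < β * m := by
    have : α * (m + η) * #T < β * m * #T := by
      rw [hcard] at hsplit
      nlinarith
    exact lt_of_mul_lt_mul_right this hT'.le
  have hm : 0 < m := by
    rcases hm0.eq_or_lt with h0 | h0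
    · rw [← h0] at hmain
      nlinarith
    · exact h0
  have hβ : α * (1 + η / m) < β := by
    rw [show α * (1 + η / m) = α * (m + η) / m by field_simp]
    rwa [div_lt_iff₀ hm]
  have hpow : (α * (1 + η / m)) ^ M < β ^ M := pow_lt_pow_left₀ hβ (by positivity) hM0
  have hbern : 1 + (M : ℝ) * (η / m) ≤ (1 + η / m) ^ M :=
    one_add_mul_le_pow (by linarith [div_nonneg hη.le hm.le]) M
  have h1 : m + 1 ≤ (1 + η / m) ^ M * m := by
    calc m + 1 ≤ m + M * η := by linarith
      _ = (1 + (M : ℝ) * (η / m)) * m := by field_simp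
      _ ≤ _ := by gcongr
  have h2 := h (S.erase x) (Finset.erase_subset _ _) T subset_rfl
  rw [hcard] at h2
  have h3 : α ^ M * ((m + 1) * #T) < β ^ M * (m * #T) := by
    calc α ^ M * ((m + 1) * #T) ≤ α ^ M * ((1 + η / m) ^ M * m * #T) := by gcongr
      _ = (α * (1 + η / m)) ^ M * (m * #T) := by rw [mul_pow]; ring
      _ < β ^ M * (m * #T) := by gcongr
  exact absurd h2 (not_le.mpr h3)

theorem Extremal.density_le {M : ℕ} (hM : M ≠ 0) {S : Finset X} {T : Finset Y} {A : X → Y → ℝ}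
    (hA : Binary A) (h : Extremal M S T A) {S' : Finset X} {T' : Finset Y} (hS' : S' ⊆ S)
    (hT' : T' ⊆ T) {σ η : ℝ} (hη : 0 ≤ η) (hσ : 1 ≤ (1 + η) ^ M * σ)
    (hcard : σ * (#S * #T) ≤ #S' * #T') : density S' T' A ≤ (1 + η) * density S T A := by
  by_contra! hlt
  have h0 : 0 ≤ (1 + η) * density S T A := mul_nonneg (by linarith) (hA.density_nonneg S T)
  obtain ⟨hS'n, hT'n⟩ := nonempty_of_density_pos (h0.trans_lt hlt)
  have hS'c : (0 : ℝ) < #S' := by exact_mod_cast hS'n.card_pos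
  have hT'c : (0 : ℝ) < #T' := by exact_mod_cast hT'n.card_pos
  have hα := hA.density_nonneg S T
  refine absurd (h S' hS' T' hT') (not_le.mpr ?_)
  calc density S T A ^ M * ((#S : ℝ) * #T)
      ≤ density S T A ^ M * (((1 + η) ^ M * σ) * ((#S : ℝ) * #T)) :=
        mul_le_mul_of_nonneg_left (le_mul_of_one_le_left (by positivity) hσ) (by positivity)
    _ = ((1 + η) * density S T A) ^ M * (σ * ((#S : ℝ) * #T)) := by rw [mul_pow]; ring
    _ ≤ ((1 + η) * density S T A) ^ M * (#S' * #T') := by gcongr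
    _ < density S' T' A ^ M * (#S' * #T') := by gcongr

theorem Extremal.minDegree {M : ℕ} {S : Finset X} {T : Finset Y} {A : X → Y → ℝ}
    (h : Extremal M S T A) (hα : 0 < density S T A) {ε : ℝ} (hε : 0 < ε) (hM : 1 ≤ M * ε) :
    MinDegree S T ε A := by
  intro x hx
  have hT' : (0 : ℝ) < #T := by exact_mod_cast (nonempty_of_density_pos hα).2.card_pos
  rw [rowDeg, le_div_iff₀ hT']
  exact h.le_row_sum hα hε hM hx

/-- A subrectangle of positive proportion of an extremal rectangle is regular, as long as its
density has not dropped. -/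
theorem Extremal.gridRegular_of_le {M : ℕ} (hM : M ≠ 0) {S : Finset X} {T : Finset Y}
    {A : X → Y → ℝ} (hA : Binary A) (h : Extremal M S T A) {S' : Finset X} {T' : Finset Y}
    (hS' : S' ⊆ S) (hT' : T' ⊆ T) {ε η σ τ : ℝ} (hε : 0 < ε) {d : ℕ} (hd : 1 ≤ d) (hη : 0 ≤ η)
    (hτ : 0 < τ) (hτα : τ ≤ density S' T' A)
    (hdens : (1 + η) * density S T A < (1 + ε / 4) * density S' T' A)
    (hσ : 1 ≤ (1 + η) ^ M * (ε ^ 2 / 4 * τ ^ (d + 2) * σ))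
    (hσ0 : 0 ≤ σ) (hcard : σ * (#S * #T) ≤ #S' * #T') : GridRegular S' T' ε 2 d A := by
  by_contra hreg
  obtain ⟨S'', hS'', T'', hT'', hS''c, hT''c, hdense⟩ :=
    exists_dense_of_not_gridRegular hA hε hd (hτ.trans_le hτα) hreg
  have hle := h.density_le hM hA (hS''.trans hS') (hT''.trans hT') hη hσ ?_
  · linarith
  · calc ε ^ 2 / 4 * τ ^ (d + 2) * σ * (#S * #T)
        = (ε / 2 * τ ^ d) * (ε / 2 * τ ^ 2) * (σ * (#S * #T)) := by ring
      _ ≤ (ε / 2 * density S' T' A ^ d) * (ε / 2 * density S' T' A ^ 2) * (#S' * #T') := by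
          have h2 := hA.density_nonneg S' T'
          gcongr
      _ = (ε / 2 * density S' T' A ^ d * #S') * (ε / 2 * density S' T' A ^ 2 * #T') := by ring
      _ ≤ #S'' * #T'' := by
          have h2 := hA.density_nonneg S' T'
          gcongr

/-- The rows of `S` whose degree into `T'` is noticeably below the density of `S × T`. -/
noncomputable def lowRows (ε : ℝ) (S : Finset X) (T T' : Finset Y) (A : X → Y → ℝ) : Finset X :=
  {x ∈ S | ∑ y ∈ T', A x y < (1 - ε / 2) * density S T A * #T'}

/-- Restricting an extremal rectangle to a large set of columns keeps it regular and of large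
minimum degree, up to a small set of rows. -/
theorem Extremal.restrict_columns {M : ℕ} (hM : M ≠ 0) {S : Finset X} {T : Finset Y}
    {A : X → Y → ℝ} (hA : Binary A) (h : Extremal M S T A) {T' : Finset Y} (hT' : T' ⊆ T)
    (hT'n : T'.Nonempty) {ε δ η σ τ : ℝ} (hε : 0 < ε) (hε1 : ε < 1) (hδ : 0 < δ) (hδ1 : δ ≤ 1 / 4)
    (hη : η = δ * ε / 4) {d : ℕ} (hd : 1 ≤ d) (hτ : 0 < τ) (hτ1 : τ ≤ 1) (hτα : τ ≤ density S T A)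
    (hMη : 1 ≤ M * η) (hσ0 : 0 < σ) (hcard : σ * #T ≤ #T')
    (hσ : 1 ≤ (1 + η) ^ M * (ε ^ 2 / 4 * (τ / 2) ^ (d + 2) * (ε / 4 * τ * σ))) :
    (#(lowRows ε S T T' A) : ℝ) ≤ δ * #S ∧ (S \ lowRows ε S T T' A).Nonempty ∧
      GridRegular (S \ lowRows ε S T T' A) T' ε 2 d A ∧
      MinDegree (S \ lowRows ε S T T' A) T' ε A := by
  have hα : 0 < density S T A := hτ.trans_le hτα
  obtain ⟨hS, hT⟩ := nonempty_of_density_pos hα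
  have hSc : (0 : ℝ) < #S := by exact_mod_cast hS.card_pos
  have hTc : (0 : ℝ) < #T := by exact_mod_cast hT.card_pos
  have hT'c : (0 : ℝ) < #T' := by exact_mod_cast hT'n.card_pos
  have hη0 : 0 < η := by rw [hη]; positivity
  have hηε : η ≤ ε / 16 := by rw [hη]; nlinarith
  have hεη0 : 0 < ε * η := by positivity
  have hεη : ε * η ≤ η := mul_le_of_le_one_left hη0.le hε1.le
  have hη_reg : 1 + η < (1 + ε / 4) * (1 - η) := by linarith
  have hη_deg : (1 - ε) * (1 + η) ≤ 1 - ε / 2 := by linarith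
  set low := lowRows ε S T T' A with hlow_def
  have hlowS : low ⊆ S := Finset.filter_subset _ _
  have hdiffS : S \ low ⊆ S := Finset.sdiff_subset
  set α := density S T A with hα_def
  have hcol : (1 - η) * α * (#S * #T') ≤ ∑ x ∈ S, ∑ y ∈ T', A x y := by
    rw [Finset.sum_comm]
    calc (1 - η) * α * (#S * #T') = ∑ y ∈ T', (1 - η) * α * #S := by
          simp
          ring
      _ ≤ _ := Finset.sum_le_sum fun y hy => by
          have := h.swap.le_row_sum (by rwa [density_swap]) hη0 hMη (hT' hy)
          rwa [density_swap] at this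
  have hlowsum : ∑ x ∈ low, ∑ y ∈ T', A x y ≤ (1 - ε / 2) * α * (#low * #T') := by
    calc ∑ x ∈ low, ∑ y ∈ T', A x y ≤ ∑ x ∈ low, (1 - ε / 2) * α * #T' :=
          Finset.sum_le_sum fun x hx => (Finset.mem_filter.mp hx).2.le
      _ = _ := by
          simp
          ring
  have hsplit : ∑ x ∈ S \ low, ∑ y ∈ T', A x y + ∑ x ∈ low, ∑ y ∈ T', A x y
      = ∑ x ∈ S, ∑ y ∈ T', A x y := Finset.sum_sdiff hlowS
  have hcardS : (#(S \ low) : ℝ) + #low = #S := by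
    exact_mod_cast Finset.card_sdiff_add_card_eq_card hlowS
  set E := density (S \ low) T' A with hE_def
  have hEsum : ∑ x ∈ S \ low, ∑ y ∈ T', A x y = E * (#(S \ low) * #T') :=
    sum_eq_density_mul _ _ _
  have hEle1 : E ≤ 1 := hA.density_le_one _ _
  set H : ℝ := (#(S \ low) : ℝ)
  set L : ℝ := (#low : ℝ)
  have hH0 : 0 ≤ H := by positivity
  have hL0 : 0 ≤ L := by positivity
  have hmass : (1 - η) * α * #S - (1 - ε / 2) * α * L ≤ E * H := by
    have : ((1 - η) * α * #S - (1 - ε / 2) * α * L) * #T' ≤ E * H * #T' := by linarith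
    exact le_of_mul_le_mul_right this hT'c
  have hHlarge : ε / 4 * τ * #S ≤ H := by
    have h1 : ε / 4 * α * #S ≤ E * H := by
      have : (1 - ε / 2) * α * L ≤ (1 - ε / 2) * α * #S := by
        have : 0 ≤ (1 - ε / 2) * α := mul_nonneg (by linarith) hα.le
        gcongr
        linarith
      have : 0 ≤ (ε / 4 - η) * (α * #S) := mul_nonneg (by linarith) (by positivity)
      linarith
    have h2 : E * H ≤ H := mul_le_of_le_one_left hH0 hEle1
    have h3 : ε / 4 * τ * #S ≤ ε / 4 * α * #S := by gcongr
    linarith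
  have hHpos : 0 < H := lt_of_lt_of_le (by positivity) hHlarge
  have hHne : (S \ low).Nonempty := by
    rw [← Finset.card_pos, ← Nat.cast_pos (α := ℝ)]
    exact hHpos
  have hrect : ε / 4 * τ * σ * (#S * #T) ≤ H * #T' := by
    calc ε / 4 * τ * σ * (#S * #T) = (ε / 4 * τ * #S) * (σ * #T) := by ring
      _ ≤ H * #T' := by gcongr
  have hElow : (1 - η) * α ≤ E := by
    have : (1 - η) * α * H ≤ E * H := by
      have : 0 ≤ (ε / 2 - η) * (α * L) := mul_nonneg (by linarith) (by positivity)
      rw [← hcardS] at hmass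
      linarith
    exact le_of_mul_le_mul_right this hHpos
  have hE_up : E ≤ (1 + η) * α := by
    refine h.density_le hM hA hdiffS hT' hη0.le (hσ.trans ?_) hrect
    refine mul_le_mul_of_nonneg_left ?_ (by positivity)
    refine mul_le_of_le_one_left (by positivity) ?_
    have h1 : (τ / 2) ^ (d + 2) ≤ 1 := pow_le_one₀ (by positivity) (by linarith)
    have h2 : ε ^ 2 / 4 ≤ 1 := by nlinarith
    exact mul_le_one₀ h2 (by positivity) h1
  refine ⟨?_, hHne, ?_, ?_⟩
  · have h1 : (1 - η) * α * #S - (1 - ε / 2) * α * L ≤ (1 + η) * α * H :=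
      hmass.trans (by gcongr)
    have h2 : ε / 2 * L ≤ 2 * η * #S := by
      have : α * (ε / 2 * L) ≤ α * (2 * η * #S) := by
        have h3 : 0 ≤ α * (η * L) := by positivity
        rw [← hcardS] at h1 ⊢
        linarith
      exact le_of_mul_le_mul_left this hα
    have : ε / 2 * L ≤ ε / 2 * (δ * #S) := h2.trans_eq (by rw [hη]; ring)
    exact le_of_mul_le_mul_left this (by positivity)
  · refine h.gridRegular_of_le hM hA hdiffS hT' hε hd hη0.le (τ := τ / 2) (by positivity) ?_ ?_ hσ
      (by positivity) hrect
    · have : η * α ≤ 1 / 2 * α := by gcongr; linarith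
      linarith
    · calc (1 + η) * α < (1 + ε / 4) * (1 - η) * α := by gcongr
        _ = (1 + ε / 4) * ((1 - η) * α) := by ring
        _ ≤ (1 + ε / 4) * E := by gcongr
  · intro x hx
    rw [Finset.mem_sdiff] at hx
    have hx2 : (1 - ε / 2) * α * #T' ≤ ∑ y ∈ T', A x y := by
      by_contra! hlt
      exact hx.2 (Finset.mem_filter.mpr ⟨hx.1, hlt⟩)
    rw [rowDeg, le_div_iff₀ hT'c]
    refine le_trans (mul_le_mul_of_nonneg_right ?_ hT'c.le) hx2
    calc (1 - ε) * E ≤ (1 - ε) * ((1 + η) * α) :=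
          mul_le_mul_of_nonneg_left hE_up (by linarith)
      _ = (1 - ε) * (1 + η) * α := by ring
      _ ≤ (1 - ε / 2) * α := by gcongr

/-! ### Peeling off extremal rectangles -/

/-- All nonzero entries of the matrix lie in `S × T`. -/
def SupportedOn (S : Finset X) (T : Finset Y) (A : X → Y → ℝ) : Prop :=
  ∀ x y, A x y ≠ 0 → x ∈ S ∧ y ∈ T

theorem SupportedOn.swap {S : Finset X} {T : Finset Y} {A : X → Y → ℝ} (h : SupportedOn S T A) :
    SupportedOn T S fun y x => A x y :=
  fun y x hne => (h x y hne).symm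

/-- The matrix with all entries outside `S × T` replaced by zero. -/
noncomputable def restrict (S : Finset X) (T : Finset Y) (A : X → Y → ℝ) : X → Y → ℝ :=
  fun x y => if x ∈ S ∧ y ∈ T then A x y else 0

theorem Binary.restrict {A : X → Y → ℝ} (hA : Binary A) (S : Finset X) (T : Finset Y) :
    Binary (restrict S T A) := by
  intro x y
  rw [ABDecomposition.restrict]
  split_ifs
  · exact hA x y
  · exact Or.inl rfl

theorem supportedOn_restrict (S : Finset X) (T : Finset Y) (A : X → Y → ℝ) :
    SupportedOn S T (restrict S T A) := by
  intro x y h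
  by_contra hxy
  exact h (if_neg hxy)

theorem restrict_apply_of_mem {S : Finset X} {T : Finset Y} (A : X → Y → ℝ) {x : X} {y : Y}
    (hx : x ∈ S) (hy : y ∈ T) : restrict S T A x y = A x y :=
  if_pos ⟨hx, hy⟩

theorem density_restrict {S S' : Finset X} {T T' : Finset Y} (A : X → Y → ℝ) (hS : S' ⊆ S)
    (hT : T' ⊆ T) : density S' T' (restrict S T A) = density S' T' A :=
  density_congr fun _ hx _ hy => restrict_apply_of_mem A (hS hx) (hT hy)

theorem Extremal.restrict {M : ℕ} {S : Finset X} {T : Finset Y} {A : X → Y → ℝ}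
    (h : Extremal M S T A) : Extremal M S T (restrict S T A) := by
  intro S' hS' T' hT'
  rw [density_restrict A hS' hT', density_restrict A subset_rfl subset_rfl]
  exact h S' hS' T' hT'

/-- A zero-one matrix together with a rectangle. -/
structure Rect (X Y : Type*) where
  /-- The rows of the rectangle. -/
  rows : Finset X
  /-- The columns of the rectangle. -/
  cols : Finset Y
  /-- The matrix. -/
  mat : X → Y → ℝ

/-- `r` is a large, dense, extremal rectangle inside `S × T`. -/
structure Rect.IsDenseIn (M : ℕ) (τ : ℝ) (S : Finset X) (T : Finset Y) (r : Rect X Y) : Prop where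
  rows_subset : r.rows ⊆ S
  cols_subset : r.cols ⊆ T
  binary : Binary r.mat
  supported : SupportedOn r.rows r.cols r.mat
  extremal : Extremal M r.rows r.cols r.mat
  dense : τ < density r.rows r.cols r.mat
  large : τ ^ M * (#S * #T) ≤ #r.rows * #r.cols

theorem log_area_step {m m' τ a N : ℝ} (hτ : 0 < τ) (hm : τ < m) (ha : a ≤ N) (hN : 0 < N)
    (hm' : m' * N ≤ m * N - m * a) :
    a + (if τ < m' then 1 + Real.log (m' / τ) else 0) * N ≤ (1 + Real.log (m / τ)) * N := by
  have hm0 : 0 < m := hτ.trans hm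
  split_ifs with h
  · have hm'0 : 0 < m' := hτ.trans h
    have h1 : Real.log (m' / τ) = Real.log (m / τ) + Real.log (m' / m) := by
      rw [← Real.log_mul (by positivity) (by positivity)]
      congr 1
      field_simp
    have h2 : Real.log (m' / m) ≤ m' / m - 1 := Real.log_le_sub_one_of_pos (by positivity)
    have h3 : (m' / m - 1) * N ≤ -a := by
      rw [div_sub_one hm0.ne', div_mul_eq_mul_div, div_le_iff₀ hm0]
      linarith
    have h4 := mul_le_mul_of_nonneg_right h2 hN.le
    rw [h1]
    linarith
  · have : 0 ≤ Real.log (m / τ) := Real.log_nonneg (by rw [le_div_iff₀ hτ]; linarith)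
    nlinarith

theorem exists_peeling_aux {M : ℕ} {τ : ℝ} (hM : M ≠ 0) (hτ : 0 < τ) {S : Finset X}
    {T : Finset Y} (hS : S.Nonempty) (hT : T.Nonempty) (n : ℕ) :
    ∀ A : X → Y → ℝ, Binary A → SupportedOn S T A → density S T A ≤ n * τ ^ (M + 1) →
    ∃ (R : X → Y → ℝ) (L : List (Rect X Y)),
      Binary R ∧ SupportedOn S T R ∧ density S T R ≤ τ ∧
      (∀ x y, A x y = R x y + (L.map fun r => r.mat x y).sum) ∧
      (∀ r ∈ L, r.IsDenseIn M τ S T) ∧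
      (L.map fun r => (#r.rows : ℝ) * #r.cols).sum ≤
        (if τ < density S T A then 1 + Real.log (density S T A / τ) else 0) * (#S * #T) ∧
      L.length * τ ^ (M + 1) ≤ density S T A := by
  have hSc : (0 : ℝ) < #S := by exact_mod_cast hS.card_pos
  have hTc : (0 : ℝ) < #T := by exact_mod_cast hT.card_pos
  have hbase : ∀ A : X → Y → ℝ, Binary A → SupportedOn S T A → density S T A ≤ τ →
      ∃ (R : X → Y → ℝ) (L : List (Rect X Y)),
      Binary R ∧ SupportedOn S T R ∧ density S T R ≤ τ ∧
      (∀ x y, A x y = R x y + (L.map fun r => r.mat x y).sum) ∧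
      (∀ r ∈ L, r.IsDenseIn M τ S T) ∧
      (L.map fun r => (#r.rows : ℝ) * #r.cols).sum ≤
        (if τ < density S T A then 1 + Real.log (density S T A / τ) else 0) * (#S * #T) ∧
      L.length * τ ^ (M + 1) ≤ density S T A := by
    intro A hA hsupp hle
    refine ⟨A, [], hA, hsupp, hle, by simp, by simp, ?_, ?_⟩
    · simp [not_lt.mpr hle]
    · simpa using hA.density_nonneg S T
  induction n with
  | zero =>
    intro A hA hsupp hle
    exact hbase A hA hsupp (by simp at hle; linarith)
  | succ n ih =>
    intro A hA hsupp hn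
    rcases le_or_gt (density S T A) τ with hle | hgt
    · exact hbase A hA hsupp hle
    obtain ⟨S', hS', T', hT', hext, hbig⟩ := exists_extremal M S T A
    set m := density S T A with hm_def
    set α := density S' T' A with hα_def
    have hm0 : 0 < m := hτ.trans hgt
    have hα0 : 0 ≤ α := hA.density_nonneg S' T'
    have hα1 : α ≤ 1 := hA.density_le_one S' T'
    have harea : (#S' : ℝ) * #T' ≤ #S * #T := by
      gcongr
    have hmα : m ≤ α := by
      by_contra! hlt
      have : α ^ M * ((#S' : ℝ) * #T') < m ^ M * ((#S : ℝ) * #T) := by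
        calc α ^ M * ((#S' : ℝ) * #T') ≤ α ^ M * ((#S : ℝ) * #T) := by gcongr
          _ < m ^ M * ((#S : ℝ) * #T) := by gcongr
      linarith
    have hlarge : τ ^ M * ((#S : ℝ) * #T) ≤ #S' * #T' := by
      calc τ ^ M * ((#S : ℝ) * #T) ≤ m ^ M * ((#S : ℝ) * #T) := by gcongr
        _ ≤ α ^ M * (#S' * #T') := hbig
        _ ≤ #S' * #T' := mul_le_of_le_one_left (by positivity) (pow_le_one₀ hα0 hα1)
    set A' : X → Y → ℝ := fun x y => if x ∈ S' ∧ y ∈ T' then 0 else A x y with hA'_def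
    have hA'bin : Binary A' := by
      intro x y
      simp only [hA'_def]
      split_ifs
      · exact Or.inl rfl
      · exact hA x y
    have hA'supp : SupportedOn S T A' := by
      intro x y hne
      refine hsupp x y fun h0 => hne ?_
      simp [hA'_def, h0]
    have hsplit : ∀ x y, A' x y + restrict S' T' A x y = A x y := by
      intro x y
      simp only [hA'_def, restrict]
      split_ifs <;> simp
    have hmass : density S T A' * (#S * #T) = m * (#S * #T) - α * (#S' * #T') := by
      have h1 : ∑ x ∈ S, ∑ y ∈ T, A x y =
          ∑ x ∈ S, ∑ y ∈ T, A' x y + ∑ x ∈ S, ∑ y ∈ T, restrict S' T' A x y := by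
        simp only [← Finset.sum_add_distrib, hsplit]
      have h2 : ∑ x ∈ S, ∑ y ∈ T, restrict S' T' A x y = ∑ x ∈ S', ∑ y ∈ T', A x y := by
        rw [← Finset.sum_subset hS']
        · refine Finset.sum_congr rfl fun x hx => ?_
          rw [← Finset.sum_subset hT']
          · exact Finset.sum_congr rfl fun y hy => restrict_apply_of_mem A hx hy
          · intro y _ hy
            exact if_neg fun h => hy h.2
        · intro x _ hx
          exact Finset.sum_eq_zero fun y _ => if_neg fun h => hx h.1
      rw [h2, sum_eq_density_mul, sum_eq_density_mul, sum_eq_density_mul] at h1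
      linarith
    have hdrop : density S T A' + τ ^ (M + 1) ≤ m := by
      have h1 : τ * (τ ^ M * ((#S : ℝ) * #T)) ≤ α * (#S' * #T') := by
        gcongr
        linarith
      have h2 : (density S T A' + τ ^ (M + 1)) * ((#S : ℝ) * #T) ≤ m * ((#S : ℝ) * #T) := by
        rw [add_mul, hmass, pow_succ]
        linarith
      exact le_of_mul_le_mul_right h2 (by positivity)
    obtain ⟨R, L, hR, hRs, hRτ, hsum, hL, harea', hlen⟩ := ih A' hA'bin hA'supp (by
      push_cast at hn
      linarith)
    refine ⟨R, ⟨S', T', restrict S' T' A⟩ :: L, hR, hRs, hRτ, ?_, ?_, ?_, ?_⟩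
    · intro x y
      rw [← hsplit, hsum, List.map_cons, List.sum_cons]
      ring
    · intro r hr
      rcases List.mem_cons.mp hr with rfl | hr
      · refine ⟨hS', hT', hA.restrict S' T', supportedOn_restrict S' T' A, hext.restrict, ?_, hlarge⟩
        simp only [density_restrict A subset_rfl subset_rfl]
        exact hgt.trans_le hmα
      · exact hL r hr
    · rw [List.map_cons, List.sum_cons, if_pos hgt]
      refine le_trans (add_le_add_right harea' _) ?_
      refine log_area_step hτ hgt harea (by positivity) ?_
      rw [hmass]
      have : m * ((#S' : ℝ) * #T') ≤ α * (#S' * #T') := by gcongr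
      linarith
    · rw [List.length_cons]
      push_cast
      linarith

theorem exists_peeling {M : ℕ} (hM : M ≠ 0) (d : ℕ) {S : Finset X} {T : Finset Y}
    (hS : S.Nonempty) (hT : T.Nonempty) {A : X → Y → ℝ} (hA : Binary A)
    (hsupp : SupportedOn S T A) :
    ∃ (R : X → Y → ℝ) (L : List (Rect X Y)),
      Binary R ∧ SupportedOn S T R ∧ density S T R ≤ (1 / 2) ^ d ∧
      (∀ x y, A x y = R x y + (L.map fun r => r.mat x y).sum) ∧
      (∀ r ∈ L, r.IsDenseIn M ((1 / 2) ^ d) S T) ∧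
      (L.map fun r => (#r.rows : ℝ) * #r.cols).sum ≤ (d + 1) * (#S * #T) ∧
      L.length ≤ 2 ^ (d * (M + 1)) := by
  have hτ : (0 : ℝ) < (1 / 2) ^ d := by positivity
  obtain ⟨n, hn⟩ := exists_nat_ge (density S T A / ((1 / 2) ^ d) ^ (M + 1))
  rw [div_le_iff₀ (by positivity)] at hn
  obtain ⟨R, L, hR, hRs, hRτ, hsum, hL, harea, hlen⟩ :=
    exists_peeling_aux hM hτ hS hT n A hA hsupp hn
  have hm1 := hA.density_le_one S T
  refine ⟨R, L, hR, hRs, hRτ, hsum, hL, harea.trans ?_, ?_⟩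
  · gcongr
    split_ifs with h
    · have h1 : Real.log (density S T A / (1 / 2) ^ d) ≤ Real.log (2 ^ d) := by
        refine Real.log_le_log (div_pos (hτ.trans h) hτ) ?_
        rw [div_le_iff₀ hτ, ← mul_pow]
        norm_num
        exact hm1
      rw [Real.log_pow] at h1
      have h2 : (d : ℝ) * Real.log 2 ≤ d * 1 := by
        gcongr
        linarith [Real.log_two_lt_d9]
      linarith
    · positivity
  · have h1 : (L.length : ℝ) * ((1 / 2) ^ d) ^ (M + 1) ≤ 1 := hlen.trans hm1
    rw [← pow_mul, one_div, inv_pow, ← div_eq_mul_inv, div_le_one (by positivity)] at h1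
    exact_mod_cast h1

/-! ### Splitting products into boxes -/

theorem gridRegular_congr {A A' : X → Y → ℝ} {S : Finset X} {T : Finset Y} {ε : ℝ} {k l : ℕ}
    (h : ∀ x ∈ S, ∀ y ∈ T, A x y = A' x y) :
    GridRegular S T ε k l A ↔ GridRegular S T ε k l A' := by
  rw [GridRegular, GridRegular, gridNorm, gridNorm, density_congr h]
  have hsum : (∑ xs ∈ Fintype.piFinset (fun _ : Fin k => S),
      ∑ ys ∈ Fintype.piFinset (fun _ : Fin l => T),
      ∏ i : Fin k, ∏ j : Fin l, A (xs i) (ys j)) =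
      ∑ xs ∈ Fintype.piFinset (fun _ : Fin k => S),
      ∑ ys ∈ Fintype.piFinset (fun _ : Fin l => T),
      ∏ i : Fin k, ∏ j : Fin l, A' (xs i) (ys j) := by
    refine Finset.sum_congr rfl fun xs hxs => Finset.sum_congr rfl fun ys hys =>
      Finset.prod_congr rfl fun i _ => Finset.prod_congr rfl fun j _ => ?_
    rw [Fintype.mem_piFinset] at hxs hys
    exact h _ (hxs i) _ (hys j)
  rw [hsum]

theorem minDegree_congr {A A' : X → Y → ℝ} {S : Finset X} {T : Finset Y} {ε : ℝ}
    (h : ∀ x ∈ S, ∀ y ∈ T, A x y = A' x y) : MinDegree S T ε A ↔ MinDegree S T ε A' := by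
  rw [MinDegree, MinDegree, density_congr h]
  refine forall₂_congr fun x hx => ?_
  rw [rowDeg, rowDeg, Finset.sum_congr rfl (h x hx)]

/-- A pair of matrices `left`, `right` living on a box `rows × mid × cols`. -/
structure Box (X Y Z : Type*) where
  /-- The row set of the left matrix. -/
  rows : Finset X
  /-- The common index set. -/
  mid : Finset Y
  /-- The column set of the right matrix. -/
  cols : Finset Z
  /-- The left matrix. -/
  left : X → Y → ℝ
  /-- The right matrix. -/
  right : Y → Z → ℝ

/-- The matrices of the box are zero-one and supported on the (nonempty) sides of the box. -/
structure Box.Valid (p : Box X Y Z) : Prop where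
  rows_nonempty : p.rows.Nonempty
  mid_nonempty : p.mid.Nonempty
  cols_nonempty : p.cols.Nonempty
  binary_left : Binary p.left
  binary_right : Binary p.right
  supported_left : SupportedOn p.rows p.mid p.left
  supported_right : SupportedOn p.mid p.cols p.right

/-- One of the two matrices is sparse, or both are regular with large minimum degree. -/
def Box.Good (ε : ℝ) (d : ℕ) (p : Box X Y Z) : Prop :=
  density p.rows p.mid p.left ≤ (1 / 2) ^ d ∨ density p.mid p.cols p.right ≤ (1 / 2) ^ d ∨
    (GridRegular p.rows p.mid ε 2 d p.left ∧ MinDegree p.rows p.mid ε p.left ∧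
      GridRegular p.cols p.mid ε 2 d (fun z y => p.right y z) ∧
      MinDegree p.cols p.mid ε (fun z y => p.right y z))

/-- The volume of a box. -/
noncomputable def Box.volume (p : Box X Y Z) : ℝ := #p.rows * #p.mid * #p.cols

/-- The three-dimensional tensor of summands of the matrix product. -/
def Box.tensor (p : Box X Y Z) (x : X) (y : Y) (z : Z) : ℝ := p.left x y * p.right y z

theorem Box.volume_nonneg (p : Box X Y Z) : 0 ≤ p.volume := by
  rw [Box.volume]
  positivity

/-- The tensor `f` is a sum of at most `n` valid boxes, consisting of good boxes of total volume
at most `v` and of further boxes with at most `ρ` rows, of total volume at most `w`. -/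
def HasSplit (ε : ℝ) (d : ℕ) (f : X → Y → Z → ℝ) (ρ v w : ℝ) (n : ℕ) : Prop :=
  ∃ G L : List (Box X Y Z),
    (∀ x y z, f x y z = (G.map fun p => p.tensor x y z).sum + (L.map fun p => p.tensor x y z).sum) ∧
    (∀ p ∈ G, p.Valid ∧ p.Good ε d) ∧ (∀ p ∈ L, p.Valid ∧ #p.rows ≤ ρ) ∧
    (G.map Box.volume).sum ≤ v ∧ (L.map Box.volume).sum ≤ w ∧ G.length + L.length ≤ n

section HasSplit

variable {ε : ℝ} {d : ℕ} {f g : X → Y → Z → ℝ} {ρ ρ' v v' w w' : ℝ} {n n' : ℕ}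

theorem HasSplit.mono (h : HasSplit ε d f ρ v w n) (hρ : ρ ≤ ρ') (hv : v ≤ v') (hw : w ≤ w')
    (hn : n ≤ n') : HasSplit ε d f ρ' v' w' n' := by
  obtain ⟨G, L, h1, h2, h3, h4, h5, h6⟩ := h
  exact ⟨G, L, h1, h2, fun p hp => ⟨(h3 p hp).1, (h3 p hp).2.trans hρ⟩, h4.trans hv, h5.trans hw,
    h6.trans hn⟩

theorem HasSplit.congr (h : HasSplit ε d f ρ v w n) (hfg : ∀ x y z, g x y z = f x y z) :
    HasSplit ε d g ρ v w n := by
  obtain ⟨G, L, h1, h2⟩ := h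
  exact ⟨G, L, fun x y z => (hfg x y z).trans (h1 x y z), h2⟩

theorem HasSplit.add (hf : HasSplit ε d f ρ v w n) (hg : HasSplit ε d g ρ v' w' n') :
    HasSplit ε d (fun x y z => f x y z + g x y z) ρ (v + v') (w + w') (n + n') := by
  obtain ⟨G, L, h1, h2, h3, h4, h5, h6⟩ := hf
  obtain ⟨G', L', h1', h2', h3', h4', h5', h6'⟩ := hg
  refine ⟨G ++ G', L ++ L', ?_, ?_, ?_, ?_, ?_, ?_⟩
  · intro x y z
    beta_reduce
    rw [h1, h1', List.map_append, List.map_append, List.sum_append, List.sum_append]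
    ring
  · intro p hp
    exact (List.mem_append.mp hp).elim (h2 p) (h2' p)
  · intro p hp
    exact (List.mem_append.mp hp).elim (h3 p) (h3' p)
  · rw [List.map_append, List.sum_append]
    exact add_le_add h4 h4'
  · rw [List.map_append, List.sum_append]
    exact add_le_add h5 h5'
  · rw [List.length_append, List.length_append]
    omega

theorem HasSplit.zero : HasSplit ε d (fun (_ : X) (_ : Y) (_ : Z) => 0) ρ 0 0 0 :=
  ⟨[], [], by simp⟩

theorem HasSplit.of_good {p : Box X Y Z} (hp : p.Valid) (hg : p.Good ε d) :
    HasSplit ε d p.tensor ρ p.volume 0 1 :=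
  ⟨[p], [], by simp [hp, hg]⟩

theorem HasSplit.of_rows_le {p : Box X Y Z} (hp : p.Valid) (hρ : #p.rows ≤ ρ) :
    HasSplit ε d p.tensor ρ 0 p.volume 1 :=
  ⟨[], [p], by simp [hp, hρ]⟩

theorem HasSplit.list_sum {ι : Type*} {L : List ι} {F : ι → X → Y → Z → ℝ} {V W : ι → ℝ}
    (h : ∀ i ∈ L, HasSplit ε d (F i) ρ (V i) (W i) n) :
    HasSplit ε d (fun x y z => (L.map fun i => F i x y z).sum) ρ (L.map V).sum (L.map W).sum
      (L.length * n) := by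
  induction L with
  | nil => simpa using HasSplit.zero
  | cons i L ih =>
    have h1 := (h i List.mem_cons_self).add (ih fun j hj => h j (List.mem_cons_of_mem i hj))
    simp only [List.map_cons, List.sum_cons, List.length_cons]
    exact h1.mono le_rfl le_rfl le_rfl (by rw [add_mul, one_mul, add_comm])

end HasSplit

/-- Parameters for which extremal rectangles are regular, robustly for the left matrix. -/
structure Admissible (ε δ : ℝ) (d M₁ M₂ : ℕ) : Prop where
  eps_pos : 0 < ε
  eps_lt_one : ε < 1
  delta_pos : 0 < δ
  delta_le : δ ≤ 1 / 4
  one_le : 1 ≤ d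
  right_large : 1 ≤ M₂ * ε
  right_pow : 1 ≤ (1 + ε / 8) ^ M₂ * (ε ^ 2 / 4 * ((1 / 2) ^ d) ^ (d + 2))
  left_large : 1 ≤ M₁ * (δ * ε / 4)
  left_pow : 1 ≤ (1 + δ * ε / 4) ^ M₁ * (ε ^ 2 / 4 * ((1 / 2) ^ d / 2) ^ (d + 2) *
    (ε / 4 * (1 / 2) ^ d * ((1 / 2) ^ d) ^ M₂))

theorem Admissible.left_ne_zero {ε δ : ℝ} {d M₁ M₂ : ℕ} (h : Admissible ε δ d M₁ M₂) : M₁ ≠ 0 := by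
  rintro rfl
  have := h.left_large
  norm_num at this

theorem Admissible.right_ne_zero {ε δ : ℝ} {d M₁ M₂ : ℕ} (h : Admissible ε δ d M₁ M₂) :
    M₂ ≠ 0 := by
  rintro rfl
  have := h.right_large
  norm_num at this

theorem hasSplit_rect_mul_rect {ε δ : ℝ} {d M₁ M₂ : ℕ} (h : Admissible ε δ d M₁ M₂) {S : Finset X}
    {T : Finset Y} {U : Finset Z} (hU : U.Nonempty) {r : Rect X Y} {s : Rect Z Y}
    (hr : r.IsDenseIn M₁ ((1 / 2) ^ d) S T) (hs : s.IsDenseIn M₂ ((1 / 2) ^ d) U r.cols) :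
    HasSplit ε d (fun x y z => r.mat x y * s.mat z y) (δ * #r.rows)
      (#r.rows * (#s.rows * #s.cols)) (δ * #r.rows * (#s.rows * #s.cols)) 2 := by
  have hε := h.eps_pos
  have hτ : (0 : ℝ) < (1 / 2) ^ d := by positivity
  obtain ⟨hs_rows, hs_cols⟩ := nonempty_of_density_pos (hτ.trans hs.dense)
  have hcols : ((1 / 2) ^ d) ^ M₂ * (#r.cols : ℝ) ≤ #s.cols := by
    have hUc : (0 : ℝ) < #U := by exact_mod_cast hU.card_pos
    have h1 : (#s.rows : ℝ) * #s.cols ≤ #U * #s.cols := by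
      gcongr
      exact hs.rows_subset
    exact le_of_mul_le_mul_left (by linarith [hs.large]) hUc
  obtain ⟨hlow, hne, hreg, hdeg⟩ := hr.extremal.restrict_columns h.left_ne_zero hr.binary
    hs.cols_subset hs_cols hε h.eps_lt_one h.delta_pos h.delta_le rfl h.one_le hτ
    (pow_le_one₀ (by norm_num) (by norm_num)) hr.dense.le h.left_large (by positivity) hcols
    h.left_pow
  set low := lowRows ε r.rows r.cols s.cols r.mat
  have hlow_sub : low ⊆ r.rows := Finset.filter_subset _ _
  have hvalid : ∀ R : Finset X, R.Nonempty →
      Box.Valid ⟨R, s.cols, s.rows, restrict R s.cols r.mat, fun y z => s.mat z y⟩ := fun R hR =>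
    ⟨hR, hs_cols, hs_rows, hr.binary.restrict _ _, hs.binary.swap, supportedOn_restrict _ _ _,
      hs.supported.swap⟩
  have hmem : ∀ x ∈ r.rows \ low, ∀ y ∈ s.cols,
      r.mat x y = restrict (r.rows \ low) s.cols r.mat x y :=
    fun x hx y hy => (restrict_apply_of_mem _ hx hy).symm
  have hgood : Box.Good ε d ⟨r.rows \ low, s.cols, s.rows,
      restrict (r.rows \ low) s.cols r.mat, fun y z => s.mat z y⟩ := by
    refine Or.inr (Or.inr ⟨(gridRegular_congr hmem).mp hreg, (minDegree_congr hmem).mp hdeg, ?_, ?_⟩)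
    · refine hs.extremal.gridRegular_of_le h.right_ne_zero hs.binary subset_rfl subset_rfl hε
        h.one_le (η := ε / 8) (by positivity) hτ hs.dense.le ?_ (σ := 1) ?_ zero_le_one
        (one_mul _).le
      · have := hτ.trans hs.dense
        gcongr
        norm_num
      · rw [mul_one]
        exact h.right_pow
    · exact hs.extremal.minDegree (hτ.trans hs.dense) hε h.right_large
  have hsplit_low : HasSplit ε d
      (Box.tensor ⟨low, s.cols, s.rows, restrict low s.cols r.mat, fun y z => s.mat z y⟩)
      (δ * #r.rows) 0 (δ * #r.rows * (#s.rows * #s.cols)) 1 := by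
    rcases low.eq_empty_or_nonempty with he | hn
    · refine (HasSplit.zero.congr fun x y z => ?_).mono le_rfl le_rfl ?_ zero_le_one
      · simp [Box.tensor, restrict, he]
      · have := h.delta_pos
        positivity
    · refine (HasSplit.of_rows_le (hvalid low hn) hlow).mono le_rfl le_rfl ?_ le_rfl
      calc (#low : ℝ) * #s.cols * #s.rows = #low * (#s.rows * #s.cols) := by ring
        _ ≤ δ * #r.rows * (#s.rows * #s.cols) := by gcongr
  refine (((HasSplit.of_good (hvalid _ hne) hgood).add hsplit_low).congr ?_).mono le_rfl ?_ ?_ le_rfl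
  · intro x y z
    simp only [Box.tensor]
    by_cases hz : s.mat z y = 0
    · simp [hz]
    have hy := (hs.supported z y hz).2
    by_cases hx : x ∈ low
    · simp [restrict, hx, hy]
    · by_cases hxr : x ∈ r.rows
      · simp [restrict, hx, hy, hxr]
      · have : r.mat x y = 0 := by
          by_contra hne
          exact hxr (hr.supported x y hne).1
        simp [restrict, this]
  · rw [add_zero, Box.volume]
    calc (#(r.rows \ low) : ℝ) * #s.cols * #s.rows = #(r.rows \ low) * (#s.rows * #s.cols) := by ring
      _ ≤ #r.rows * (#s.rows * #s.cols) := by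
          gcongr
          exact Finset.sdiff_subset
  · rw [zero_add]

theorem hasSplit_rect_mul {ε δ : ℝ} {d M₁ M₂ : ℕ} (h : Admissible ε δ d M₁ M₂) {S : Finset X}
    {T : Finset Y} {U : Finset Z} (hU : U.Nonempty) {r : Rect X Y}
    (hr : r.IsDenseIn M₁ ((1 / 2) ^ d) S T) {B : Y → Z → ℝ} (hB : Binary B)
    (hsupp : SupportedOn T U B) :
    HasSplit ε d (fun x y z => r.mat x y * B y z) (δ * #S)
      ((d + 2) * #U * (#r.rows * #r.cols)) (δ * (d + 1) * #U * (#r.rows * #r.cols))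
      (1 + 2 ^ (d * (M₂ + 1)) * 2) := by
  have hτ : (0 : ℝ) < (1 / 2) ^ d := by positivity
  have hδ := h.delta_pos
  obtain ⟨hr_rows, hr_cols⟩ := nonempty_of_density_pos (hτ.trans hr.dense)
  have hrS : (#r.rows : ℝ) ≤ #S := by exact_mod_cast Finset.card_le_card hr.rows_subset
  obtain ⟨R, L, hR, hRs, hRτ, hsum, hL, harea, hlen⟩ := exists_peeling h.right_ne_zero d hU hr_cols
    (hB.swap.restrict U r.cols) (supportedOn_restrict U r.cols fun z y => B y z)
  have hsparse : HasSplit ε d (Box.tensor ⟨r.rows, r.cols, U, r.mat, fun y z => R z y⟩)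
      (δ * #S) (#U * (#r.rows * #r.cols)) 0 1 := by
    refine (HasSplit.of_good ⟨hr_rows, hr_cols, hU, hr.binary, hR.swap, hr.supported, hRs.swap⟩
      (Or.inr (Or.inl ?_))).mono le_rfl ?_ le_rfl le_rfl
    · simp only
      rwa [density_swap U r.cols R]
    · rw [Box.volume]
      exact le_of_eq (by ring)
  have hlist := HasSplit.list_sum (L := L) (F := fun s x y z => r.mat x y * s.mat z y)
    fun s hs => (hasSplit_rect_mul_rect h hU hr (hL s hs)).mono
      (mul_le_mul_of_nonneg_left hrS hδ.le) le_rfl le_rfl le_rfl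
  rw [List.sum_map_mul_left, List.sum_map_mul_left] at hlist
  refine ((hsparse.add hlist).congr ?_).mono le_rfl ?_ ?_ ?_
  · intro x y z
    rw [List.sum_map_mul_left, Box.tensor, ← mul_add, ← hsum z y]
    by_cases hx : r.mat x y = 0
    · simp [hx]
    · have hy := (hr.supported x y hx).2
      by_cases hz : z ∈ U
      · rw [restrict_apply_of_mem _ hz hy]
      · have : B y z = 0 := by
          by_contra hne
          exact hz (hsupp y z hne).2
        simp [restrict, hz, this]
  · have : (#r.rows : ℝ) * (L.map fun s => (#s.rows : ℝ) * #s.cols).sum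
        ≤ #r.rows * ((d + 1) * (#U * #r.cols)) := by gcongr
    linarith
  · have : δ * (#r.rows : ℝ) * (L.map fun s => (#s.rows : ℝ) * #s.cols).sum
        ≤ δ * #r.rows * ((d + 1) * (#U * #r.cols)) := by gcongr
    linarith
  · gcongr

theorem hasSplit_box {ε δ : ℝ} {d M₁ M₂ : ℕ} (h : Admissible ε δ d M₁ M₂) {p : Box X Y Z}
    (hp : p.Valid) :
    HasSplit ε d p.tensor (δ * #p.rows) ((d + 2) ^ 2 * p.volume) (δ * (d + 2) ^ 2 * p.volume)
      (1 + 2 ^ (d * (M₁ + 1)) * (1 + 2 ^ (d * (M₂ + 1)) * 2)) := by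
  have hδ := h.delta_pos
  have hvol := p.volume_nonneg
  obtain ⟨R, L, hR, hRs, hRτ, hsum, hL, harea, hlen⟩ := exists_peeling h.left_ne_zero d
    hp.rows_nonempty hp.mid_nonempty hp.binary_left hp.supported_left
  have hsparse : HasSplit ε d (Box.tensor ⟨p.rows, p.mid, p.cols, R, p.right⟩)
      (δ * #p.rows) p.volume 0 1 :=
    HasSplit.of_good ⟨hp.rows_nonempty, hp.mid_nonempty, hp.cols_nonempty, hR, hp.binary_right, hRs,
      hp.supported_right⟩ (Or.inl hRτ)
  have hlist := HasSplit.list_sum (L := L) (F := fun r x y z => r.mat x y * p.right y z)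
    fun r hr => hasSplit_rect_mul h hp.cols_nonempty (hL r hr) hp.binary_right hp.supported_right
  rw [List.sum_map_mul_left, List.sum_map_mul_left] at hlist
  refine ((hsparse.add hlist).congr ?_).mono le_rfl ?_ ?_ ?_
  · intro x y z
    rw [List.sum_map_mul_right, Box.tensor, Box.tensor, ← add_mul, ← hsum x y]
  · have h1 : (d + 2 : ℝ) * #p.cols * (L.map fun r => (#r.rows : ℝ) * #r.cols).sum
        ≤ (d + 2) * #p.cols * ((d + 1) * (#p.rows * #p.mid)) := by gcongr
    have h2 : (d + 2 : ℝ) * #p.cols * ((d + 1) * (#p.rows * #p.mid))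
        = (d + 2) * (d + 1) * p.volume := by
      rw [Box.volume]
      ring
    have h3 : 0 ≤ (d : ℝ) * p.volume := by positivity
    linarith
  · have h1 : δ * (d + 1) * #p.cols * (L.map fun r => (#r.rows : ℝ) * #r.cols).sum
        ≤ δ * (d + 1) * #p.cols * ((d + 1) * (#p.rows * #p.mid)) := by gcongr
    have h2 : δ * (d + 1) * #p.cols * ((d + 1) * (#p.rows * #p.mid))
        = δ * (d + 1) ^ 2 * p.volume := by
      rw [Box.volume]
      ring
    have h3 : δ * (d + 1) ^ 2 * p.volume ≤ δ * (d + 2) ^ 2 * p.volume := by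
      gcongr
      norm_num
    linarith
  · gcongr

theorem hasSplit_iterate {ε δ : ℝ} {d M₁ M₂ : ℕ} (h : Admissible ε δ d M₁ M₂)
    (hδ : δ * (d + 2) ^ 2 = 1 / 4) (t : ℕ) : ∀ {p : Box X Y Z}, p.Valid →
    HasSplit ε d p.tensor (δ ^ t * #p.rows) (4 / 3 * (1 - (1 / 4) ^ t) * (d + 2) ^ 2 * p.volume)
      ((1 / 4) ^ t * p.volume)
      ((1 + 2 ^ (d * (M₁ + 1)) * (1 + 2 ^ (d * (M₂ + 1)) * 2)) ^ t) := by
  set N := 1 + 2 ^ (d * (M₁ + 1)) * (1 + 2 ^ (d * (M₂ + 1)) * 2)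
  have hδ0 := h.delta_pos
  induction t with
  | zero =>
    intro p hp
    refine (HasSplit.of_rows_le hp ?_).mono le_rfl ?_ ?_ ?_ <;> simp
  | succ t ih =>
    intro p hp
    obtain ⟨G, L, hsum, hG, hL, hGv, hLv, hlen⟩ := hasSplit_box h hp
    have hgood : HasSplit ε d (fun x y z => (G.map fun q => q.tensor x y z).sum)
        (δ ^ (t + 1) * #p.rows) ((d + 2) ^ 2 * p.volume) 0 G.length :=
      ⟨G, [], by simp, hG, by simp, hGv, by simp, by simp⟩
    have hrest := HasSplit.list_sum (L := L) (F := Box.tensor) fun q hq =>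
      (ih (hL q hq).1).mono (ρ' := δ ^ (t + 1) * #p.rows) (by
        rw [pow_succ, mul_assoc]
        exact mul_le_mul_of_nonneg_left (hL q hq).2 (by positivity)) le_rfl le_rfl le_rfl
    rw [List.sum_map_mul_left, List.sum_map_mul_left] at hrest
    rw [hδ] at hLv
    refine ((hgood.add hrest).congr hsum).mono le_rfl ?_ ?_ ?_
    · have h1 : (1 / 4 : ℝ) ^ t ≤ 1 := pow_le_one₀ (by norm_num) (by norm_num)
      have h2 : 4 / 3 * (1 - (1 / 4 : ℝ) ^ t) * (d + 2) ^ 2 * (L.map Box.volume).sum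
          ≤ 4 / 3 * (1 - (1 / 4) ^ t) * (d + 2) ^ 2 * (1 / 4 * p.volume) := by
        have : 0 ≤ 1 - (1 / 4 : ℝ) ^ t := by linarith
        gcongr
      refine (add_le_add_right h2 _).trans (le_of_eq ?_)
      rw [pow_succ]
      ring
    · have h2 : (1 / 4 : ℝ) ^ t * (L.map Box.volume).sum ≤ (1 / 4) ^ t * (1 / 4 * p.volume) := by
        gcongr
      rw [pow_succ]
      linarith
    · have hN : 1 ≤ N ^ t := Nat.one_le_pow _ _ (by omega)
      calc G.length + L.length * N ^ t ≤ G.length * N ^ t + L.length * N ^ t := by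
            gcongr
            exact Nat.le_mul_of_pos_right _ hN
        _ = (G.length + L.length) * N ^ t := by ring
        _ ≤ N * N ^ t := by gcongr
        _ = N ^ (t + 1) := by ring

/-! ### Choice of parameters -/

theorem one_le_pow_mul {b c : ℝ} {m e : ℕ} (hb : 2 ≤ b ^ m) (hc : (1 / 2) ^ e ≤ c) :
    1 ≤ b ^ (m * e) * c := by
  calc (1 : ℝ) = 2 ^ e * (1 / 2) ^ e := by rw [← mul_pow]; norm_num
    _ ≤ (b ^ m) ^ e * c := by gcongr
    _ = b ^ (m * e) * c := by rw [pow_mul]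

theorem two_le_one_add_pow {a : ℝ} {m : ℕ} (ha : 0 ≤ a) (h : 1 ≤ m * a) : 2 ≤ (1 + a) ^ m := by
  have := one_add_mul_le_pow (show -2 ≤ a by linarith) m
  linarith

theorem admissible_of_one_le_mul {ε : ℝ} {d n : ℕ} (hε : 0 < ε) (hε1 : ε < 1) (hd : 1 ≤ d)
    (hn : 1 ≤ n * ε) : Admissible ε (1 / (4 * (d + 2) ^ 2)) d
      (16 * (d + 2) ^ 2 * n * (2 * n + 2 + (d + 1) * (d + 2) +
        (n + 2 + d + d * (8 * n * (2 * n + 2 + d * (d + 2))))))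
      (8 * n * (2 * n + 2 + d * (d + 2))) := by
  have hpow : (1 / 2 : ℝ) ^ n ≤ ε := by
    have h2 : (n : ℝ) ≤ 2 ^ n := by exact_mod_cast (Nat.lt_two_pow_self).le
    have h3 : 1 ≤ 2 ^ n * ε := hn.trans (by gcongr)
    rw [one_div, inv_pow]
    exact (inv_le_iff_one_le_mul₀' (by positivity)).mpr h3
  have hsq : (1 / 2 : ℝ) ^ (2 * n + 2) ≤ ε ^ 2 / 4 := by
    calc (1 / 2 : ℝ) ^ (2 * n + 2) = ((1 / 2) ^ n) ^ 2 / 4 := by ring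
      _ ≤ ε ^ 2 / 4 := by gcongr
  have hd0 : (0 : ℝ) < (d : ℝ) + 2 := by positivity
  have hquot : 1 / (4 * ((d : ℝ) + 2) ^ 2) * ε / 4 * (16 * (d + 2) ^ 2 * n) = n * ε := by
    field_simp
    ring
  have hn1 : 1 ≤ n := by
    rcases Nat.eq_zero_or_pos n with rfl | h
    · norm_num at hn
    · exact h
  constructor
  · exact hε
  · exact hε1
  · positivity
  · refine one_div_le_one_div_of_le (by norm_num) ?_
    nlinarith [(Nat.cast_nonneg d : (0 : ℝ) ≤ d)]
  · exact hd
  · refine hn.trans ?_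
    gcongr
    nlinarith [Nat.zero_le (d * (d + 2)), Nat.zero_le (n * n), Nat.zero_le (n * (d * (d + 2)))]
  · refine one_le_pow_mul (two_le_one_add_pow (by positivity) ?_) ?_
    · push_cast
      linarith
    · rw [pow_add, pow_mul]
      gcongr
  · have h : 1 ≤ 2 * n + 2 + (d + 1) * (d + 2) +
        (n + 2 + d + d * (8 * n * (2 * n + 2 + d * (d + 2)))) := by omega
    calc 1 ≤ n * ε * 1 := by rwa [mul_one]
      _ ≤ n * ε * ((2 * n + 2 + (d + 1) * (d + 2) +
          (n + 2 + d + d * (8 * n * (2 * n + 2 + d * (d + 2)))) : ℕ) : ℝ) := by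
          gcongr
          exact_mod_cast h
      _ = _ := by
          rw [← hquot]
          push_cast
          ring
  · refine one_le_pow_mul (two_le_one_add_pow (by positivity) ?_) ?_
    · push_cast
      rw [mul_comm, hquot]
      exact hn
    · have h4 : (1 / 2 : ℝ) ^ (n + 2) ≤ ε / 4 := by
        calc (1 / 2 : ℝ) ^ (n + 2) = (1 / 2) ^ n / 4 := by ring
          _ ≤ ε / 4 := by gcongr
      have h5 : ((1 / 2 : ℝ) ^ d / 2) ^ (d + 2) = (1 / 2) ^ ((d + 1) * (d + 2)) := by
        rw [pow_mul, pow_succ]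
        ring
      rw [h5, pow_add, pow_add _ (2 * n + 2), pow_add _ (n + 2 + d), pow_add _ (n + 2),
        pow_mul _ d (8 * n * _)]
      gcongr

theorem count_le {d n : ℕ} (hd : 1 ≤ d) (hn : 1 ≤ n) :
    (1 + 2 ^ (d * (16 * (d + 2) ^ 2 * n * (2 * n + 2 + (d + 1) * (d + 2) +
        (n + 2 + d + d * (8 * n * (2 * n + 2 + d * (d + 2))))) + 1)) *
      (1 + 2 ^ (d * (8 * n * (2 * n + 2 + d * (d + 2)) + 1)) * 2)) ^ d + 1 ≤
      2 ^ (10143 * n ^ 3 * d ^ 7) := by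
  have hd2 : d ≤ d ^ 2 := Nat.le_self_pow (by norm_num) d
  have hM₂ : 8 * n * (2 * n + 2 + d * (d + 2)) ≤ 56 * n ^ 2 * d ^ 2 := by
    have h1 : 2 * n + 2 ≤ 4 * n * d ^ 2 := by nlinarith
    have h2 : d * (d + 2) ≤ 3 * n * d ^ 2 := by nlinarith
    calc 8 * n * (2 * n + 2 + d * (d + 2)) ≤ 8 * n * (4 * n * d ^ 2 + 3 * n * d ^ 2) := by gcongr
      _ = 56 * n ^ 2 * d ^ 2 := by ring
  generalize 8 * n * (2 * n + 2 + d * (d + 2)) = M₂ at *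
  have hM₁ : 16 * (d + 2) ^ 2 * n * (2 * n + 2 + (d + 1) * (d + 2) + (n + 2 + d + d * M₂)) ≤
      10080 * n ^ 3 * d ^ 5 := by
    have h1 : n ≤ n ^ 2 * d ^ 3 := by
      calc n = n * 1 * 1 := by ring
        _ ≤ n * n * d ^ 3 := by gcongr; exact Nat.one_le_pow _ _ hd
        _ = n ^ 2 * d ^ 3 := by ring
    have h2 : d ^ 2 ≤ n ^ 2 * d ^ 3 := by
      calc d ^ 2 = 1 * d ^ 2 * 1 := by ring
        _ ≤ n ^ 2 * d ^ 2 * d := by gcongr; exact Nat.one_le_pow _ _ hn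
        _ = n ^ 2 * d ^ 3 := by ring
    have h3 : d * M₂ ≤ 56 * (n ^ 2 * d ^ 3) := by
      calc d * M₂ ≤ d * (56 * n ^ 2 * d ^ 2) := by gcongr
        _ = 56 * (n ^ 2 * d ^ 3) := by ring
    have h4 : 2 * n + 2 + (d + 1) * (d + 2) + (n + 2 + d + d * M₂) ≤ 70 * (n ^ 2 * d ^ 3) := by
      have : (d + 1) * (d + 2) = d ^ 2 + 3 * d + 2 := by ring
      omega
    calc 16 * (d + 2) ^ 2 * n * (2 * n + 2 + (d + 1) * (d + 2) + (n + 2 + d + d * M₂))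
        ≤ 16 * (d + 2 * d) ^ 2 * n * (70 * (n ^ 2 * d ^ 3)) := by
          gcongr
          omega
      _ = 10080 * n ^ 3 * d ^ 5 := by ring
  generalize 16 * (d + 2) ^ 2 * n * (2 * n + 2 + (d + 1) * (d + 2) + (n + 2 + d + d * M₂)) = M₁
    at *
  have hN : 1 + 2 ^ (d * (M₁ + 1)) * (1 + 2 ^ (d * (M₂ + 1)) * 2) ≤
      2 ^ (d * (M₁ + 1) + d * (M₂ + 1) + 2) := by
    rw [pow_add, pow_add]
    have h1 : 1 ≤ 2 ^ (d * (M₁ + 1)) := Nat.one_le_two_pow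
    have h2 : 1 ≤ 2 ^ (d * (M₂ + 1)) := Nat.one_le_two_pow
    nlinarith [Nat.mul_le_mul h1 h2]
  have hE : (d * (M₁ + 1) + d * (M₂ + 1) + 2) * d + 1 ≤ 10143 * n ^ 3 * d ^ 7 := by
    have h1 : 1 ≤ n ^ 3 * d ^ 5 := Nat.one_le_iff_ne_zero.mpr (by positivity)
    have h2 : n ^ 2 * d ^ 2 ≤ n ^ 3 * d ^ 5 := by gcongr <;> omega
    have h3 : M₁ + 1 + (M₂ + 1) ≤ 10138 * (n ^ 3 * d ^ 5) := by linarith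
    have h4 : 1 ≤ n ^ 3 * d ^ 7 := Nat.one_le_iff_ne_zero.mpr (by positivity)
    have h5 : d ≤ n ^ 3 * d ^ 7 := by
      calc d = 1 * d ^ 1 := by ring
        _ ≤ n ^ 3 * d ^ 7 := by gcongr <;> first | omega | exact Nat.one_le_pow _ _ hn
    calc (d * (M₁ + 1) + d * (M₂ + 1) + 2) * d + 1 = d ^ 2 * (M₁ + 1 + (M₂ + 1)) + 2 * d + 1 := by
          ring
      _ ≤ d ^ 2 * (10138 * (n ^ 3 * d ^ 5)) + 2 * (n ^ 3 * d ^ 7) + n ^ 3 * d ^ 7 := by gcongr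
      _ = 10141 * (n ^ 3 * d ^ 7) := by ring
      _ ≤ 10143 * n ^ 3 * d ^ 7 := by nlinarith
  calc _ ≤ (2 ^ (d * (M₁ + 1) + d * (M₂ + 1) + 2)) ^ d + 1 := by gcongr
    _ ≤ (2 ^ (d * (M₁ + 1) + d * (M₂ + 1) + 2)) ^ d * 2 := by
        have : 1 ≤ (2 ^ (d * (M₁ + 1) + d * (M₂ + 1) + 2)) ^ d :=
          Nat.one_le_pow _ _ (by positivity)
        omega
    _ = 2 ^ ((d * (M₁ + 1) + d * (M₂ + 1) + 2) * d + 1) := by rw [pow_succ 2 (_ * d), pow_mul]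
    _ ≤ 2 ^ (10143 * n ^ 3 * d ^ 7) := Nat.pow_le_pow_right (by norm_num) hE

theorem two_pow_le_exp {ε : ℝ} {d n : ℕ} (hε : 0 < ε) (hn : n ≤ 2 / ε) :
    (2 : ℝ) ^ (10143 * n ^ 3 * d ^ 7) ≤ Real.exp (100000 * (d : ℝ) ^ 7 * ε ^ (-(3 : ℝ))) := by
  have hn3 : (n : ℝ) ^ 3 ≤ 8 * ε ^ (-(3 : ℝ)) := by
    calc (n : ℝ) ^ 3 ≤ (2 / ε) ^ 3 := by gcongr
      _ = 8 * ε ^ (-(3 : ℝ)) := by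
        rw [Real.rpow_neg hε.le, show (3 : ℝ) = (3 : ℕ) by norm_num, Real.rpow_natCast]
        field_simp
        norm_num
  calc (2 : ℝ) ^ (10143 * n ^ 3 * d ^ 7) ≤ Real.exp 1 ^ (10143 * n ^ 3 * d ^ 7) := by
        gcongr
        linarith [Real.add_one_le_exp 1]
    _ = Real.exp (10143 * n ^ 3 * d ^ 7) := by
        rw [← Real.exp_nat_mul]
        push_cast
        ring_nf
    _ ≤ Real.exp (100000 * (d : ℝ) ^ 7 * ε ^ (-(3 : ℝ))) := by
        refine Real.exp_le_exp.mpr ?_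
        have h0 : 0 ≤ ε ^ (-(3 : ℝ)) := Real.rpow_nonneg hε.le _
        calc 10143 * (n : ℝ) ^ 3 * d ^ 7 ≤ 10143 * (8 * ε ^ (-(3 : ℝ))) * d ^ 7 := by gcongr
          _ = 81144 * (d ^ 7 * ε ^ (-(3 : ℝ))) := by ring
          _ ≤ 100000 * (d ^ 7 * ε ^ (-(3 : ℝ))) := by gcongr; norm_num
          _ = _ := by ring

/-! ### Assembling the decomposition -/

/-- Enlarging the row set makes the left matrix of a box sparse. -/
theorem Box.Valid.exists_good [Fintype X] {ε : ℝ} {d : ℕ} {p : Box X Y Z} (hp : p.Valid)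
    (h : (#p.rows : ℝ) ≤ (1 / 2) ^ d * Fintype.card X) :
    ∃ q : Box X Y Z, q.Valid ∧ q.Good ε d ∧ q.tensor = p.tensor ∧
      q.volume = 2 ^ d * p.volume := by
  have hcard : 2 ^ d * #p.rows ≤ Fintype.card X := by
    have : (2 : ℝ) ^ d * #p.rows ≤ Fintype.card X := by
      calc (2 : ℝ) ^ d * #p.rows ≤ 2 ^ d * ((1 / 2) ^ d * Fintype.card X) := by gcongr
        _ = Fintype.card X := by rw [← mul_assoc, ← mul_pow]; norm_num
    exact_mod_cast this
  obtain ⟨U, hU, hUcard⟩ := Finset.exists_superset_card_eq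
    (Nat.le_mul_of_pos_left #p.rows (Nat.two_pow_pos d)) hcard
  have hmid : (0 : ℝ) < #p.mid := by exact_mod_cast hp.mid_nonempty.card_pos
  have hrows : (0 : ℝ) < #p.rows := by exact_mod_cast hp.rows_nonempty.card_pos
  refine ⟨⟨U, p.mid, p.cols, p.left, p.right⟩, ⟨hp.rows_nonempty.mono hU, hp.mid_nonempty,
    hp.cols_nonempty, hp.binary_left, hp.binary_right,
    fun x y hxy => ⟨hU (hp.supported_left x y hxy).1, (hp.supported_left x y hxy).2⟩,
    hp.supported_right⟩, Or.inl ?_, rfl, ?_⟩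
  · have hsum : ∑ x ∈ U, ∑ y ∈ p.mid, p.left x y = ∑ x ∈ p.rows, ∑ y ∈ p.mid, p.left x y := by
      refine (Finset.sum_subset hU fun x _ hx => Finset.sum_eq_zero fun y _ => ?_).symm
      by_contra hne
      exact hx (hp.supported_left x y hne).1
    rw [density, hsum, hUcard]
    push_cast
    rw [div_le_iff₀ (by positivity)]
    calc _ ≤ (#p.rows : ℝ) * #p.mid := hp.binary_left.sum_le_card _ _
      _ = ((1 / 2) ^ d * 2 ^ d) * (#p.rows * #p.mid) := by rw [← mul_pow]; norm_num
      _ = _ := by ring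
  · rw [Box.volume, Box.volume, hUcard]
    push_cast
    ring

theorem exists_good_list [Fintype X] {ε : ℝ} {d : ℕ} (L : List (Box X Y Z))
    (hL : ∀ p ∈ L, p.Valid ∧ (#p.rows : ℝ) ≤ (1 / 2) ^ d * Fintype.card X) :
    ∃ L' : List (Box X Y Z), (∀ p ∈ L', p.Valid ∧ p.Good ε d) ∧
      (∀ x y z, (L'.map fun p => p.tensor x y z).sum = (L.map fun p => p.tensor x y z).sum) ∧
      (L'.map Box.volume).sum = 2 ^ d * (L.map Box.volume).sum ∧ L'.length = L.length := by
  induction L with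
  | nil => exact ⟨[], by simp⟩
  | cons p L ih =>
    obtain ⟨L', h1, h2, h3, h4⟩ := ih fun q hq => hL q (List.mem_cons_of_mem _ hq)
    obtain ⟨hp, hrows⟩ := hL p List.mem_cons_self
    obtain ⟨q, hq1, hq2, hq3, hq4⟩ := hp.exists_good (ε := ε) hrows
    refine ⟨q :: L', ?_, ?_, ?_, ?_⟩
    · intro r hr
      rcases List.mem_cons.mp hr with rfl | hr
      · exact ⟨hq1, hq2⟩
      · exact h1 r hr
    · intro x y z
      simp [h2, hq3]
    · simp [h3, hq4, mul_add]
    · simp [h4]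

theorem exists_list_of_binary [Fintype X] [Fintype Y] [Fintype Z] [Nonempty X] [Nonempty Y]
    [Nonempty Z] {A : X → Y → ℝ} {B : Y → Z → ℝ} (hA : Binary A) (hB : Binary B) {ε : ℝ} {d : ℕ}
    (hε : 0 < ε) (hε1 : ε < 1) (hd : 1 ≤ d) :
    ∃ L : List (Box X Y Z), 1 ≤ L.length ∧ (∀ p ∈ L, p.Valid ∧ p.Good ε d) ∧
      (∀ x y z, A x y * B y z = (L.map fun p => p.tensor x y z).sum) ∧
      (L.map Box.volume).sum ≤ 2 * ((d : ℝ) + 2) ^ 2 *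
        (Fintype.card X * Fintype.card Y * Fintype.card Z) ∧
      (L.length : ℝ) ≤ Real.exp (100000 * (d : ℝ) ^ 7 * ε ^ (-(3 : ℝ))) := by
  set n := ⌈1 / ε⌉₊
  have hn : 1 ≤ n * ε := (div_le_iff₀ hε).mp (Nat.le_ceil _)
  have hn1 : 1 ≤ n := Nat.one_le_ceil_iff.mpr (by positivity)
  have hn2 : n ≤ 2 / ε := by
    have h1 : (n : ℝ) < 1 / ε + 1 := Nat.ceil_lt_add_one (by positivity)
    have h2 : 1 ≤ 1 / ε := (one_le_div hε).mpr hε1.le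
    have h3 : 2 / ε = 1 / ε + 1 / ε := by ring
    linarith
  let p : Box X Y Z := ⟨univ, univ, univ, A, B⟩
  have hp : p.Valid := ⟨univ_nonempty, univ_nonempty, univ_nonempty, hA, hB,
    fun x y _ => ⟨mem_univ x, mem_univ y⟩, fun y z _ => ⟨mem_univ y, mem_univ z⟩⟩
  let q : Box X Y Z := ⟨univ, univ, univ, 0, 0⟩
  have hq : q.Valid := ⟨univ_nonempty, univ_nonempty, univ_nonempty, fun _ _ => Or.inl rfl,
    fun _ _ => Or.inl rfl, fun _ _ h => (h rfl).elim, fun _ _ h => (h rfl).elim⟩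
  have hqg : q.Good ε d := by
    refine Or.inl ?_
    simp [q, density]
  have hqv : q.volume = p.volume := rfl
  have hpv : p.volume = Fintype.card X * Fintype.card Y * Fintype.card Z := by
    simp [p, Box.volume]
  obtain ⟨G, L, h1, h2, h3, h4, h5, h6⟩ := hasSplit_iterate
    (admissible_of_one_le_mul hε hε1 hd hn) (by field_simp) d hp
  obtain ⟨L', h1', h2', h3', h4'⟩ := exists_good_list (ε := ε) (d := d) L fun r hr => by
    refine ⟨(h3 r hr).1, (h3 r hr).2.trans ?_⟩
    have hδ : 1 / (4 * ((d : ℝ) + 2) ^ 2) ≤ 1 / 2 :=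
      one_div_le_one_div_of_le (by norm_num) (by nlinarith [(Nat.cast_nonneg d : (0 : ℝ) ≤ d)])
    gcongr
    simp [p]
  refine ⟨q :: (G ++ L'), by simp, ?_, ?_, ?_, ?_⟩
  · intro r hr
    rcases List.mem_cons.mp hr with rfl | hr
    · exact ⟨hq, hqg⟩
    · exact (List.mem_append.mp hr).elim (h2 r) (h1' r)
  · intro x y z
    have := h1 x y z
    rw [List.map_cons, List.sum_cons, List.map_append, List.sum_append, h2', ← this]
    simp [q, p, Box.tensor]
  · rw [List.map_cons, List.sum_cons, List.map_append, List.sum_append, h3', hqv, ← hpv]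
    have hv := p.volume_nonneg
    have h7 : (2 : ℝ) ^ d * (L.map Box.volume).sum ≤ p.volume := by
      calc (2 : ℝ) ^ d * (L.map Box.volume).sum ≤ 2 ^ d * ((1 / 4) ^ d * p.volume) := by gcongr
        _ = (1 / 2) ^ d * p.volume := by rw [← mul_assoc, ← mul_pow]; norm_num
        _ ≤ 1 * p.volume := by
          gcongr
          exact pow_le_one₀ (by norm_num) (by norm_num)
        _ = p.volume := one_mul _
    have h8 : 4 / 3 * (1 - (1 / 4 : ℝ) ^ d) * (d + 2) ^ 2 * p.volume ≤
        4 / 3 * 1 * (d + 2) ^ 2 * p.volume := by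
      gcongr
      linarith [pow_nonneg (show (0 : ℝ) ≤ 1 / 4 by norm_num) d]
    have h9 : 3 * p.volume ≤ ((d : ℝ) + 2) ^ 2 * p.volume := by
      gcongr
      nlinarith [(Nat.cast_nonneg d : (0 : ℝ) ≤ d)]
    linarith
  · refine le_trans ?_ (two_pow_le_exp hε hn2)
    have h7 := (Nat.add_le_add_right h6 1).trans (count_le hd hn1)
    rw [List.length_cons, List.length_append, h4']
    exact_mod_cast h7

theorem Box.Valid.sum_tensor [Fintype Y] {p : Box X Y Z} (hp : p.Valid) (x : X) (z : Z) :
    (if x ∈ p.rows ∧ z ∈ p.cols then ∑ y ∈ p.mid, p.left x y * p.right y z else 0) =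
      ∑ y, p.tensor x y z := by
  have hmem : ∀ y, p.tensor x y z ≠ 0 → x ∈ p.rows ∧ y ∈ p.mid ∧ z ∈ p.cols := fun y hy =>
    ⟨(hp.supported_left x y (left_ne_zero_of_mul hy)).1,
      hp.supported_right y z (right_ne_zero_of_mul hy)⟩
  split_ifs with h
  · refine Finset.sum_subset (Finset.subset_univ _) fun y _ hy => ?_
    by_contra hne
    exact hy (hmem y hne).2.1
  · refine (Finset.sum_eq_zero fun y _ => ?_).symm
    by_contra hne
    exact h ⟨(hmem y hne).1, (hmem y hne).2.2⟩

end ABDecomposition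

/-- **AB-Decomposition (existential content).** There are universal constants `c, C > 0`
such that: for zero-one matrices `A ∈ {0,1}^{X×Y}`, `B ∈ {0,1}^{Y×Z}` on finite nonempty
sets, `ε ∈ (0,1)` and an integer `d ≥ 1`, there are pieces
`{(X_k, Y_k, Z_k, A_k, B_k)}_{k=1}^K` with: (1) `AB = Σ_k A_k B_k` entrywise (unnormalized
matrix products, extended by zeros); (2) each piece has `E[A_k] ≤ 2^{−d}` or
`E[B_k] ≤ 2^{−d}`, or both `A_k` and `B_kᵀ` are `(ε,2,d)`-regular and `ε`-min-degree;
(3) `Σ_k |X_k||Y_k||Z_k| ≤ 2(d+2)²|X||Y||Z|`; (4) `K ≤ exp(C·d⁷·ε^{−c})`. -/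
theorem AB_decomposition :
    ∃ c C : ℝ, 0 < c ∧ 0 < C ∧
    ∀ (X Y Z : Type) [Fintype X] [Fintype Y] [Fintype Z]
      [Nonempty X] [Nonempty Y] [Nonempty Z]
      (A : X → Y → ℝ) (B : Y → Z → ℝ),
      ZeroOne Finset.univ Finset.univ A → ZeroOne Finset.univ Finset.univ B →
      ∀ (ε : ℝ) (d : ℕ), ε ∈ Set.Ioo (0 : ℝ) 1 → 1 ≤ d →
      ∃ (K : ℕ) (Xk : Fin K → Finset X) (Yk : Fin K → Finset Y) (Zk : Fin K → Finset Z)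
        (Ak : Fin K → X → Y → ℝ) (Bk : Fin K → Y → Z → ℝ),
        1 ≤ K ∧
        (∀ i, (Xk i).Nonempty ∧ (Yk i).Nonempty ∧ (Zk i).Nonempty ∧
          ZeroOne (Xk i) (Yk i) (Ak i) ∧ ZeroOne (Yk i) (Zk i) (Bk i)) ∧
        -- (1) AB = Σ_k A_k B_k
        (∀ x z, (∑ y : Y, A x y * B y z)
            = ∑ i : Fin K,
                if x ∈ Xk i ∧ z ∈ Zk i then ∑ y ∈ Yk i, Ak i x y * Bk i y z else 0) ∧
        -- (2)
        (∀ i, density (Xk i) (Yk i) (Ak i) ≤ (2 : ℝ) ^ (-(d : ℝ)) ∨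
              density (Yk i) (Zk i) (Bk i) ≤ (2 : ℝ) ^ (-(d : ℝ)) ∨
          (GridRegular (Xk i) (Yk i) ε 2 d (Ak i) ∧ MinDegree (Xk i) (Yk i) ε (Ak i) ∧
           GridRegular (Zk i) (Yk i) ε 2 d (fun z y => Bk i y z) ∧
           MinDegree (Zk i) (Yk i) ε (fun z y => Bk i y z))) ∧
        -- (3)
        (∑ i : Fin K, ((Xk i).card : ℝ) * ((Yk i).card : ℝ) * ((Zk i).card : ℝ))
            ≤ 2 * ((d : ℝ) + 2) ^ 2
              * ((Fintype.card X : ℝ) * (Fintype.card Y : ℝ) * (Fintype.card Z : ℝ)) ∧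
        -- (4)
        (K : ℝ) ≤ Real.exp (C * (d : ℝ) ^ 7 * ε ^ (-c)) := by
  refine ⟨3, 100000, by norm_num, by norm_num, ?_⟩
  intro X Y Z _ _ _ _ _ _ A B hA hB ε d hε hd
  obtain ⟨L, h1, h2, h3, h4, h5⟩ := ABDecomposition.exists_list_of_binary
    (fun x y => hA x (mem_univ x) y (mem_univ y)) (fun y z => hB y (mem_univ y) z (mem_univ z))
    hε.1 hε.2 hd
  have hL : ∀ i : Fin L.length, L[i].Valid ∧ L[i].Good ε d := fun i => h2 _ (List.getElem_mem i.2)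
  have hpow : (2 : ℝ) ^ (-(d : ℝ)) = (1 / 2) ^ d := by
    rw [Real.rpow_neg (by norm_num), Real.rpow_natCast, one_div, inv_pow]
  refine ⟨L.length, fun i => L[i].rows, fun i => L[i].mid, fun i => L[i].cols,
    fun i => L[i].left, fun i => L[i].right, h1, ?_, ?_, ?_, ?_, h5⟩
  · intro i
    have h := (hL i).1
    exact ⟨h.rows_nonempty, h.mid_nonempty, h.cols_nonempty, fun x _ y _ => h.binary_left x y,
      fun y _ z _ => h.binary_right y z⟩
  · intro x z
    calc ∑ y, A x y * B y z = ∑ y, ∑ i : Fin L.length, L[i].tensor x y z := by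
          refine Finset.sum_congr rfl fun y _ => ?_
          rw [h3]
          exact (Fin.sum_univ_fun_getElem L fun p => p.tensor x y z).symm
      _ = ∑ i : Fin L.length, ∑ y, L[i].tensor x y z := Finset.sum_comm
      _ = _ := Finset.sum_congr rfl fun i _ => ((hL i).1.sum_tensor x z).symm
  · intro i
    rw [hpow]
    exact (hL i).2
  · exact (Fin.sum_univ_fun_getElem L ABDecomposition.Box.volume).trans_le h4
end

section
/- Let X, Y, Z be finite nonempty sets, let A ∈ ℝ_{≥0}^{X×Y} and B ∈ ℝ_{≥0}^{Y×Z}, let ε ∈ (0, 1/80) and let d ≥ 2/ε. Assume that (a) A and B^T are (ε,2,d)-regular, and (b) A and B^T are ε-min-degree. Then the scaled product A∘B is (E[A]·E[B], 80ε, 2^{−εd/2})-uniform. -/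
open Finset

/-- The scaled matrix product `(A ∘ B)(x,z) = E_{y∈Y} A(x,y)B(y,z)`. -/
noncomputable def scaledProd {X Y Z : Type*} [Fintype Y] (A : X → Y → ℝ) (B : Y → Z → ℝ) :
    X → Z → ℝ :=
  fun x z => (∑ y : Y, A x y * B y z) / (Fintype.card Y : ℝ)

open scoped Classical in
/-- `M` is `(α,ε,δ)`-uniform: at least a `(1−δ)`-fraction of the entries lie in
`[(1−ε)α, (1+ε)α]`. -/
def IsUniform {X Z : Type*} [Fintype X] [Fintype Z] (M : X → Z → ℝ) (α ε δ : ℝ) : Prop :=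
  (1 - δ) * ((Fintype.card X : ℝ) * (Fintype.card Z : ℝ)) ≤
    ((Finset.univ.filter (fun p : X × Z =>
        (1 - ε) * α ≤ M p.1 p.2 ∧ M p.1 p.2 ≤ (1 + ε) * α)).card : ℝ)

section Aux

variable {X Y Z : Type*} [Fintype Y]

theorem sum_sub_rowDeg_mul_sub_rowDeg [Nonempty Y] (f : X → Y → ℝ) (h : Z → Y → ℝ) (x : X)
    (z : Z) :
    ∑ y, (f x y - rowDeg univ f x) * (h z y - rowDeg univ h z) =
      ∑ y, f x y * h z y - Fintype.card Y * (rowDeg univ f x * rowDeg univ h z) := by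
  have hn : (Fintype.card Y : ℝ) ≠ 0 := by positivity
  have hf : ∑ y, f x y = Fintype.card Y * rowDeg univ f x := by
    rw [rowDeg, card_univ]; field_simp
  have hh : ∑ y, h z y = Fintype.card Y * rowDeg univ h z := by
    rw [rowDeg, card_univ]; field_simp
  simp_rw [sub_mul, mul_sub, sum_sub_distrib, ← sum_mul, ← mul_sum, hf, hh]
  simp only [sum_const, card_univ, nsmul_eq_mul]
  ring

variable [Fintype X] [Fintype Z]

/-- Expanding a power of an inner product of rows decouples the two row indices. -/
theorem sum_weighted_inner_pow (u : X → ℝ) (v : Z → ℝ) (g : X → Y → ℝ) (h : Z → Y → ℝ) (k : ℕ) :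
    ∑ x, ∑ z, u x * v z * (∑ y, g x y * h z y) ^ k =
      ∑ p : Fin k → Y, (∑ x, u x * ∏ i, g x (p i)) * (∑ z, v z * ∏ i, h z (p i)) := by
  classical
  have expand : ∀ x z, u x * v z * (∑ y, g x y * h z y) ^ k =
      ∑ p : Fin k → Y, (u x * ∏ i, g x (p i)) * (v z * ∏ i, h z (p i)) := by
    intro x z
    rw [Fintype.sum_pow, mul_sum]
    refine sum_congr rfl fun p _ => ?_
    rw [prod_mul_distrib]
    ring
  simp_rw [expand, sum_mul_sum]
  rw [eq_comm, sum_comm]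
  exact sum_congr rfl fun x _ => sum_comm

theorem sum_weighted_gram_pow_nonneg (w : X → ℝ) (g : X → Y → ℝ) (k : ℕ) :
    0 ≤ ∑ x, ∑ x', w x * w x' * (∑ y, g x y * g x' y) ^ k := by
  rw [sum_weighted_inner_pow]
  exact sum_nonneg fun p _ => mul_self_nonneg _

theorem sum_inner_pow_sq_le (g : X → Y → ℝ) (h : Z → Y → ℝ) (k : ℕ) :
    (∑ x, ∑ z, (∑ y, g x y * h z y) ^ k) ^ 2 ≤
      (∑ x, ∑ x', (∑ y, g x y * g x' y) ^ k) * ∑ z, ∑ z', (∑ y, h z y * h z' y) ^ k := by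
  have e₁ := sum_weighted_inner_pow (fun _ => 1) (fun _ => 1) g h k
  have e₂ := sum_weighted_inner_pow (fun _ => 1) (fun _ => 1) g g k
  have e₃ := sum_weighted_inner_pow (fun _ => 1) (fun _ => 1) h h k
  simp only [one_mul] at e₁ e₂ e₃
  rw [e₁, e₂, e₃]
  simp_rw [← pow_two (∑ _, _)]
  exact sum_mul_sq_le_sq_mul_sq _ _ _

/-- Each term of even order, and the term of order zero, in the binomial expansion of the `d`-th
moment of the Gram matrix around the rank-one matrix of degrees, bounds the moment from below. -/
theorem choose_mul_sum_le_sum_gram_pow [Nonempty Y] (f : X → Y → ℝ) {d k : ℕ} (hkd : k ≤ d) :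
    (d.choose k : ℝ) * ((Fintype.card Y : ℝ) ^ (d - k) *
      ∑ x, ∑ x', rowDeg univ f x ^ (d - k) * rowDeg univ f x' ^ (d - k) *
        (∑ y, (f x y - rowDeg univ f x) * (f x' y - rowDeg univ f x')) ^ k) ≤
      ∑ x, ∑ x', (∑ y, f x y * f x' y) ^ d := by
  set a := rowDeg univ f with ha
  set n := (Fintype.card Y : ℝ) with hn
  set M : X → X → ℝ := fun x x' => ∑ y, (f x y - a x) * (f x' y - a x') with hM
  have expand : ∑ x, ∑ x', (∑ y, f x y * f x' y) ^ d =
      ∑ j ∈ range (d + 1), (d.choose j : ℝ) * (n ^ (d - j) *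
        ∑ x, ∑ x', a x ^ (d - j) * a x' ^ (d - j) * M x x' ^ j) := by
    have term : ∀ x x', (∑ y, f x y * f x' y) ^ d =
        ∑ j ∈ range (d + 1), (d.choose j : ℝ) * (n ^ (d - j) *
          (a x ^ (d - j) * a x' ^ (d - j) * M x x' ^ j)) := by
      intro x x'
      have h1 : ∑ y, f x y * f x' y = M x x' + n * (a x * a x') := by
        have := sum_sub_rowDeg_mul_sub_rowDeg f f x x'
        simp only [hM]
        rw [this]; ring
      rw [h1, add_pow]
      refine sum_congr rfl fun j _ => ?_
      rw [mul_pow, mul_pow]; ring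
    simp_rw [term, mul_sum]
    rw [eq_comm, sum_comm]
    exact sum_congr rfl fun x _ => sum_comm
  rw [expand]
  refine single_le_sum (f := fun j => (d.choose j : ℝ) * (n ^ (d - j) *
        ∑ x, ∑ x', a x ^ (d - j) * a x' ^ (d - j) * M x x' ^ j)) (fun j _ => ?_)
    (mem_range.2 (Nat.lt_succ_of_le hkd))
  have := sum_weighted_gram_pow_nonneg (fun x => a x ^ (d - j)) (fun x y => f x y - a x) j
  positivity

theorem card_filter_lt_mul_pow_le {ι : Type*} [Fintype ι] (f : ι → ℝ) (hf : ∀ i, 0 ≤ f i)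
    {t : ℝ} (ht : 0 ≤ t) (k : ℕ) :
    ((univ.filter fun i => t < f i).card : ℝ) * t ^ k ≤ ∑ i, f i ^ k := by
  calc ((univ.filter fun i => t < f i).card : ℝ) * t ^ k
      = ∑ i ∈ univ.filter (fun i => t < f i), t ^ k := by simp
    _ ≤ ∑ i ∈ univ.filter (fun i => t < f i), f i ^ k :=
        sum_le_sum fun i hi => pow_le_pow_left₀ ht (mem_filter.1 hi).2.le k
    _ ≤ ∑ i, f i ^ k :=
        sum_le_sum_of_subset_of_nonneg (filter_subset _ _) fun i _ _ => pow_nonneg (hf i) k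

theorem pow_le_pow_self_mul_choose {d k : ℕ} (hkd : k ≤ d) : d ^ k ≤ k ^ k * d.choose k := by
  induction k generalizing d with
  | zero => simp
  | succ k ih =>
    obtain ⟨d, rfl⟩ : ∃ e, d = e + 1 := ⟨d - 1, by omega⟩
    have hkd' : k ≤ d := by omega
    have key : (d + 1) ^ k ≤ (k + 1) ^ k * d.choose k := by
      rcases Nat.eq_zero_or_pos k with rfl | hk
      · simp
      refine le_of_mul_le_mul_left (a := k ^ k) ?_ (pow_pos hk k)
      calc k ^ k * (d + 1) ^ k = (k * (d + 1)) ^ k := by rw [mul_pow]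
        _ ≤ ((k + 1) * d) ^ k := Nat.pow_le_pow_left (by nlinarith) k
        _ = (k + 1) ^ k * d ^ k := by rw [mul_pow]
        _ ≤ (k + 1) ^ k * (k ^ k * d.choose k) := Nat.mul_le_mul_left _ (ih hkd')
        _ = k ^ k * ((k + 1) ^ k * d.choose k) := by ring
    calc (d + 1) ^ (k + 1) = (d + 1) * (d + 1) ^ k := by ring
      _ ≤ (d + 1) * ((k + 1) ^ k * d.choose k) := Nat.mul_le_mul_left _ key
      _ = (k + 1) ^ k * ((d + 1) * d.choose k) := by ring
      _ = (k + 1) ^ k * ((d + 1).choose (k + 1) * (k + 1)) := by rw [Nat.add_one_mul_choose_eq]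
      _ = (k + 1) ^ (k + 1) * (d + 1).choose (k + 1) := by ring

theorem GridRegular.sum_gram_pow_le [Nonempty X] [Nonempty Y] {f : X → Y → ℝ}
    (hf : ∀ x y, 0 ≤ f x y) {ε : ℝ} {d : ℕ} (hd : d ≠ 0)
    (hreg : GridRegular univ univ ε 2 d f) :
    ∑ x, ∑ x', (∑ y, f x y * f x' y) ^ d ≤
      (Fintype.card X : ℝ) ^ 2 * (Fintype.card Y : ℝ) ^ d *
        ((1 + ε) * density univ univ f) ^ (2 * d) := by
  have e : ∑ xs ∈ Fintype.piFinset (fun _ : Fin 2 => (univ : Finset X)),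
      ∑ ys ∈ Fintype.piFinset (fun _ : Fin d => (univ : Finset Y)),
      ∏ i : Fin 2, ∏ j : Fin d, f (xs i) (ys j) = ∑ x, ∑ x', (∑ y, f x y * f x' y) ^ d := by
    classical
    simp_rw [Fintype.piFinset_univ, Fin.prod_univ_two, ← prod_mul_distrib, Fintype.sum_pow]
    rw [← (finTwoArrowEquiv X).symm.sum_comp, Fintype.sum_prod_type]
    simp [finTwoArrowEquiv]
  unfold GridRegular gridNorm at hreg
  rw [e] at hreg
  simp only [card_univ] at hreg
  set S := ∑ x, ∑ x', (∑ y, f x y * f x' y) ^ d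
  have hS : 0 ≤ S := sum_nonneg fun x _ => sum_nonneg fun x' _ =>
    pow_nonneg (sum_nonneg fun y _ => mul_nonneg (hf _ _) (hf _ _)) _
  have hpos : 0 < (Fintype.card X : ℝ) ^ 2 * (Fintype.card Y : ℝ) ^ d := by positivity
  have hq : 0 ≤ S / ((Fintype.card X : ℝ) ^ 2 * (Fintype.card Y : ℝ) ^ d) := by positivity
  have h2 := pow_le_pow_left₀ (Real.rpow_nonneg hq _) hreg (2 * d)
  rw [← Real.rpow_natCast, ← Real.rpow_mul hq] at h2
  have h3 : (1 : ℝ) / (((2 : ℕ) : ℝ) * d) * ((2 * d : ℕ) : ℝ) = 1 := by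
    have : (d : ℝ) ≠ 0 := by exact_mod_cast hd
    push_cast; field_simp
  rw [h3, Real.rpow_one, div_le_iff₀ hpos] at h2
  linarith

theorem card_rowDeg_gt_le [Nonempty X] [Nonempty Y] {f : X → Y → ℝ}
    (hf : ∀ x y, 0 ≤ f x y) {ε : ℝ} (hε : 0 < ε) (hε' : ε < 1 / 80) {d : ℕ} (hd : d ≠ 0)
    (hα : 0 < density univ univ f) (hreg : GridRegular univ univ ε 2 d f) :
    ((univ.filter fun x => (1 + 6 * ε) * density univ univ f < rowDeg univ f x).card : ℝ) ≤
      Fintype.card X * Real.exp (-(4 * (ε * d))) := by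
  set α := density univ univ f
  have ha : ∀ x, 0 ≤ rowDeg univ f x := fun x =>
    div_nonneg (sum_nonneg fun y _ => hf x y) (Nat.cast_nonneg _)
  have h1 := (choose_mul_sum_le_sum_gram_pow f (Nat.zero_le d)).trans (hreg.sum_gram_pow_le hf hd)
  simp only [Nat.choose_zero_right, Nat.cast_one, one_mul, Nat.sub_zero, pow_zero, mul_one,
    ← sum_mul_sum] at h1
  have hn : (0 : ℝ) < (Fintype.card Y : ℝ) ^ d := by positivity
  have h2 : (∑ x, rowDeg univ f x ^ d) ^ 2 ≤ (Fintype.card X * ((1 + ε) * α) ^ d) ^ 2 := by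
    refine le_of_mul_le_mul_left ?_ hn
    calc _ = (Fintype.card Y : ℝ) ^ d * ((∑ x, rowDeg univ f x ^ d) *
          ∑ x, rowDeg univ f x ^ d) := by ring
      _ ≤ _ := h1
      _ = _ := by rw [mul_comm 2 d, pow_mul]; ring
  have h3 : ∑ x, rowDeg univ f x ^ d ≤ Fintype.card X * ((1 + ε) * α) ^ d :=
    le_of_sq_le_sq h2 (by positivity)
  have h4 := (card_filter_lt_mul_pow_le (rowDeg univ f) ha
    (t := (1 + 6 * ε) * α) (by positivity) d).trans h3
  have h5 : 1 + ε ≤ Real.exp (-(4 * ε)) * (1 + 6 * ε) := by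
    have := Real.add_one_le_exp (-(4 * ε))
    nlinarith
  refine le_of_mul_le_mul_right (a := ((1 + 6 * ε) * α) ^ d) (h4.trans ?_) (by positivity)
  calc Fintype.card X * ((1 + ε) * α) ^ d
      ≤ Fintype.card X * ((Real.exp (-(4 * ε)) * (1 + 6 * ε)) * α) ^ d := by gcongr
    _ = Fintype.card X * Real.exp (-(4 * (ε * d))) * ((1 + 6 * ε) * α) ^ d := by
        rw [mul_assoc, mul_pow, ← Real.exp_nat_mul]
        ring_nf

theorem sum_centered_gram_pow_le [Nonempty X] [Nonempty Y] {f : X → Y → ℝ}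
    (hf : ∀ x y, 0 ≤ f x y) {ε : ℝ} (hε : 0 < ε) (hε' : ε < 1 / 80) {d k : ℕ} (hd : d ≠ 0)
    (hα : 0 < density univ univ f) (hreg : GridRegular univ univ ε 2 d f)
    (hmin : MinDegree univ univ ε f) (hk : Even k) (hkd : k ≤ d)
    (hk' : (k : ℝ) ≤ 10 * (ε * d)) :
    ∑ x, ∑ x', (∑ y, (f x y - rowDeg univ f x) * (f x' y - rowDeg univ f x')) ^ k ≤
      (Fintype.card X : ℝ) ^ 2 * (Fintype.card Y : ℝ) ^ k * density univ univ f ^ (2 * k) *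
        (Real.exp (5 * (ε * d)) * (10 * ε) ^ k) := by
  set α := density univ univ f
  set n := (Fintype.card Y : ℝ) with hn
  set a := rowDeg univ f with ha
  set T := ∑ x, ∑ x', (∑ y, (f x y - a x) * (f x' y - a x')) ^ k with hT
  have hn0 : 0 < n := by positivity
  have hT0 : 0 ≤ T := sum_nonneg fun x _ => sum_nonneg fun x' _ => hk.pow_nonneg _
  have h1ε : 0 < 1 - ε := by linarith
  have h1 := (choose_mul_sum_le_sum_gram_pow f hkd).trans (hreg.sum_gram_pow_le hf hd)
  have h2 : ((1 - ε) * α) ^ (2 * (d - k)) * T ≤ ∑ x, ∑ x', a x ^ (d - k) * a x' ^ (d - k) *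
      (∑ y, (f x y - a x) * (f x' y - a x')) ^ k := by
    rw [hT, mul_sum]
    refine sum_le_sum fun x _ => ?_
    rw [mul_sum]
    refine sum_le_sum fun x' _ => ?_
    refine mul_le_mul_of_nonneg_right ?_ (hk.pow_nonneg _)
    rw [two_mul, pow_add]
    have hx := hmin x (mem_univ _)
    have hx' := hmin x' (mem_univ _)
    have h0 : 0 ≤ (1 - ε) * α := by positivity
    exact mul_le_mul (pow_le_pow_left₀ h0 hx _) (pow_le_pow_left₀ h0 hx' _) (by positivity)
      (pow_nonneg (h0.trans hx) _)
  have h3 : (d.choose k : ℝ) * (n ^ (d - k) * (((1 - ε) * α) ^ (2 * (d - k)) * T)) ≤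
      (Fintype.card X : ℝ) ^ 2 * n ^ d * ((1 + ε) * α) ^ (2 * d) :=
    le_trans (by gcongr) h1
  have h4 : (1 : ℝ) ≤ (10 * ε) ^ k * d.choose k := by
    have hc : (d : ℝ) ^ k ≤ (k : ℝ) ^ k * d.choose k := by
      exact_mod_cast pow_le_pow_self_mul_choose hkd
    have hdpos : (0 : ℝ) < (d : ℝ) ^ k := by positivity
    refine le_of_mul_le_mul_right (a := (d : ℝ) ^ k) ?_ hdpos
    calc 1 * (d : ℝ) ^ k ≤ (k : ℝ) ^ k * d.choose k := by linarith
      _ ≤ (10 * (ε * d)) ^ k * d.choose k := by gcongr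
      _ = (10 * ε) ^ k * d.choose k * (d : ℝ) ^ k := by rw [← mul_assoc, mul_pow]; ring
  have h5 : (1 + ε) ^ (2 * d) ≤ Real.exp (5 * (ε * d)) * (1 - ε) ^ (2 * (d - k)) := by
    have hb : (1 + ε) ^ 2 ≤ Real.exp (5 * ε) * (1 - ε) ^ 2 := by
      have := Real.add_one_le_exp (5 * ε)
      have h6 : (5 * ε + 1) * (1 - ε) ^ 2 ≤ Real.exp (5 * ε) * (1 - ε) ^ 2 := by gcongr
      have : 0 < ε ^ 3 := by positivity
      nlinarith
    calc (1 + ε) ^ (2 * d) = ((1 + ε) ^ 2) ^ d := pow_mul _ _ _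
      _ ≤ (Real.exp (5 * ε) * (1 - ε) ^ 2) ^ d := by gcongr
      _ = Real.exp (5 * (ε * d)) * (1 - ε) ^ (2 * d) := by
          rw [mul_pow, ← Real.exp_nat_mul, ← pow_mul]; ring_nf
      _ ≤ Real.exp (5 * (ε * d)) * (1 - ε) ^ (2 * (d - k)) := by
          gcongr ?_ * ?_
          exact pow_le_pow_of_le_one h1ε.le (by linarith) (by omega)
  have hα2 : α ^ (2 * d) = α ^ (2 * (d - k)) * α ^ (2 * k) := by
    rw [← pow_add]; congr 1; omega
  have hnd : n ^ d = n ^ (d - k) * n ^ k := by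
    rw [← pow_add]; congr 1; omega
  have hD : 0 < n ^ (d - k) * ((1 - ε) * α) ^ (2 * (d - k)) := by positivity
  refine le_of_mul_le_mul_left (a := n ^ (d - k) * ((1 - ε) * α) ^ (2 * (d - k))) ?_ hD
  calc n ^ (d - k) * ((1 - ε) * α) ^ (2 * (d - k)) * T
      ≤ ((10 * ε) ^ k * d.choose k) * (n ^ (d - k) * ((1 - ε) * α) ^ (2 * (d - k)) * T) :=
        le_mul_of_one_le_left (by positivity) h4
    _ = (10 * ε) ^ k * (d.choose k * (n ^ (d - k) * (((1 - ε) * α) ^ (2 * (d - k)) * T))) := by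
        ring
    _ ≤ (10 * ε) ^ k * ((Fintype.card X : ℝ) ^ 2 * n ^ d * ((1 + ε) * α) ^ (2 * d)) := by gcongr
    _ = (10 * ε) ^ k * ((Fintype.card X : ℝ) ^ 2 * n ^ d * ((1 + ε) ^ (2 * d) * α ^ (2 * d))) := by
        rw [mul_pow (1 + ε)]
    _ ≤ (10 * ε) ^ k * ((Fintype.card X : ℝ) ^ 2 * n ^ d *
          ((Real.exp (5 * (ε * d)) * (1 - ε) ^ (2 * (d - k))) * α ^ (2 * d))) := by gcongr
    _ = _ := by rw [hα2, hnd, mul_pow (1 - ε)]; ring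

theorem card_centered_inner_gt_le [Nonempty X] [Nonempty Y] [Nonempty Z]
    {f : X → Y → ℝ} {h : Z → Y → ℝ} (hf : ∀ x y, 0 ≤ f x y) (hh : ∀ z y, 0 ≤ h z y)
    {ε : ℝ} (hε : 0 < ε) (hε' : ε < 1 / 80) {d : ℕ} (hd : 2 ≤ ε * d)
    (hα : 0 < density univ univ f) (hβ : 0 < density univ univ h)
    (hfreg : GridRegular univ univ ε 2 d f) (hhreg : GridRegular univ univ ε 2 d h)
    (hfmin : MinDegree univ univ ε f) (hhmin : MinDegree univ univ ε h) :
    ((univ.filter fun p : X × Z =>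
      60 * ε * (Fintype.card Y * (density univ univ f * density univ univ h)) <
        |∑ y, (f p.1 y - rowDeg univ f p.1) * (h p.2 y - rowDeg univ h p.2)|).card : ℝ) ≤
      Fintype.card X * Fintype.card Z * Real.exp (-(4 * (ε * d))) := by
  have hd0 : d ≠ 0 := by rintro rfl; norm_num at hd
  obtain ⟨k, hk, hk1, hk2⟩ : ∃ k : ℕ, Even k ∧ 9 * (ε * d) ≤ k ∧ (k : ℝ) ≤ 10 * (ε * d) := by
    refine ⟨2 * ⌊5 * (ε * d)⌋₊, even_two_mul _, ?_, ?_⟩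
    · have := Nat.lt_floor_add_one (5 * (ε * d))
      push_cast; linarith
    · have := Nat.floor_le (a := 5 * (ε * d)) (by linarith)
      push_cast; linarith
  have hkd : k ≤ d := by
    have : (k : ℝ) ≤ d := by
      have : (0 : ℝ) ≤ d := Nat.cast_nonneg d
      nlinarith
    exact_mod_cast this
  have hF := sum_centered_gram_pow_le hf hε hε' hd0 hα hfreg hfmin hk hkd hk2
  have hH := sum_centered_gram_pow_le hh hε hε' hd0 hβ hhreg hhmin hk hkd hk2
  have hCS := sum_inner_pow_sq_le (fun x y => f x y - rowDeg univ f x)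
    (fun z y => h z y - rowDeg univ h z) k
  set α := density univ univ f
  set β := density univ univ h
  set n := (Fintype.card Y : ℝ) with hn
  set N := (Fintype.card X : ℝ) with hN
  set Q := (Fintype.card Z : ℝ) with hQ
  set E := Real.exp (5 * (ε * d)) * (10 * ε) ^ k with hE
  set G : X × Z → ℝ := fun p => ∑ y, (f p.1 y - rowDeg univ f p.1) * (h p.2 y - rowDeg univ h p.2)
    with hG
  have hn0 : 0 < n := by positivity
  have hsum : ∑ p, |G p| ^ k ≤ N * Q * E * (n * (α * β)) ^ k := by
    have e : ∑ p, |G p| ^ k = ∑ x, ∑ z,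
        (∑ y, (f x y - rowDeg univ f x) * (h z y - rowDeg univ h z)) ^ k := by
      simp_rw [hk.pow_abs, Fintype.sum_prod_type, hG]
    rw [e]
    refine le_of_sq_le_sq ?_ (by positivity)
    refine (hCS.trans (mul_le_mul hF hH
      (sum_nonneg fun x _ => sum_nonneg fun x' _ => hk.pow_nonneg _) (by positivity))).trans_eq ?_
    rw [mul_pow n, mul_pow α]
    ring
  have hM := (card_filter_lt_mul_pow_le (fun p => |G p|) (fun p => abs_nonneg _)
    (t := 60 * ε * (n * (α * β))) (by positivity) k).trans hsum
  have h6 : E ≤ Real.exp (-(4 * (ε * d))) * (60 * ε) ^ k := by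
    have h7 : Real.exp k ≤ 6 ^ k := by
      have h8 : Real.exp 1 ≤ 6 := by linarith [Real.exp_one_lt_d9]
      calc Real.exp k = Real.exp 1 ^ k := by rw [← Real.exp_nat_mul, mul_one]
        _ ≤ 6 ^ k := by gcongr
    calc E ≤ (Real.exp (-(4 * (ε * d))) * Real.exp k) * (10 * ε) ^ k := by
          rw [hE, ← Real.exp_add]
          gcongr
          linarith
      _ ≤ (Real.exp (-(4 * (ε * d))) * 6 ^ k) * (10 * ε) ^ k := by gcongr
      _ = _ := by
          rw [mul_assoc, ← mul_pow]
          ring_nf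
  refine le_of_mul_le_mul_right (a := (60 * ε * (n * (α * β))) ^ k) (hM.trans ?_) (by positivity)
  calc N * Q * E * (n * (α * β)) ^ k
      ≤ N * Q * (Real.exp (-(4 * (ε * d))) * (60 * ε) ^ k) * (n * (α * β)) ^ k := by gcongr
    _ = _ := by rw [mul_pow (60 * ε)]; ring

theorem three_mul_exp_neg_le {s : ℝ} (hs : 2 ≤ s) :
    3 * Real.exp (-(4 * s)) ≤ (2 : ℝ) ^ (-(s / 2)) := by
  rw [Real.rpow_def_of_pos two_pos]
  have h3 : (3 : ℝ) ≤ Real.exp (3 * s) := by linarith [Real.add_one_le_exp (3 * s)]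
  have hlog : Real.log 2 < 1 := by linarith [Real.log_two_lt_d9]
  calc 3 * Real.exp (-(4 * s)) ≤ Real.exp (3 * s) * Real.exp (-(4 * s)) := by gcongr
    _ = Real.exp (-s) := by rw [← Real.exp_add]; ring_nf
    _ ≤ _ := Real.exp_le_exp.2 (by nlinarith)

theorem density_nonneg {f : X → Y → ℝ} (hf : ∀ x y, 0 ≤ f x y) : 0 ≤ density univ univ f :=
  div_nonneg (sum_nonneg fun x _ => sum_nonneg fun y _ => hf x y) (by positivity)

theorem density_eq_zero_iff [Nonempty X] [Nonempty Y] {f : X → Y → ℝ} (hf : ∀ x y, 0 ≤ f x y) :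
    density univ univ f = 0 ↔ ∀ x y, f x y = 0 := by
  have hcard : ((univ : Finset X).card : ℝ) * (univ : Finset Y).card ≠ 0 := by
    simp only [card_univ]; positivity
  rw [density, div_eq_zero_iff, or_iff_left hcard,
    sum_eq_zero_iff_of_nonneg fun x _ => sum_nonneg fun y _ => hf x y]
  simp [sum_eq_zero_iff_of_nonneg fun y _ => hf _ y]

theorem density_transpose (f : X → Y → ℝ) :
    density univ univ (fun y x => f x y) = density univ univ f := by
  rw [density, density, sum_comm, mul_comm]

/-- The pointwise estimate: a small centered inner product and bounded degrees force the
entry of the product to be close to the product of the densities. -/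
theorem product_entry_mem {ε α β a b c : ℝ} (hε : 0 < ε) (hε' : ε < 1 / 80) (hα : 0 < α)
    (hβ : 0 < β) (ha : (1 - ε) * α ≤ a) (ha' : a ≤ (1 + 6 * ε) * α) (hb : (1 - ε) * β ≤ b)
    (hb' : b ≤ (1 + 6 * ε) * β) (hc : |c| ≤ 60 * ε * (α * β)) :
    (1 - 80 * ε) * (α * β) ≤ c + a * b ∧ c + a * b ≤ (1 + 80 * ε) * (α * β) := by
  have h1ε : 0 < 1 - ε := by linarith
  have hαβ : 0 < α * β := by positivity
  have ha0 : 0 ≤ a := le_trans (by positivity) ha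
  have hb0 : 0 ≤ b := le_trans (by positivity) hb
  have lo : ((1 - ε) * α) * ((1 - ε) * β) ≤ a * b := mul_le_mul ha hb (by positivity) ha0
  have hi : a * b ≤ ((1 + 6 * ε) * α) * ((1 + 6 * ε) * β) := mul_le_mul ha' hb' hb0 (by positivity)
  obtain ⟨hc1, hc2⟩ := abs_le.1 hc
  have lo' : (1 - 2 * ε) * (α * β) ≤ ((1 - ε) * α) * ((1 - ε) * β) := by
    have : 1 - 2 * ε ≤ (1 - ε) * (1 - ε) := by nlinarith
    nlinarith
  have hi' : ((1 + 6 * ε) * α) * ((1 + 6 * ε) * β) ≤ (1 + 20 * ε) * (α * β) := by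
    have : (1 + 6 * ε) * (1 + 6 * ε) ≤ 1 + 20 * ε := by nlinarith
    nlinarith
  have : 0 < ε * (α * β) := by positivity
  constructor <;> nlinarith

end Aux

/-- **Regular matrices have uniform products (Kelley–Lovett–Meka).** If
`A ∈ ℝ_{≥0}^{X×Y}` and `B ∈ ℝ_{≥0}^{Y×Z}`, `ε ∈ (0,1/80)`, `d ≥ 2/ε`, and `A` and `Bᵀ` are
`(ε,2,d)`-regular and `ε`-min-degree, then `A ∘ B` is
`(E[A]·E[B], 80ε, 2^{−εd/2})`-uniform. -/
theorem regular_product {X Y Z : Type*} [Fintype X] [Fintype Y] [Fintype Z]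
    [Nonempty X] [Nonempty Y] [Nonempty Z]
    (A : X → Y → ℝ) (B : Y → Z → ℝ)
    (hA : ∀ x y, 0 ≤ A x y) (hB : ∀ y z, 0 ≤ B y z)
    (ε : ℝ) (hε : ε ∈ Set.Ioo (0 : ℝ) (1/80)) (d : ℕ) (hd : 2 / ε ≤ (d : ℝ))
    (hAreg : GridRegular Finset.univ Finset.univ ε 2 d A)
    (hBreg : GridRegular Finset.univ Finset.univ ε 2 d (fun z y => B y z))
    (hAmin : MinDegree Finset.univ Finset.univ ε A)
    (hBmin : MinDegree Finset.univ Finset.univ ε (fun z y => B y z)) :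
    IsUniform (scaledProd A B)
      (density Finset.univ Finset.univ A * density Finset.univ Finset.univ B)
      (80 * ε) ((2 : ℝ) ^ (-(ε * (d : ℝ) / 2))) := by
  classical
  obtain ⟨hε0, hε1⟩ := hε
  have hs : 2 ≤ ε * d := by rw [div_le_iff₀ hε0] at hd; linarith
  have hd0 : d ≠ 0 := by rintro rfl; norm_num at hs
  have hC : ∀ z y, 0 ≤ (fun z y => B y z) z y := fun z y => hB y z
  rw [← density_transpose B]
  unfold IsUniform
  set C : Z → Y → ℝ := fun z y => B y z with hCdef
  set α := density univ univ A
  set β := density univ univ C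
  set δ := (2 : ℝ) ^ (-(ε * (d : ℝ) / 2)) with hδ
  have hδ0 : 0 < δ := by positivity
  have hn : (0 : ℝ) < Fintype.card Y := by positivity
  set good := univ.filter fun p : X × Z => (1 - 80 * ε) * (α * β) ≤ scaledProd A B p.1 p.2 ∧
    scaledProd A B p.1 p.2 ≤ (1 + 80 * ε) * (α * β)
  suffices (1 - δ) * ((Fintype.card X : ℝ) * Fintype.card Z) ≤ good.card by
    convert this
  by_cases hzero : α = 0 ∨ β = 0
  · have hprod : ∀ x z, scaledProd A B x z = 0 := by
      intro x z
      rcases hzero with h0 | h0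
      · simp [scaledProd, (density_eq_zero_iff hA).1 h0]
      · have h1 : ∀ z y, B y z = 0 := (density_eq_zero_iff hC).1 h0
        simp [scaledProd, h1]
    have hαβ : α * β = 0 := mul_eq_zero.2 hzero
    have hgood : good = univ := filter_true_of_mem fun p _ => by simp [hprod, hαβ]
    rw [hgood, card_univ, Fintype.card_prod, Nat.cast_mul]
    exact mul_le_of_le_one_left (by positivity) (by linarith)
  push Not at hzero
  have hα : 0 < α := (density_nonneg hA).lt_of_ne' hzero.1
  have hβ : 0 < β := (density_nonneg hC).lt_of_ne' hzero.2
  have hXb := card_rowDeg_gt_le hA hε0 hε1 hd0 hα hAreg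
  have hZb := card_rowDeg_gt_le hC hε0 hε1 hd0 hβ hBreg
  have hW := card_centered_inner_gt_le hA hC hε0 hε1 hs hα hβ hAreg hBreg hAmin hBmin
  set Xb := univ.filter fun x => (1 + 6 * ε) * α < rowDeg univ A x
  set Zb := univ.filter fun z => (1 + 6 * ε) * β < rowDeg univ C z
  set W := univ.filter fun p : X × Z => 60 * ε * (Fintype.card Y * (α * β)) <
    |∑ y, (A p.1 y - rowDeg univ A p.1) * (C p.2 y - rowDeg univ C p.2)|
  have hcover : univ ⊆ good ∪ (Xb ×ˢ univ ∪ univ ×ˢ Zb ∪ W) := by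
    rintro ⟨x, z⟩ -
    by_contra hnot
    simp only [mem_union, mem_product, mem_univ, and_true, true_and, not_or, Xb, Zb, W, good,
      mem_filter, not_lt] at hnot
    obtain ⟨hg, ⟨hx, hz⟩, hw⟩ := hnot
    refine hg ?_
    set c := ∑ y, (A x y - rowDeg univ A x) * (C z y - rowDeg univ C z) with hc
    have hentry : scaledProd A B x z =
        c / Fintype.card Y + rowDeg univ A x * rowDeg univ C z := by
      rw [hc, sum_sub_rowDeg_mul_sub_rowDeg, scaledProd]
      field_simp
      ring
    rw [hentry]
    refine product_entry_mem hε0 hε1 hα hβ (hAmin x (mem_univ _)) hx (hBmin z (mem_univ _)) hz ?_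
    rw [abs_div, abs_of_pos hn, div_le_iff₀ hn]
    linarith
  have hcard : (Fintype.card X * Fintype.card Z : ℝ) ≤
      good.card + (Xb.card * Fintype.card Z + Fintype.card X * Zb.card + W.card) := by
    have h1 := (card_le_card hcover).trans ((card_union_le _ _).trans
      (Nat.add_le_add_left ((card_union_le _ _).trans
        (Nat.add_le_add_right (card_union_le _ _) _)) _))
    simp only [card_product, card_univ, Fintype.card_prod] at h1
    exact_mod_cast h1
  have hδ3 := three_mul_exp_neg_le hs
  rw [← hδ] at hδ3
  have hXZ : (0 : ℝ) ≤ Fintype.card X * Fintype.card Z := by positivity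
  have b1 : (Xb.card * Fintype.card Z : ℝ) ≤
      Fintype.card X * Real.exp (-(4 * (ε * d))) * Fintype.card Z := by gcongr
  have b2 : (Fintype.card X * Zb.card : ℝ) ≤
      Fintype.card X * (Fintype.card Z * Real.exp (-(4 * (ε * d)))) := by gcongr
  nlinarith [mul_le_mul_of_nonneg_left hδ3 hXZ]
end
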